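/- Let 1 < p, q < ∞, 1 ≤ r, s ≤ 2 with max(r,s) = 2, let t = rs/(r+s), and fix φ and φ_i as in the context. There exists a constant C such that for all sequences (f_i)_{i∈ℤ} and (g_j)_{j∈ℤ} of measurable functions on ℝ with ‖(f_i)‖_{p,r} < ∞ and ‖(g_j)‖_{q,s} < ∞, every jump collection (N_k)_{k≥0}, and every λ > 0, one has ‖ λ · (#{k ≥ 1 : |Σ_{N_{k−1}(x) < i < j ≤ N_k(x)} (φ_i * f_i)(x) (φ_j * g_j)(x)| > λ})^{1/t} ‖_{pq/(p+q)} ≤ C ‖(f_i)‖_{p,r} ‖(g_j)‖_{q,s}. -/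

import Mathlib

open MeasureTheory ENNReal
open scoped FourierTransform NNReal

noncomputable section

/-- A jump collection: a sequence of measurable integer-valued functions on `ℝ`,
nondecreasing in the index. -/
def IsJumpCollection (Nk : ℕ → ℝ → ℤ) : Prop :=
  (∀ k, Measurable (Nk k)) ∧ ∀ (k : ℕ) (x : ℝ), Nk k x ≤ Nk (k + 1) x

/-- The dilate `φ_i(x) = 2^i φ(2^i x)` of a Schwartz function `φ`. -/
def dilate (φ : SchwartzMap ℝ ℂ) (i : ℤ) : ℝ → ℂ :=
  fun x => ((2 : ℝ) ^ i : ℝ) • φ (((2 : ℝ) ^ i) * x)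

/-- Convolution `(φ_i * h)(x) = ∫ φ_i(x - y) h(y) dy`. -/
def conv (φi : ℝ → ℂ) (h : ℝ → ℂ) : ℝ → ℂ :=
  fun x => ∫ y : ℝ, φi (x - y) * h y

/-- The mixed norm `‖(f_i)‖_{p,r} = ‖(∑_i |f_i|^r)^(1/r)‖_{L^p}`. -/
def mixedNorm (p r : ℝ) (f : ℤ → ℝ → ℂ) : ℝ≥0∞ :=
  (∫⁻ x : ℝ, ((∑' i : ℤ, (ENNReal.ofReal ‖f i x‖) ^ r) ^ (1 / r)) ^ p) ^ (1 / p)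

/-! ### Pathwise part -/

/-- discrete area -/
def area (M N : ℕ → ℂ) (a n : ℕ) : ℂ :=
  ∑ j ∈ Finset.Ico a n, (M j - M a) * (N (j + 1) - N j)

lemma area_self (M N : ℕ → ℂ) (a : ℕ) : area M N a a = 0 := by simp [area]

lemma area_succ (M N : ℕ → ℂ) {a n : ℕ} (h : a ≤ n) :
    area M N a (n + 1) = area M N a n + (M n - M a) * (N (n + 1) - N n) := by
  simp [area, Finset.sum_Ico_succ_top h]

/-- machine state -/
structure MSt where
  A : ℂ
  B : ℂ
  Q : ℂ
  c : ℕ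

open Classical in
/-- machine step -/
def mstep (s : MSt) (dM dN : ℂ) (d e : ℝ) : MSt :=
  if 1 < d ∨ 1 < e then ⟨0, 0, 0, s.c⟩
  else if 1 < ‖s.A + dM‖ ∨ 1 < ‖s.B + dN‖ ∨ 1 < ‖s.Q + s.A * dN‖ then ⟨0, 0, 0, s.c + 1⟩
  else ⟨s.A + dM, s.B + dN, s.Q + s.A * dN, s.c⟩

/-- the machine -/
def mach (M N : ℕ → ℂ) (D E : ℕ → ℝ) : ℕ → MSt
  | 0 => ⟨0, 0, 0, 0⟩
  | n + 1 => mstep (mach M N D E n) (M (n + 1) - M n) (N (n + 1) - N n) (D (n + 1)) (E (n + 1))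

lemma mach_succ (M N : ℕ → ℂ) (D E : ℕ → ℝ) (n : ℕ) : mach M N D E (n + 1) =
    mstep (mach M N D E n) (M (n + 1) - M n) (N (n + 1) - N n) (D (n + 1)) (E (n + 1)) := rfl

lemma mach_bd (M N : ℕ → ℂ) (D E : ℕ → ℝ) (n : ℕ) :
    ‖(mach M N D E n).A‖ ≤ 1 ∧ ‖(mach M N D E n).B‖ ≤ 1 ∧ ‖(mach M N D E n).Q‖ ≤ 1 := by
  cases n with
  | zero => simp [mach]
  | succ n =>
    rw [mach_succ, mstep]
    split_ifs with h1 h2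
    · simp
    · simp
    · push Not at h2
      exact h2

lemma mach_c_succ (M N : ℕ → ℂ) (D E : ℕ → ℝ) (n : ℕ) :
    (mach M N D E n).c ≤ (mach M N D E (n + 1)).c := by
  rw [mach_succ, mstep]
  split_ifs <;> simp

lemma mach_c_mono (M N : ℕ → ℂ) (D E : ℕ → ℝ) : Monotone (fun n => (mach M N D E n).c) :=
  monotone_nat_of_le_succ (mach_c_succ M N D E)

lemma mach_track (M N : ℕ → ℂ) (D E : ℕ → ℝ)
    (hM : ∀ n, ‖M (n + 1) - M n‖ ≤ D (n + 1)) (hN : ∀ n, ‖N (n + 1) - N n‖ ≤ E (n + 1))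
    (a n : ℕ) (han : a ≤ n) (hcl : ∀ k, a < k → k ≤ n → D k ≤ 1 ∧ E k ≤ 1)
    (hc : (mach M N D E n).c ≤ (mach M N D E a).c + 2) :
    ‖M n - M a - (mach M N D E n).A‖ ≤ 1 + 2 * ((mach M N D E n).c - (mach M N D E a).c : ℝ) ∧
    ‖N n - N a - (mach M N D E n).B‖ ≤ 1 + 2 * ((mach M N D E n).c - (mach M N D E a).c : ℝ) ∧
    ‖area M N a n - (mach M N D E n).Q -
      (M n - M a - (mach M N D E n).A) * (mach M N D E n).B‖ ≤
        2 + 8 * ((mach M N D E n).c - (mach M N D E a).c : ℝ) := by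
  induction n, han using Nat.le_induction with
  | base =>
    obtain ⟨h1, h2, h3⟩ := mach_bd M N D E a
    simp only [sub_self, zero_sub, norm_neg, area_self, mul_zero, add_zero]
    refine ⟨h1, h2, ?_⟩
    refine (norm_sub_le _ _).trans ?_
    rw [norm_neg, norm_mul, norm_neg]
    nlinarith [norm_nonneg (mach M N D E a).A, norm_nonneg (mach M N D E a).B]
  | succ n hn ih =>
    have hcn := (mach_c_succ M N D E n).trans hc
    obtain ⟨i1, i2, i3⟩ := ih (fun k h1 h2 => hcl k h1 (by omega)) hcn
    obtain ⟨b1, b2, b3⟩ := mach_bd M N D E n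
    have cm : (mach M N D E a).c ≤ (mach M N D E n).c := mach_c_mono M N D E hn
    obtain ⟨c1, c2⟩ := hcl (n + 1) (by omega) le_rfl
    have hdM := (hM n).trans c1
    have hdN := (hN n).trans c2
    rw [area_succ M N hn]
    have hs := mach_succ M N D E n
    rw [mstep, if_neg (by push Not; exact ⟨c1, c2⟩)] at hs
    set s := mach M N D E n with hsdef
    set dM := M (n + 1) - M n with hdMd
    set dN := N (n + 1) - N n with hdNd
    set ca := (mach M N D E a).c with hca
    split_ifs at hs with h2
    · rw [hs] at hc ⊢
      simp only at hc
      have hj : (s.c : ℝ) - ca ≤ 1 := by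
        have : (s.c : ℝ) + 1 ≤ ca + 2 := by exact_mod_cast hc
        linarith
      have hj0 : (0 : ℝ) ≤ (s.c : ℝ) - ca := by
        have : (ca : ℝ) ≤ s.c := by exact_mod_cast cm
        linarith
      simp only [Nat.cast_add, Nat.cast_one, sub_zero, mul_zero]
      refine ⟨?_, ?_, ?_⟩
      · have : M (n + 1) - M a = (M n - M a - s.A) + (s.A + dM) := by rw [hdMd]; ring
        rw [this]
        refine (norm_add_le _ _).trans ?_
        have := norm_add_le s.A dM
        linarith
      · have : N (n + 1) - N a = (N n - N a - s.B) + (s.B + dN) := by rw [hdNd]; ring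
        rw [this]
        refine (norm_add_le _ _).trans ?_
        have := norm_add_le s.B dN
        linarith
      · have : area M N a n + (M n - M a) * dN =
          (area M N a n - s.Q - (M n - M a - s.A) * s.B) + (s.Q + s.A * dN) +
            (M n - M a - s.A) * (s.B + dN) := by ring
        rw [this]
        refine (norm_add₃_le).trans ?_
        have e1 : ‖s.Q + s.A * dN‖ ≤ 2 := by
          refine (norm_add_le _ _).trans ?_
          rw [norm_mul]
          nlinarith [norm_nonneg s.A, norm_nonneg dN]
        have e2 : ‖(M n - M a - s.A) * (s.B + dN)‖ ≤ 3 * 2 := by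
          rw [norm_mul]
          refine mul_le_mul (by linarith) ?_ (norm_nonneg _) (by norm_num)
          have := norm_add_le s.B dN
          linarith
        linarith
    · rw [hs]
      simp only
      have e1 : M (n + 1) - M a - (s.A + dM) = M n - M a - s.A := by rw [hdMd]; ring
      have e2 : N (n + 1) - N a - (s.B + dN) = N n - N a - s.B := by rw [hdNd]; ring
      have e3 : area M N a n + (M n - M a) * dN - (s.Q + s.A * dN) -
        (M n - M a - s.A) * (s.B + dN) = area M N a n - s.Q - (M n - M a - s.A) * s.B := by ring
      rw [e1, e2, e3]
      exact ⟨i1, i2, i3⟩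

lemma mach_few (M N : ℕ → ℂ) (D E : ℕ → ℝ)
    (hM : ∀ n, ‖M (n + 1) - M n‖ ≤ D (n + 1)) (hN : ∀ n, ‖N (n + 1) - N n‖ ≤ E (n + 1))
    (a n : ℕ) (han : a ≤ n) (hcl : ∀ k, a < k → k ≤ n → D k ≤ 1 ∧ E k ≤ 1)
    (hc : (mach M N D E n).c ≤ (mach M N D E a).c + 2) :
    ‖M n - M a‖ ≤ 6 ∧ ‖N n - N a‖ ≤ 6 ∧ ‖area M N a n‖ ≤ 36 := by
  obtain ⟨i1, i2, i3⟩ := mach_track M N D E hM hN a n han hcl hc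
  obtain ⟨b1, b2, b3⟩ := mach_bd M N D E n
  have hj : ((mach M N D E n).c : ℝ) ≤ (mach M N D E a).c + 2 := by exact_mod_cast hc
  set s := mach M N D E n
  have a1 := norm_add_le (M n - M a - s.A) s.A
  have a2 := norm_add_le (N n - N a - s.B) s.B
  rw [sub_add_cancel] at a1 a2
  have a3 : area M N a n = (area M N a n - s.Q - (M n - M a - s.A) * s.B) + s.Q +
    (M n - M a - s.A) * s.B := by ring
  refine ⟨by linarith, by linarith, ?_⟩
  rw [a3]
  refine (norm_add₃_le).trans ?_
  rw [norm_mul]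
  have : ‖M n - M a - s.A‖ * ‖s.B‖ ≤ 5 * 1 :=
    mul_le_mul (by linarith) b2 (norm_nonneg _) (by norm_num)
  linarith

/-- chains of big intervals -/
inductive Chain (big : ℕ → ℕ → Prop) : ℕ → ℕ → Prop
  | nil (b : ℕ) : Chain big 0 b
  | cons {m a' a b : ℕ} : Chain big m a' → a' ≤ a → a < b → big a b → Chain big (m + 1) b

lemma Chain.count {big : ℕ → ℕ → Prop} {T : ℕ} {e : ℕ → ℝ} (he : Monotone e) (h0 : 0 ≤ e 0)
    (hb : ∀ a b, a < b → b ≤ T → big a b → e a + 3 ≤ e b) {m b : ℕ} (h : Chain big m b)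
    (hbT : b ≤ T) : 3 * (m : ℝ) ≤ e b := by
  induction h with
  | nil b => simpa using h0.trans (he (Nat.zero_le b))
  | cons hc h1 h2 h3 ih =>
    have := ih (by omega)
    have h4 := hb _ _ h2 hbT h3
    have h5 := he h1
    push_cast
    linarith

lemma Chain.down {big : ℕ → ℕ → Prop} {m b : ℕ} (h : Chain big m b) :
    ∀ k ≤ m, ∃ b' ≤ b, Chain big k b' := by
  induction h with
  | nil b =>
    intro k hk
    obtain rfl : k = 0 := by omega
    exact ⟨b, le_rfl, .nil b⟩
  | @cons m a' a b hc h1 h2 h3 ih =>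
    intro k hk
    rcases Nat.lt_or_ge m k with h | h
    · obtain rfl : k = m + 1 := by omega
      exact ⟨b, le_rfl, .cons hc h1 h2 h3⟩
    · obtain ⟨b', hb', h'⟩ := ih k h
      exact ⟨b', by omega, h'⟩

/-- big interval for a pair of paths -/
def bigMN (M N : ℕ → ℂ) (a b : ℕ) : Prop :=
  ∃ n, a ≤ n ∧ n ≤ b ∧ (1 < ‖M n - M a‖ ∨ 1 < ‖N n - N a‖ ∨ 1 < ‖area M N a n‖)

lemma mach_chain (M N : ℕ → ℂ) (D E : ℕ → ℝ) (n : ℕ) :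
    ∃ τ ≤ n, ∃ e ≤ τ, Chain (bigMN M N) (mach M N D E n).c e ∧
      (mach M N D E n).A = M n - M τ ∧ (mach M N D E n).B = N n - N τ ∧
      (mach M N D E n).Q = area M N τ n := by
  induction n with
  | zero => exact ⟨0, le_rfl, 0, le_rfl, .nil 0, by simp [mach], by simp [mach], by simp [mach, area]⟩
  | succ n ih =>
    obtain ⟨τ, hτ, e, he, hch, hA, hB, hQ⟩ := ih
    rw [mach_succ, mstep]
    split_ifs with h1 h2
    · exact ⟨n + 1, le_rfl, e, by omega, hch, by simp, by simp, by simp [area]⟩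
    · refine ⟨n + 1, le_rfl, n + 1, le_rfl, ?_, by simp, by simp, by simp [area]⟩
      refine .cons hch he (by omega) ⟨n + 1, by omega, le_rfl, ?_⟩
      rw [hA, hB, hQ, ← area_succ M N hτ] at h2
      rcases h2 with h | h | h
      · left; convert h using 2; ring
      · right; left; convert h using 2; ring
      · right; right; exact h
    · refine ⟨τ, by omega, e, he, hch, ?_, ?_, ?_⟩
      · simp only [hA]; ring
      · simp only [hB]; ring
      · simp only [hA, hQ]; rw [area_succ M N hτ]

lemma mach_chain' (M N : ℕ → ℂ) (D E : ℕ → ℝ) (n m : ℕ) (h : m ≤ (mach M N D E n).c) :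
    ∃ b ≤ n, Chain (bigMN M N) m b := by
  obtain ⟨τ, hτ, e, he, hch, -⟩ := mach_chain M N D E n
  obtain ⟨b, hb, h'⟩ := hch.down m h
  exact ⟨b, by omega, h'⟩

lemma area_smul (c : ℝ) (M N : ℕ → ℂ) (a n : ℕ) :
    area (fun n => (c : ℂ) * M n) (fun n => (c : ℂ) * N n) a n = (c : ℂ) * c * area M N a n := by
  simp only [area, Finset.mul_sum]
  refine Finset.sum_congr rfl fun j _ => ?_
  ring

/-- Counting: a long chain with small total `h` forces many machine counts. -/
lemma chain_forces (M N : ℕ → ℂ) (D E : ℕ → ℝ) (hD0 : ∀ n, 0 ≤ D n) (hE0 : ∀ n, 0 ≤ E n)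
    (hM : ∀ n, ‖M (n + 1) - M n‖ ≤ D (n + 1)) (hN : ∀ n, ‖N (n + 1) - N n‖ ≤ E (n + 1))
    (r s : ℝ) (hr : 1 ≤ r) (hr2 : r ≤ 2) (hs : 1 ≤ s) (hs2 : s ≤ 2)
    (big : ℕ → ℕ → Prop) (T m b : ℕ)
    (hbig : ∀ a b, a < b → b ≤ T → big a b →
      ∑ k ∈ Finset.Icc a b, (D k ^ r + E k ^ s) ≤ 1 / 36 → bigMN M N a b)
    (hch : Chain big m b) (hbT : b ≤ T)
    (hH : 216 * ∑ k ∈ Finset.range (T + 1), (D k ^ r + E k ^ s) ≤ m) :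
    2 * m ≤ (mach (fun n => ((6 : ℝ) : ℂ) * M n) (fun n => ((6 : ℝ) : ℂ) * N n)
      (fun n => 6 * D n) (fun n => 6 * E n) T).c := by
  set h : ℕ → ℝ := fun k => D k ^ r + E k ^ s with hh
  have h0 : ∀ k, 0 ≤ h k := fun k => by have := hD0 k; have := hE0 k; positivity
  set M' : ℕ → ℂ := fun n => ((6 : ℝ) : ℂ) * M n with hM'
  set N' : ℕ → ℂ := fun n => ((6 : ℝ) : ℂ) * N n with hN'
  set S := mach M' N' (fun n => 6 * D n) (fun n => 6 * E n) with hS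
  set H : ℕ → ℝ := fun n => ∑ k ∈ Finset.range n, h k with hHd
  have Hm : Monotone H := by
    refine monotone_nat_of_le_succ fun n => ?_
    simp only [hHd, Finset.sum_range_succ]
    linarith [h0 n]
  have cm : Monotone (fun n => (S n).c) := mach_c_mono _ _ _ _
  set e : ℕ → ℝ := fun n => (S n).c + 108 * (H (n + 1) + H n) with he
  have em : Monotone e := by
    intro x y hxy
    have h1 := Hm hxy
    have h2 := Hm (Nat.succ_le_succ hxy)
    have h3 : ((S x).c : ℝ) ≤ (S y).c := by exact_mod_cast cm hxy
    simp only [Nat.succ_eq_add_one] at h2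
    simp only [he]
    linarith
  have key : ∀ a b, a < b → b ≤ T → big a b → e a + 3 ≤ e b := by
    intro a b hab hbT hb
    have hsum : ∑ k ∈ Finset.Icc a b, h k ≤ (H (b + 1) + H b) - (H (a + 1) + H a) := by
      have e1 : H (b + 1) - H (a + 1) = ∑ k ∈ Finset.Ico (a + 1) (b + 1), h k :=
        (Finset.sum_Ico_eq_sub _ (by omega)).symm
      have e2 : H b - H a = ∑ k ∈ Finset.Ico a b, h k :=
        (Finset.sum_Ico_eq_sub _ (by omega)).symm
      have e3 : ∑ k ∈ Finset.Icc a b, h k = h a + ∑ k ∈ Finset.Ico (a + 1) (b + 1), h k := by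
        rw [← Finset.sum_eq_sum_Ico_succ_bot (by omega)]
        rfl
      have e4 : h a ≤ ∑ k ∈ Finset.Ico a b, h k :=
        Finset.single_le_sum (fun k _ => h0 k) (by simp [hab])
      linarith
    by_cases hsm : ∑ k ∈ Finset.Icc a b, h k ≤ 1 / 36
    · obtain ⟨n, han, hnb, hbn⟩ := hbig a b hab hbT hb hsm
      have hcl : ∀ k, a < k → k ≤ n → 6 * D k ≤ 1 ∧ 6 * E k ≤ 1 := by
        intro k hk1 hk2
        have hk : h k ≤ 1 / 36 :=
          (Finset.single_le_sum (fun k _ => h0 k) (by simp; omega)).trans hsm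
        have aux : ∀ (x p : ℝ), 0 ≤ x → 1 ≤ p → p ≤ 2 → x ^ p ≤ 1 / 36 → 6 * x ≤ 1 := by
          intro x p hx hp1 hp2 hxp
          by_contra hcon
          push Not at hcon
          have hx6 : 1 / 6 < x := by linarith
          rcases le_total x 1 with h1 | h1
          · have := Real.rpow_le_rpow_of_exponent_ge (by linarith) h1 hp2
            rw [Real.rpow_two] at this
            nlinarith
          · have := Real.one_le_rpow h1 (by linarith : 0 ≤ p)
            linarith
        have hd := Real.rpow_nonneg (hD0 k) r
        have hee := Real.rpow_nonneg (hE0 k) s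
        simp only [hh] at hk
        exact ⟨aux _ r (hD0 k) hr hr2 (by linarith), aux _ s (hE0 k) hs hs2 (by linarith)⟩
      have hc3 : (S a).c + 3 ≤ (S b).c := by
        by_contra hcon
        push Not at hcon
        have hcn : (S n).c ≤ (S a).c + 2 := by
          have := cm hnb
          simp only at this
          omega
        have h6 : ∀ z w : ℂ, ‖((6 : ℝ) : ℂ) * z - ((6 : ℝ) : ℂ) * w‖ = 6 * ‖z - w‖ := by
          intro z w
          rw [← mul_sub, norm_mul, Complex.norm_real]
          norm_num
        obtain ⟨f1, f2, f3⟩ := mach_few M' N' (fun n => 6 * D n) (fun n => 6 * E n)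
          (fun n => by simp only [hM']; rw [h6]; linarith [hM n])
          (fun n => by simp only [hN']; rw [h6]; linarith [hN n]) a n han hcl hcn
        simp only [hM', hN'] at f1 f2 f3
        rw [h6] at f1 f2
        rw [area_smul, norm_mul, norm_mul, Complex.norm_real] at f3
        norm_num at f3
        rcases hbn with h | h | h <;> linarith
      have : ((S a).c : ℝ) + 3 ≤ (S b).c := by exact_mod_cast hc3
      have h1 := Hm hab.le
      have h2 := Hm (Nat.succ_le_succ hab.le)
      simp only [Nat.succ_eq_add_one] at h2
      simp only [he]
      linarith
    · push Not at hsm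
      have h3 : ((S a).c : ℝ) ≤ (S b).c := by exact_mod_cast cm hab.le
      simp only [he]
      linarith
  have hfin := hch.count em (by
    have := Hm (Nat.zero_le 1)
    have h00 : H 0 = 0 := by simp [hHd]
    have : 0 ≤ ((S 0).c : ℝ) := by positivity
    simp only [he]
    linarith) key hbT
  have hbe := em hbT
  have h4 : H T ≤ H (T + 1) := Hm (by omega)
  have : (2 * m : ℝ) ≤ (S T).c := by
    simp only [he] at hbe hfin
    have : H (T + 1) = ∑ k ∈ Finset.range (T + 1), h k := rfl
    linarith
  exact_mod_cast this

lemma small_of_rpow (x p : ℝ) (hx : 0 ≤ x) (hp1 : 1 ≤ p) (hp2 : p ≤ 2) (hxp : x ^ p ≤ 1 / 36) :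
    x ≤ 1 / 6 ∧ x ^ 2 ≤ x ^ p := by
  have h6 : x ≤ 1 / 6 := by
    by_contra hcon
    push Not at hcon
    rcases le_total x 1 with h1 | h1
    · have := Real.rpow_le_rpow_of_exponent_ge (by linarith) h1 hp2
      rw [Real.rpow_two] at this
      nlinarith
    · have := Real.one_le_rpow h1 (by linarith : 0 ≤ p)
      linarith
  refine ⟨h6, ?_⟩
  rcases hx.eq_or_lt with h | h
  · rw [← h, Real.zero_rpow (by linarith)]; norm_num
  · have := Real.rpow_le_rpow_of_exponent_ge h (by linarith : x ≤ 1) hp2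
    rwa [Real.rpow_two] at this

lemma area_identity (M N X Y : ℕ → ℂ) (a b : ℕ) (hab : a ≤ b) :
    area X Y a b = area M N a b + ∑ j ∈ Finset.Ico a b, (X j - M j) * (Y (j + 1) - Y j)
      - (X a - M a) * (Y b - Y a) + (M b - M a) * (Y b - N b)
      - ∑ j ∈ Finset.Ico a b, (Y (j + 1) - N (j + 1)) * (M (j + 1) - M j) := by
  induction b, hab using Nat.le_induction with
  | base => simp [area]
  | succ n hn ih =>
    rw [area_succ X Y hn, area_succ M N hn, Finset.sum_Ico_succ_top hn,
      Finset.sum_Ico_succ_top hn, ih]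
    ring

lemma area_abel (X Y : ℕ → ℂ) (a b : ℕ) (hab : a ≤ b) :
    area X Y a b = ∑ j ∈ Finset.Ico a b, (X (j + 1) - X j) * (Y b - Y (j + 1)) := by
  induction b, hab using Nat.le_induction with
  | base => simp [area]
  | succ n hn ih =>
    rw [area_succ X Y hn, Finset.sum_Ico_succ_top hn, ih]
    have h1 : ∑ j ∈ Finset.Ico a n, (X (j + 1) - X j) = X n - X a :=
      Finset.sum_Ico_sub X hn
    have : ∑ j ∈ Finset.Ico a n, (X (j + 1) - X j) * (Y (n + 1) - Y (j + 1)) =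
      ∑ j ∈ Finset.Ico a n, (X (j + 1) - X j) * (Y n - Y (j + 1)) +
        (X n - X a) * (Y (n + 1) - Y n) := by
      rw [← h1, Finset.sum_mul, ← Finset.sum_add_distrib]
      exact Finset.sum_congr rfl fun j _ => by ring
    rw [this]
    ring

/-- coupling of a path with a martingale path -/
def Coup (r : ℝ) (M X : ℕ → ℂ) (D : ℕ → ℝ) : Prop :=
  (∀ n, ‖X (n + 1) - X n‖ ≤ D (n + 1)) ∧ ((∀ n, ‖X n - M n‖ ≤ D n) ∨ r = 1)

/-- big interval for the area of a pair of paths -/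
def bigXY (X Y : ℕ → ℂ) (a b : ℕ) : Prop := 2 < ‖area X Y a b‖

lemma bigXY_big (M N X Y : ℕ → ℂ) (D E : ℕ → ℝ) (hD0 : ∀ n, 0 ≤ D n) (hE0 : ∀ n, 0 ≤ E n)
    (hM : ∀ n, ‖M (n + 1) - M n‖ ≤ D (n + 1))
    (r s : ℝ) (hr : 1 ≤ r) (hr2 : r ≤ 2) (hs : 1 ≤ s) (hs2 : s ≤ 2)
    (hne : r ≠ 1 ∨ s ≠ 1)
    (hX : Coup r M X D) (hY : Coup s N Y E) (a b : ℕ) (hab : a < b)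
    (hbig : bigXY X Y a b)
    (hsm : ∑ k ∈ Finset.Icc a b, (D k ^ r + E k ^ s) ≤ 1 / 36) : bigMN M N a b := by
  by_contra hnb
  have hnb' : ∀ n, a ≤ n → n ≤ b → ‖M n - M a‖ ≤ 1 ∧ ‖N n - N a‖ ≤ 1 ∧ ‖area M N a n‖ ≤ 1 := by
    intro n h1 h2
    by_contra hcon
    apply hnb
    refine ⟨n, h1, h2, ?_⟩
    by_contra h3
    push Not at h3
    exact hcon h3
  have hDr : ∀ k, 0 ≤ D k ^ r := fun k => Real.rpow_nonneg (hD0 k) _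
  have hEs : ∀ k, 0 ≤ E k ^ s := fun k => Real.rpow_nonneg (hE0 k) _
  have hone : ∀ k, a ≤ k → k ≤ b → (D k ≤ 1 / 6 ∧ D k ^ 2 ≤ D k ^ r) ∧
      (E k ≤ 1 / 6 ∧ E k ^ 2 ≤ E k ^ s) := by
    intro k h1 h2
    have : D k ^ r + E k ^ s ≤ 1 / 36 :=
      (Finset.single_le_sum (f := fun k => D k ^ r + E k ^ s)
        (fun k _ => add_nonneg (hDr k) (hEs k)) (by simp; omega)).trans hsm
    exact ⟨small_of_rpow _ r (hD0 k) hr hr2 (by linarith [hEs k]),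
      small_of_rpow _ s (hE0 k) hs hs2 (by linarith [hDr k])⟩
  rw [Finset.sum_add_distrib] at hsm
  -- shifted sums
  have sh : ∀ u : ℕ → ℝ, (∀ k, 0 ≤ u k) →
      ∑ j ∈ Finset.Ico a b, u (j + 1) ≤ ∑ k ∈ Finset.Icc a b, u k := by
    intro u hu
    rw [Finset.sum_Ico_add' u a b 1]
    refine Finset.sum_le_sum_of_subset_of_nonneg ?_ fun k _ _ => hu k
    intro k hk
    simp at hk ⊢
    omega
  have sh0 : ∀ u : ℕ → ℝ, (∀ k, 0 ≤ u k) →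
      ∑ j ∈ Finset.Ico a b, u j ≤ ∑ k ∈ Finset.Icc a b, u k := by
    intro u hu
    refine Finset.sum_le_sum_of_subset_of_nonneg ?_ fun k _ _ => hu k
    intro k hk
    simp at hk ⊢
    omega
  have shD := sh _ hDr
  have shE := sh _ hEs
  have shD0 := sh0 _ hDr
  have hSD : 0 ≤ ∑ k ∈ Finset.Icc a b, D k ^ r := Finset.sum_nonneg fun k _ => hDr k
  have hSE : 0 ≤ ∑ k ∈ Finset.Icc a b, E k ^ s := Finset.sum_nonneg fun k _ => hEs k
  obtain ⟨hX1, hX2⟩ := hX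
  obtain ⟨hY1, hY2⟩ := hY
  have YA : (∀ n, ‖Y n - N n‖ ≤ E n) → ∀ n, a ≤ n → n ≤ b → ‖Y b - Y n‖ ≤ 7 / 3 ∧
      ‖Y b - Y a‖ ≤ 4 / 3 := by
    intro hA n h1 h2
    have k1 := hA b
    have k2 := hA n
    have k3 := hA a
    have l1 := (hone b hab.le le_rfl).2.1
    have l2 := (hone n h1 h2).2.1
    have l3 := (hone a le_rfl hab.le).2.1
    have n1 := (hnb' b hab.le le_rfl).2.1
    have n2 := (hnb' n h1 h2).2.1
    constructor
    · have e : Y b - Y n = (Y b - N b) - (Y n - N n) + ((N b - N a) - (N n - N a)) := by ring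
      rw [e]
      have := norm_add_le ((Y b - N b) - (Y n - N n)) ((N b - N a) - (N n - N a))
      have := norm_sub_le (Y b - N b) (Y n - N n)
      have := norm_sub_le (N b - N a) (N n - N a)
      linarith
    · have e : Y b - Y a = (Y b - N b) - (Y a - N a) + (N b - N a) := by ring
      rw [e]
      have := norm_add_le ((Y b - N b) - (Y a - N a)) (N b - N a)
      have := norm_sub_le (Y b - N b) (Y a - N a)
      linarith
  have XA : (∀ n, ‖X n - M n‖ ≤ D n) → ∀ n, a ≤ n → n ≤ b → ‖X n - X a‖ ≤ 4 / 3 := by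
    intro hA n h1 h2
    have k2 := hA n
    have k3 := hA a
    have l2 := (hone n h1 h2).1.1
    have l3 := (hone a le_rfl hab.le).1.1
    have n2 := (hnb' n h1 h2).1
    have e : X n - X a = (X n - M n) - (X a - M a) + (M n - M a) := by ring
    rw [e]
    have := norm_add_le ((X n - M n) - (X a - M a)) (M n - M a)
    have := norm_sub_le (X n - M n) (X a - M a)
    linarith
  have caseX : r = 1 → (∀ n, ‖Y n - N n‖ ≤ E n) → False := by
    intro hr1 hA
    have : ‖area X Y a b‖ ≤ ∑ j ∈ Finset.Ico a b, D (j + 1) ^ r * (7 / 3) := by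
      rw [area_abel X Y a b hab.le]
      refine (norm_sum_le _ _).trans (Finset.sum_le_sum fun j hj => ?_)
      rw [Finset.mem_Ico] at hj
      rw [norm_mul, hr1, Real.rpow_one]
      exact mul_le_mul (hX1 j) (YA hA (j + 1) (by omega) (by omega)).1 (norm_nonneg _) (hD0 _)
    rw [← Finset.sum_mul] at this
    unfold bigXY at hbig
    linarith
  have caseY : s = 1 → (∀ n, ‖X n - M n‖ ≤ D n) → False := by
    intro hs1 hA
    have : ‖area X Y a b‖ ≤ ∑ j ∈ Finset.Ico a b, E (j + 1) ^ s * (4 / 3) := by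
      rw [area]
      refine (norm_sum_le _ _).trans (Finset.sum_le_sum fun j hj => ?_)
      rw [Finset.mem_Ico] at hj
      rw [norm_mul, hs1, Real.rpow_one, mul_comm]
      exact mul_le_mul (hY1 j) (XA hA j (by omega) (by omega)) (norm_nonneg _) (hE0 _)
    rw [← Finset.sum_mul] at this
    unfold bigXY at hbig
    linarith
  rcases hX2 with hXA | hXB
  · rcases hY2 with hYA | hYB
    · have t1 : ‖∑ j ∈ Finset.Ico a b, (X j - M j) * (Y (j + 1) - Y j)‖ ≤
          ∑ j ∈ Finset.Ico a b, (D j ^ r + E (j + 1) ^ s) / 2 := by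
        refine (norm_sum_le _ _).trans (Finset.sum_le_sum fun j hj => ?_)
        rw [Finset.mem_Ico] at hj
        rw [norm_mul]
        have h1 := mul_le_mul (hXA j) (hY1 j) (norm_nonneg _) (hD0 j)
        have h2 := (hone j (by omega) (by omega)).1.2
        have h3 := (hone (j + 1) (by omega) (by omega)).2.2
        nlinarith [sq_nonneg (D j - E (j + 1))]
      have t2 : ‖∑ j ∈ Finset.Ico a b, (Y (j + 1) - N (j + 1)) * (M (j + 1) - M j)‖ ≤
          ∑ j ∈ Finset.Ico a b, (D (j + 1) ^ r + E (j + 1) ^ s) / 2 := by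
        refine (norm_sum_le _ _).trans (Finset.sum_le_sum fun j hj => ?_)
        rw [Finset.mem_Ico] at hj
        rw [norm_mul]
        have h1 := mul_le_mul (hYA (j + 1)) (hM j) (norm_nonneg _) (hE0 (j + 1))
        have h2 := (hone (j + 1) (by omega) (by omega)).1.2
        have h3 := (hone (j + 1) (by omega) (by omega)).2.2
        nlinarith [sq_nonneg (D (j + 1) - E (j + 1))]
      rw [← Finset.sum_div, Finset.sum_add_distrib] at t1 t2
      have t3 : ‖(X a - M a) * (Y b - Y a)‖ ≤ 1 / 6 * (4 / 3) := by
        rw [norm_mul]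
        exact mul_le_mul ((hXA a).trans (hone a le_rfl hab.le).1.1)
          (YA hYA a le_rfl hab.le).2 (norm_nonneg _) (by norm_num)
      have t4 : ‖(M b - M a) * (Y b - N b)‖ ≤ 1 * (1 / 6) := by
        rw [norm_mul]
        exact mul_le_mul (hnb' b hab.le le_rfl).1 ((hYA b).trans (hone b hab.le le_rfl).2.1)
          (norm_nonneg _) (by norm_num)
      have t5 := (hnb' b hab.le le_rfl).2.2
      unfold bigXY at hbig
      rw [area_identity M N X Y a b hab.le] at hbig
      set S1 := ∑ j ∈ Finset.Ico a b, (X j - M j) * (Y (j + 1) - Y j)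
      set S2 := ∑ j ∈ Finset.Ico a b, (Y (j + 1) - N (j + 1)) * (M (j + 1) - M j)
      have u1 := norm_sub_le (area M N a b + S1 - (X a - M a) * (Y b - Y a) +
        (M b - M a) * (Y b - N b)) S2
      have u2 := norm_add_le (area M N a b + S1 - (X a - M a) * (Y b - Y a))
        ((M b - M a) * (Y b - N b))
      have u3 := norm_sub_le (area M N a b + S1) ((X a - M a) * (Y b - Y a))
      have u4 := norm_add_le (area M N a b) S1
      linarith
    · exact caseY hYB hXA
  · rcases hY2 with hYA | hYB
    · exact caseX hXB hYA
    · rcases hne with h | h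
      · exact h hXB
      · exact h hYB

/-! ### Probabilistic part -/

/-- functions constant on the fibres of `π n` -/
def Adap {Ω β : Type*} (π : ℕ → Ω → ℤ) (n : ℕ) (f : Ω → β) : Prop :=
  ∀ x y, π n x = π n y → f x = f y

/-- a refining sequence of measurable countable partitions -/
structure Filt {Ω : Type*} [MeasurableSpace Ω] (π : ℕ → Ω → ℤ) : Prop where
  meas : ∀ n, Measurable (π n)
  refine' : ∀ n x y, π (n + 1) x = π (n + 1) y → π n x = π n y

lemma Adap.measurable {Ω β : Type*} [MeasurableSpace Ω] [MeasurableSpace β] [Nonempty β]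
    {π : ℕ → Ω → ℤ} (hπ : Filt π) {n : ℕ} {f : Ω → β} (hf : Adap π n f) : Measurable f := by
  classical
  have hfac : Function.FactorsThrough f (π n) := fun x y h => hf x y h
  have : f = (Function.extend (π n) f (fun _ => Classical.arbitrary β)) ∘ π n := by
    funext x
    exact (hfac.extend_apply _ x).symm
  rw [this]
  exact (measurable_of_countable _).comp (hπ.meas n)

lemma Adap.succ {Ω β : Type*} [MeasurableSpace Ω] {π : ℕ → Ω → ℤ} (hπ : Filt π) {n : ℕ}
    {f : Ω → β} (hf : Adap π n f) : Adap π (n + 1) f := fun x y h => hf x y (hπ.refine' n x y h)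

lemma Adap.mono {Ω β : Type*} [MeasurableSpace Ω] {π : ℕ → Ω → ℤ} (hπ : Filt π) {n m : ℕ}
    (hnm : n ≤ m) {f : Ω → β} (hf : Adap π n f) : Adap π m f := by
  induction m, hnm using Nat.le_induction with
  | base => exact hf
  | succ m _ ih => exact ih.succ hπ

/-- martingale with predictable bound -/
structure Mart {Ω : Type*} [MeasurableSpace Ω] (π : ℕ → Ω → ℤ) (μ : Measure Ω)
    (M : Ω → ℕ → ℂ) (D : Ω → ℕ → ℝ) : Prop where
  adM : ∀ n, Adap π n (fun x => M x n)
  adD : ∀ n, Adap π n (fun x => D x (n + 1))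
  adD0 : Adap π 0 (fun x => D x 0)
  D0 : ∀ x n, 0 ≤ D x n
  hM : ∀ x n, ‖M x (n + 1) - M x n‖ ≤ D x (n + 1)
  orth : ∀ n (ξ : Ω → ℂ), Adap π n ξ → (∃ C : ℝ, ∀ x, ‖ξ x‖ ≤ C) →
    ∫ x, ξ x * (M x (n + 1) - M x n) ∂μ = 0

lemma Mart.smul {Ω : Type*} [MeasurableSpace Ω] {π : ℕ → Ω → ℤ} {μ : Measure Ω}
    {M : Ω → ℕ → ℂ} {D : Ω → ℕ → ℝ} (h : Mart π μ M D) (c : ℝ) (hc : 0 ≤ c) :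
    Mart π μ (fun x n => (c : ℂ) * M x n) (fun x n => c * D x n) where
  adM n x y hxy := by
    have := h.adM n x y hxy
    simp only at this ⊢; rw [this]
  adD n x y hxy := by
    have := h.adD n x y hxy
    simp only at this ⊢; rw [this]
  adD0 x y hxy := by
    have := h.adD0 x y hxy
    simp only at this ⊢; rw [this]
  D0 x n := mul_nonneg hc (h.D0 x n)
  hM x n := by
    rw [← mul_sub, norm_mul, Complex.norm_real, Real.norm_of_nonneg hc]
    exact mul_le_mul_of_nonneg_left (h.hM x n) hc
  orth n ξ h1 h2 := by
    have := h.orth n ξ h1 h2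
    have e : ∀ x, ξ x * ((c : ℂ) * M x (n + 1) - (c : ℂ) * M x n) =
      (c : ℂ) * (ξ x * (M x (n + 1) - M x n)) := fun x => by ring
    simp only [e]
    rw [integral_const_mul, this, mul_zero]

/-- state energy -/
def MSt.v (s : MSt) : ℝ := ‖s.A‖ ^ 2 + ‖s.B‖ ^ 2 + ‖s.Q‖ ^ 2

open Classical in
/-- potential -/
def MSt.pot (m : ℕ) (s : MSt) : ℝ := if m ≤ s.c then ((s.c : ℝ) - m) + s.v else 0

lemma MSt.v_nonneg (s : MSt) : 0 ≤ s.v := by unfold MSt.v; positivity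

lemma MSt.pot_nonneg (m : ℕ) (s : MSt) : 0 ≤ s.pot m := by
  unfold MSt.pot
  split_ifs with h
  · have : (m : ℝ) ≤ s.c := by exact_mod_cast h
    linarith [s.v_nonneg]
  · exact le_rfl

/-- cross term -/
def MSt.cross (s : MSt) (dM dN : ℂ) : ℂ :=
  2 * (starRingEnd ℂ s.A) * dM + 2 * (starRingEnd ℂ s.B + starRingEnd ℂ s.Q * s.A) * dN

lemma sq_le_rpow_of_le_one (x p : ℝ) (hx : 0 ≤ x) (hx1 : x ≤ 1) (hp1 : 1 ≤ p) (hp2 : p ≤ 2) :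
    x ^ 2 ≤ x ^ p := by
  rcases hx.eq_or_lt with h | h
  · rw [← h, Real.zero_rpow (by linarith)]; norm_num
  · have := Real.rpow_le_rpow_of_exponent_ge h hx1 hp2
    rwa [Real.rpow_two] at this

lemma norm_add_sq_c (a b : ℂ) : ‖a + b‖ ^ 2 = ‖a‖ ^ 2 + ‖b‖ ^ 2 + (2 * (starRingEnd ℂ a) * b).re := by
  rw [← Complex.normSq_eq_norm_sq, ← Complex.normSq_eq_norm_sq, ← Complex.normSq_eq_norm_sq,
    Complex.normSq_apply, Complex.normSq_apply, Complex.normSq_apply]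
  simp
  ring

open Classical in
lemma pot_step (m : ℕ) (s : MSt) (dM dN : ℂ) (d e : ℝ) (r' s' : ℝ)
    (hr : 1 ≤ r') (hr2 : r' ≤ 2) (hs : 1 ≤ s') (hs2 : s' ≤ 2)
    (hd : ‖dM‖ ≤ d) (he : ‖dN‖ ≤ e) (hA : ‖s.A‖ ≤ 1) :
    (mstep s dM dN d e).pot m ≤ s.pot m + (if m ≤ s.c then 2 * (d ^ r' + e ^ s') else 0) +
      (if m ≤ s.c ∧ d ≤ 1 ∧ e ≤ 1 then s.cross dM dN else 0).re := by
  have hd0 : 0 ≤ d := (norm_nonneg _).trans hd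
  have he0 : 0 ≤ e := (norm_nonneg _).trans he
  have hdr := Real.rpow_nonneg hd0 r'
  have hes := Real.rpow_nonneg he0 s'
  by_cases hm : m ≤ s.c
  · have hm' : (m : ℝ) ≤ s.c := by exact_mod_cast hm
    have hpot : s.pot m = ((s.c : ℝ) - m) + s.v := by simp [MSt.pot, hm]
    rw [hpot, if_pos hm]
    have hv := s.v_nonneg
    rw [mstep]
    by_cases h1 : 1 < d ∨ 1 < e
    · have h2 : ¬ (m ≤ s.c ∧ d ≤ 1 ∧ e ≤ 1) := by
        rintro ⟨-, h3, h4⟩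
        rcases h1 with h | h <;> linarith
      rw [if_pos h1, if_neg h2]
      have : (⟨0, 0, 0, s.c⟩ : MSt).pot m = (s.c : ℝ) - m := by simp [MSt.pot, hm, MSt.v]
      rw [this, Complex.zero_re]
      linarith
    rw [if_neg h1]
    push Not at h1
    rw [if_pos (show m ≤ s.c ∧ d ≤ 1 ∧ e ≤ 1 from ⟨hm, h1.1, h1.2⟩)]
    split_ifs with h2
    all_goals
      have hd2 := sq_le_rpow_of_le_one d r' hd0 h1.1 hr hr2
      have he2 := sq_le_rpow_of_le_one e s' he0 h1.2 hs hs2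
      have e1 := norm_add_sq_c s.A dM
      have e2 := norm_add_sq_c s.B dN
      have e3 := norm_add_sq_c s.Q (s.A * dN)
      have e4 : ‖s.A * dN‖ ^ 2 ≤ e ^ 2 := by
        refine pow_le_pow_left₀ (norm_nonneg _) ?_ 2
        rw [norm_mul]
        nlinarith [norm_nonneg s.A, norm_nonneg dN]
      have e5 : ‖dM‖ ^ 2 ≤ d ^ 2 := pow_le_pow_left₀ (norm_nonneg _) hd 2
      have e6 : ‖dN‖ ^ 2 ≤ e ^ 2 := pow_le_pow_left₀ (norm_nonneg _) he 2
      have e7 : (s.cross dM dN).re = (2 * (starRingEnd ℂ s.A) * dM).re +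
          (2 * (starRingEnd ℂ s.B) * dN).re + (2 * (starRingEnd ℂ s.Q) * (s.A * dN)).re := by
        rw [← Complex.add_re, ← Complex.add_re]
        congr 1
        unfold MSt.cross
        ring
      have hvn : ‖s.A + dM‖ ^ 2 + ‖s.B + dN‖ ^ 2 + ‖s.Q + s.A * dN‖ ^ 2 ≤
          s.v + 2 * (d ^ r' + e ^ s') + (s.cross dM dN).re := by
        rw [e1, e2, e3, e7]; unfold MSt.v; linarith
    · have : 1 ≤ ‖s.A + dM‖ ^ 2 + ‖s.B + dN‖ ^ 2 + ‖s.Q + s.A * dN‖ ^ 2 := by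
        have q1 := sq_nonneg ‖s.A + dM‖
        have q2 := sq_nonneg ‖s.B + dN‖
        have q3 := sq_nonneg ‖s.Q + s.A * dN‖
        rcases h2 with h | h | h
        · have := one_le_pow₀ h.le (n := 2)
          linarith
        · have := one_le_pow₀ h.le (n := 2)
          linarith
        · have := one_le_pow₀ h.le (n := 2)
          linarith
      simp only [MSt.pot, MSt.v, (by omega : m ≤ s.c + 1), if_true]
      unfold MSt.v at hvn
      push_cast
      simp only [norm_zero]
      linarith
    · have : (⟨s.A + dM, s.B + dN, s.Q + s.A * dN, s.c⟩ : MSt).pot m = ((s.c : ℝ) - m) +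
          (‖s.A + dM‖ ^ 2 + ‖s.B + dN‖ ^ 2 + ‖s.Q + s.A * dN‖ ^ 2) := by
        simp [MSt.pot, MSt.v, hm]
      rw [this]
      linarith
  · have h0 : ¬ (m ≤ s.c ∧ d ≤ 1 ∧ e ≤ 1) := fun h => hm h.1
    rw [if_neg hm, if_neg h0]
    simp only [Complex.zero_re, add_zero]
    have : s.pot m = 0 := by simp [MSt.pot, hm]
    rw [this]
    rw [mstep]
    split_ifs
    · simp [MSt.pot, hm]
    · simp only [MSt.pot, MSt.v]
      split_ifs with h
      · have : m = s.c + 1 := by omega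
        rw [this]; simp
      · exact le_rfl
    · simp [MSt.pot, hm]

/-- running sum of the bounds -/
def Hsum (r s : ℝ) (D E : ℕ → ℝ) (n : ℕ) : ℝ := ∑ k ∈ Finset.range (n + 1), (D k ^ r + E k ^ s)

lemma Hsum_succ (r s : ℝ) (D E : ℕ → ℝ) (n : ℕ) :
    Hsum r s D E (n + 1) = Hsum r s D E n + (D (n + 1) ^ r + E (n + 1) ^ s) := by
  simp [Hsum, Finset.sum_range_succ _ (n + 1)]

lemma mach_c_le (M N : ℕ → ℂ) (D E : ℕ → ℝ) (n : ℕ) : (mach M N D E n).c ≤ n := by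
  induction n with
  | zero => simp [mach]
  | succ n ih =>
    rw [mach_succ, mstep]
    split_ifs <;> simp only <;> omega

lemma pot_bd (M N : ℕ → ℂ) (D E : ℕ → ℝ) (n m : ℕ) : (mach M N D E n).pot m ≤ n + 3 := by
  obtain ⟨h1, h2, h3⟩ := mach_bd M N D E n
  have hc : ((mach M N D E n).c : ℝ) ≤ n := by exact_mod_cast mach_c_le M N D E n
  have hm : (0 : ℝ) ≤ m := by positivity
  unfold MSt.pot MSt.v
  split_ifs
  · have := pow_le_one₀ (norm_nonneg _) h1 (n := 2)
    have := pow_le_one₀ (norm_nonneg _) h2 (n := 2)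
    have := pow_le_one₀ (norm_nonneg _) h3 (n := 2)
    linarith
  · positivity

section stepA
variable {Ω : Type*} [MeasurableSpace Ω] {π : ℕ → Ω → ℤ} {μ : Measure Ω}
  {M N : Ω → ℕ → ℂ} {D E : Ω → ℕ → ℝ}

lemma mach_adap (hπ : Filt π) (hM : Mart π μ M D) (hN : Mart π μ N E) (n : ℕ) :
    Adap π n (fun x => mach (M x) (N x) (D x) (E x) n) := by
  induction n with
  | zero => intro x y _; rfl
  | succ n ih =>
    intro x y h
    have h' := hπ.refine' n x y h
    have e1 := ih x y h'
    have e2 := hM.adM (n + 1) x y h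
    have e3 := hM.adM n x y h'
    have e4 := hN.adM (n + 1) x y h
    have e5 := hN.adM n x y h'
    have e6 := hM.adD n x y h'
    have e7 := hN.adD n x y h'
    simp only [mach_succ] at *
    rw [e1, e2, e3, e4, e5, e6, e7]

lemma Hsum_adap (hπ : Filt π) (hM : Mart π μ M D) (hN : Mart π μ N E) (r s : ℝ) (n : ℕ) :
    Adap π n (fun x => Hsum r s (D x) (E x) n) ∧
    Adap π n (fun x => Hsum r s (D x) (E x) (n + 1)) := by
  have key : ∀ n, Adap π n (fun x => Hsum r s (D x) (E x) n) →
      Adap π n (fun x => Hsum r s (D x) (E x) (n + 1)) := by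
    intro n hn x y h
    have e1 := hn x y h
    have e6 := hM.adD n x y h
    have e7 := hN.adD n x y h
    simp only [Hsum_succ] at *
    rw [e1, e6, e7]
  induction n with
  | zero =>
    have : Adap π 0 (fun x => Hsum r s (D x) (E x) 0) := by
      intro x y h
      have e6 := hM.adD0 x y h
      have e7 := hN.adD0 x y h
      simp only [Hsum] at *
      simp [e6, e7]
    exact ⟨this, key 0 this⟩
  | succ n ih => exact ⟨ih.2.succ hπ, key _ (ih.2.succ hπ)⟩

lemma sum_ind_le (h : ℕ → ℝ) (h0 : ∀ k, 0 ≤ h k) (H : ℕ → ℝ) (hH0 : 0 ≤ H 0)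
    (hH : ∀ n, H (n + 1) = H n + h (n + 1)) (K : ℝ) (hK : 0 ≤ K) (T : ℕ) :
    ∑ n ∈ Finset.range T, (if H (n + 1) ≤ K then h (n + 1) else 0) ≤ K := by
  have hm : Monotone H := monotone_nat_of_le_succ fun n => by rw [hH]; linarith [h0 (n + 1)]
  have : ∀ T, ∑ n ∈ Finset.range T, (if H (n + 1) ≤ K then h (n + 1) else 0) ≤ min K (H T) := by
    intro T
    induction T with
    | zero => simp [hK, hH0]
    | succ T ih =>
      rw [Finset.sum_range_succ]
      have h1 := ih.trans (min_le_left _ _)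
      have h2 := ih.trans (min_le_right _ _)
      split_ifs with h3
      · refine le_min ?_ ?_ <;> rw [hH] at * <;> linarith
      · have := hm (Nat.le_succ T)
        refine le_min ?_ ?_
        · linarith
        · push Not at h3
          linarith
  exact (this T).trans (min_le_left _ _)

open Classical in
lemma stepA [IsFiniteMeasure μ] (hπ : Filt π) (hM : Mart π μ M D) (hN : Mart π μ N E)
    (r s : ℝ) (hr : 1 ≤ r) (hr2 : r ≤ 2) (hs : 1 ≤ s) (hs2 : s ≤ 2) (m : ℕ) (hm : 1 ≤ m)
    (K : ℝ) (hK : 0 ≤ K) (T : ℕ) :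
    m * μ.real {x | 2 * m ≤ (mach (M x) (N x) (D x) (E x) T).c ∧ Hsum r s (D x) (E x) T ≤ K} ≤
      2 * K * μ.real {x | m ≤ (mach (M x) (N x) (D x) (E x) T).c} := by
  set S : Ω → ℕ → MSt := fun x => mach (M x) (N x) (D x) (E x) with hS
  set H : Ω → ℕ → ℝ := fun x => Hsum r s (D x) (E x) with hH
  set h : Ω → ℕ → ℝ := fun x k => D x k ^ r + E x k ^ s with hh
  have h0 : ∀ x k, 0 ≤ h x k := fun x k =>
    add_nonneg (Real.rpow_nonneg (hM.D0 x k) _) (Real.rpow_nonneg (hN.D0 x k) _)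
  have Hs : ∀ x n, H x (n + 1) = H x n + h x (n + 1) := fun x n => Hsum_succ _ _ _ _ _
  have H00 : ∀ x, 0 ≤ H x 0 := fun x => by simpa [hH, Hsum] using h0 x 0
  have Sad : ∀ n, Adap π n (fun x => S x n) := mach_adap hπ hM hN
  have Had : ∀ n, Adap π n (fun x => H x n) := fun n => (Hsum_adap hπ hM hN r s n).1
  have Had' : ∀ n, Adap π n (fun x => H x (n + 1)) := fun n => (Hsum_adap hπ hM hN r s n).2
  set G : ℕ → Ω → ℝ := fun n x => if H x n ≤ K then (S x n).pot m else 0 with hG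
  set Q1 : ℕ → Ω → ℝ := fun n x =>
    if H x (n + 1) ≤ K ∧ m ≤ (S x n).c then 2 * h x (n + 1) else 0 with hQ1
  set cnd : ℕ → Ω → Prop := fun n x =>
    H x (n + 1) ≤ K ∧ m ≤ (S x n).c ∧ D x (n + 1) ≤ 1 ∧ E x (n + 1) ≤ 1 with hcnd
  set ξ1 : ℕ → Ω → ℂ := fun n x => if cnd n x then 2 * (starRingEnd ℂ (S x n).A) else 0 with hξ1
  set ξ2 : ℕ → Ω → ℂ := fun n x => if cnd n x then
    2 * (starRingEnd ℂ (S x n).B + starRingEnd ℂ (S x n).Q * (S x n).A) else 0 with hξ2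
  have cad : ∀ n, Adap π n (cnd n) := by
    intro n x y hxy
    have e1 := Sad n x y hxy
    have e2 := Had' n x y hxy
    have e6 := hM.adD n x y hxy
    have e7 := hN.adD n x y hxy
    simp only [hcnd] at *
    rw [e1, e2, e6, e7]
  have ξ1ad : ∀ n, Adap π n (ξ1 n) := by
    intro n x y hxy
    have e1 := Sad n x y hxy
    have e2 := cad n x y hxy
    simp only [hξ1] at *
    simp only [e1, e2]
  have ξ2ad : ∀ n, Adap π n (ξ2 n) := by
    intro n x y hxy
    have e1 := Sad n x y hxy
    have e2 := cad n x y hxy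
    simp only [hξ2] at *
    simp only [e1, e2]
  have ξ1b : ∀ n x, ‖ξ1 n x‖ ≤ 4 := by
    intro n x
    obtain ⟨b1, b2, b3⟩ := mach_bd (M x) (N x) (D x) (E x) n
    simp only [hξ1]
    split_ifs
    · rw [norm_mul, RCLike.norm_conj]
      norm_num
      change ‖(S x n).A‖ ≤ 1 at b1
      linarith
    · simp
  have ξ2b : ∀ n x, ‖ξ2 n x‖ ≤ 4 := by
    intro n x
    obtain ⟨b1, b2, b3⟩ := mach_bd (M x) (N x) (D x) (E x) n
    change ‖(S x n).A‖ ≤ 1 at b1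
    change ‖(S x n).B‖ ≤ 1 at b2
    change ‖(S x n).Q‖ ≤ 1 at b3
    simp only [hξ2]
    split_ifs
    · rw [norm_mul]
      have := norm_add_le (starRingEnd ℂ (S x n).B) (starRingEnd ℂ (S x n).Q * (S x n).A)
      rw [norm_mul, RCLike.norm_conj, RCLike.norm_conj] at this
      have : ‖(S x n).Q‖ * ‖(S x n).A‖ ≤ 1 * 1 :=
        mul_le_mul b3 b1 (norm_nonneg _) (by norm_num)
      norm_num
      linarith
    · simp
  set Cr : ℕ → Ω → ℂ := fun n x =>
    ξ1 n x * (M x (n + 1) - M x n) + ξ2 n x * (N x (n + 1) - N x n) with hCr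
  have I1 : ∀ n, Integrable (fun x => ξ1 n x * (M x (n + 1) - M x n)) μ := by
    intro n
    refine Integrable.of_bound (C := 4 * 1) ?_ (Filter.Eventually.of_forall fun x => ?_)
    · exact (((ξ1ad n).measurable hπ).mul
        (((hM.adM (n + 1)).measurable hπ).sub ((hM.adM n).measurable hπ))).aestronglyMeasurable
    · by_cases hc : cnd n x
      · rw [norm_mul]
        exact mul_le_mul (ξ1b n x) ((hM.hM x n).trans hc.2.2.1) (norm_nonneg _) (by norm_num)
      · simp [hξ1, hc]
  have I2 : ∀ n, Integrable (fun x => ξ2 n x * (N x (n + 1) - N x n)) μ := by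
    intro n
    refine Integrable.of_bound (C := 4 * 1) ?_ (Filter.Eventually.of_forall fun x => ?_)
    · exact (((ξ2ad n).measurable hπ).mul
        (((hN.adM (n + 1)).measurable hπ).sub ((hN.adM n).measurable hπ))).aestronglyMeasurable
    · by_cases hc : cnd n x
      · rw [norm_mul]
        exact mul_le_mul (ξ2b n x) ((hN.hM x n).trans hc.2.2.2) (norm_nonneg _) (by norm_num)
      · simp [hξ2, hc]
  have ICr : ∀ n, Integrable (Cr n) μ := fun n => (I1 n).add (I2 n)
  have Cr0 : ∀ n, ∫ x, (Cr n x).re ∂μ = 0 := by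
    intro n
    have e : ∫ x, (Cr n x).re ∂μ = (∫ x, Cr n x ∂μ).re := integral_re (ICr n)
    rw [e]
    simp only [hCr]
    rw [integral_add (I1 n) (I2 n), hM.orth n _ (ξ1ad n) ⟨4, ξ1b n⟩,
      hN.orth n _ (ξ2ad n) ⟨4, ξ2b n⟩]
    simp
  have IG : ∀ n, Integrable (G n) μ := by
    intro n
    refine Integrable.of_bound (C := n + 3) ?_ (Filter.Eventually.of_forall fun x => ?_)
    · have : Adap π n (G n) := by
        intro x y hxy
        have e1 := Sad n x y hxy
        have e2 := Had n x y hxy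
        simp only [hG] at *
        simp only [e1, e2]
      exact (this.measurable hπ).aestronglyMeasurable
    · simp only [hG]
      split_ifs
      · rw [Real.norm_of_nonneg (MSt.pot_nonneg _ _)]
        exact pot_bd _ _ _ _ _ _
      · simp; positivity
  have hle : ∀ x n, h x (n + 1) ≤ H x (n + 1) := by
    intro x n
    have : 0 ≤ H x n := Finset.sum_nonneg fun k _ => h0 x k
    rw [Hs]; linarith
  have IQ : ∀ n, Integrable (Q1 n) μ := by
    intro n
    refine Integrable.of_bound (C := 2 * K) ?_ (Filter.Eventually.of_forall fun x => ?_)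
    · have : Adap π n (Q1 n) := by
        intro x y hxy
        have e1 := Sad n x y hxy
        have e2 := Had' n x y hxy
        have e6 := hM.adD n x y hxy
        have e7 := hN.adD n x y hxy
        simp only [hQ1, hh] at *
        simp only [e1, e2, e6, e7]
      exact (this.measurable hπ).aestronglyMeasurable
    · simp only [hQ1]
      split_ifs with hc
      · rw [Real.norm_of_nonneg (by linarith [h0 x (n + 1)])]
        linarith [hle x n, hc.1]
      · simp; positivity
  have step : ∀ n x, G (n + 1) x ≤ G n x + Q1 n x + (Cr n x).re := by
    intro n x
    by_cases hc : H x (n + 1) ≤ K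
    · have hc' : H x n ≤ K := by have := Hs x n; linarith [h0 x (n + 1)]
      have := pot_step m (S x n) (M x (n + 1) - M x n) (N x (n + 1) - N x n) (D x (n + 1))
        (E x (n + 1)) r s hr hr2 hs hs2 (hM.hM x n) (hN.hM x n) (mach_bd _ _ _ _ _).1
      have e1 : G (n + 1) x = (mstep (S x n) (M x (n + 1) - M x n) (N x (n + 1) - N x n)
          (D x (n + 1)) (E x (n + 1))).pot m := by
        simp only [hG, if_pos hc]
        rfl
      have e2 : G n x = (S x n).pot m := by simp only [hG, if_pos hc']
      have e3 : Q1 n x = (if m ≤ (S x n).c then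
          2 * (D x (n + 1) ^ r + E x (n + 1) ^ s) else 0) := by
        simp only [hQ1, hc, true_and, hh]
      have e4 : Cr n x = (if m ≤ (S x n).c ∧ D x (n + 1) ≤ 1 ∧ E x (n + 1) ≤ 1 then
          (S x n).cross (M x (n + 1) - M x n) (N x (n + 1) - N x n) else 0) := by
        simp only [hCr, hξ1, hξ2, hcnd, hc, true_and]
        split_ifs
        · simp only [MSt.cross]
        · simp
      rw [e1, e2, e3, e4]
      exact this
    · have e1 : G (n + 1) x = 0 := by simp only [hG, if_neg hc]
      have e2 : 0 ≤ G n x := by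
        simp only [hG]
        split_ifs
        · exact MSt.pot_nonneg _ _
        · exact le_rfl
      have e3 : Q1 n x = 0 := by simp [hQ1, hc]
      have e4 : Cr n x = 0 := by simp [hCr, hξ1, hξ2, hcnd, hc]
      rw [e1, e3, e4]
      simpa using e2
  have istep : ∀ n, ∫ x, G (n + 1) x ∂μ ≤ ∫ x, G n x ∂μ + ∫ x, Q1 n x ∂μ := by
    intro n
    have h1 : ∫ x, G (n + 1) x ∂μ ≤ ∫ x, (G n x + Q1 n x + (Cr n x).re) ∂μ :=
      integral_mono (IG (n + 1)) (((IG n).add (IQ n)).add (ICr n).re) (step n)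
    have h2 : ∫ x, (G n x + Q1 n x + (Cr n x).re) ∂μ =
        ∫ x, (G n x + Q1 n x) ∂μ + ∫ x, (Cr n x).re ∂μ :=
      integral_add ((IG n).add (IQ n)) (ICr n).re
    rw [h2, Cr0, add_zero, integral_add (IG n) (IQ n)] at h1
    exact h1
  have itot : ∀ T, ∫ x, G T x ∂μ ≤ ∫ x, ∑ n ∈ Finset.range T, Q1 n x ∂μ := by
    intro T
    rw [integral_finsetSum _ fun n _ => IQ n]
    induction T with
    | zero =>
      have : ∀ x, G 0 x = 0 := by
        intro x
        simp only [hG, hS, mach, MSt.pot]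
        simp; omega
      simp [this]
    | succ T ih =>
      rw [Finset.sum_range_succ]
      linarith [istep T]
  have cm : ∀ x, Monotone (fun n => (S x n).c) := fun x => mach_c_mono _ _ _ _
  have Ameas : ∀ k, MeasurableSet {x | k ≤ (S x T).c} := by
    intro k
    have : Adap π T (fun x => (S x T).c) := fun x y hxy => by
      have := Sad T x y hxy
      simp only at *
      rw [this]
    exact measurableSet_le measurable_const (this.measurable hπ)
  have Bmeas : MeasurableSet {x | 2 * m ≤ (S x T).c ∧ H x T ≤ K} :=
    (Ameas (2 * m)).inter (measurableSet_le ((Had T).measurable hπ) measurable_const)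
  have up : ∫ x, ∑ n ∈ Finset.range T, Q1 n x ∂μ ≤
      ∫ x, {x | m ≤ (S x T).c}.indicator (fun _ => 2 * K) x ∂μ := by
    refine integral_mono (integrable_finsetSum _ fun n _ => IQ n)
      ((integrable_const _).indicator (Ameas m)) fun x => ?_
    simp only [Set.indicator_apply, Set.mem_ofPred_eq]
    split_ifs with hc
    · have := sum_ind_le (h x) (h0 x) (H x) (H00 x) (Hs x) K hK T
      calc ∑ n ∈ Finset.range T, Q1 n x ≤
          ∑ n ∈ Finset.range T, 2 * (if H x (n + 1) ≤ K then h x (n + 1) else 0) := by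
            refine Finset.sum_le_sum fun n _ => ?_
            simp only [hQ1]
            have := h0 x (n + 1)
            split_ifs with k1 k2 k2
            · exact le_rfl
            · exact absurd k1.1 k2
            · linarith
            · simp
        _ ≤ 2 * K := by rw [← Finset.mul_sum]; linarith
    · refine (Finset.sum_nonpos fun n hn => ?_)
      have : ¬ m ≤ (S x n).c := by
        have := cm x (Finset.mem_range.1 hn).le
        simp only at this
        omega
      simp [hQ1, this]
  have low : ∫ x, {x | 2 * m ≤ (S x T).c ∧ H x T ≤ K}.indicator (fun _ => (m : ℝ)) x ∂μ ≤
      ∫ x, G T x ∂μ := by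
    refine integral_mono ((integrable_const _).indicator Bmeas) (IG T) fun x => ?_
    simp only [Set.indicator_apply, Set.mem_ofPred_eq]
    split_ifs with hc
    · have h1 : m ≤ (S x T).c := by omega
      have h2 : (2 * m : ℝ) ≤ (S x T).c := by exact_mod_cast hc.1
      simp only [hG, if_pos hc.2, MSt.pot, if_pos h1]
      linarith [(S x T).v_nonneg]
    · simp only [hG]
      split_ifs
      · exact MSt.pot_nonneg _ _
      · exact le_rfl
  rw [integral_indicator_const _ Bmeas] at low
  rw [integral_indicator_const _ (Ameas m)] at up
  simp only [smul_eq_mul] at low up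
  have := itot T
  linarith

end stepA

section stepB
variable {Ω : Type*} [MeasurableSpace Ω] {π : ℕ → Ω → ℤ} {μ : Measure Ω}

lemma Hsum_six (r s : ℝ) (hr : 1 ≤ r) (hr2 : r ≤ 2) (hs : 1 ≤ s) (hs2 : s ≤ 2) (D E : ℕ → ℝ)
    (hD : ∀ n, 0 ≤ D n) (hE : ∀ n, 0 ≤ E n) (T : ℕ) :
    Hsum r s (fun n => 6 * D n) (fun n => 6 * E n) T ≤ 36 * Hsum r s D E T := by
  unfold Hsum
  rw [Finset.mul_sum]
  refine Finset.sum_le_sum fun k _ => ?_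
  rw [Real.mul_rpow (by norm_num) (hD k), Real.mul_rpow (by norm_num) (hE k)]
  have e : ∀ p : ℝ, p ≤ 2 → (6 : ℝ) ^ p ≤ 36 := by
    intro p hp
    calc (6 : ℝ) ^ p ≤ 6 ^ (2 : ℝ) := Real.rpow_le_rpow_of_exponent_le (by norm_num) hp
      _ = 36 := by norm_num
  have := mul_le_mul_of_nonneg_right (e r hr2) (Real.rpow_nonneg (hD k) r)
  have := mul_le_mul_of_nonneg_right (e s hs2) (Real.rpow_nonneg (hE k) s)
  linarith

lemma stepB [IsFiniteMeasure μ] (hπ : Filt π) {M N : Ω → ℕ → ℂ} {D E : Ω → ℕ → ℝ}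
    (hM : Mart π μ M D) (hN : Mart π μ N E)
    (r s : ℝ) (hr : 1 ≤ r) (hr2 : r ≤ 2) (hs : 1 ≤ s) (hs2 : s ≤ 2) (m : ℕ) (hm : 1 ≤ m)
    (γ : ℝ) (hγ : 0 ≤ γ) (hγ1 : γ ≤ 1 / 216) (T : ℕ) (big : Ω → ℕ → ℕ → Prop)
    (hbig : ∀ x a b, a < b → big x a b →
      ∑ k ∈ Finset.Icc a b, (D x k ^ r + E x k ^ s) ≤ 1 / 36 → bigMN (M x) (N x) a b) :
    μ {x | ∃ b ≤ T, Chain (big x) m b} ≤ μ {x | γ * m < Hsum r s (D x) (E x) T} +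
      ENNReal.ofReal (72 * γ) * μ {x | ∃ b ≤ T, Chain (bigMN (fun n => ((6 : ℝ) : ℂ) * M x n)
        (fun n => ((6 : ℝ) : ℂ) * N x n)) m b} := by
  set M' : Ω → ℕ → ℂ := fun x n => ((6 : ℝ) : ℂ) * M x n
  set N' : Ω → ℕ → ℂ := fun x n => ((6 : ℝ) : ℂ) * N x n
  set D' : Ω → ℕ → ℝ := fun x n => 6 * D x n
  set E' : Ω → ℕ → ℝ := fun x n => 6 * E x n
  have hM' : Mart π μ M' D' := hM.smul 6 (by norm_num)
  have hN' : Mart π μ N' E' := hN.smul 6 (by norm_num)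
  have hm0 : (0 : ℝ) < m := by exact_mod_cast hm
  have hA := stepA hπ hM' hN' r s hr hr2 hs hs2 m hm (36 * γ * m) (by positivity) T
  set S1 := {x | 2 * m ≤ (mach (M' x) (N' x) (D' x) (E' x) T).c ∧
    Hsum r s (D' x) (E' x) T ≤ 36 * γ * m}
  set S2 := {x | m ≤ (mach (M' x) (N' x) (D' x) (E' x) T).c}
  have hA' : μ S1 ≤ ENNReal.ofReal (72 * γ) * μ S2 := by
    have h1 : μ.real S1 ≤ 72 * γ * μ.real S2 := by
      have : m * μ.real S1 ≤ m * (72 * γ * μ.real S2) := by linarith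
      exact le_of_mul_le_mul_left this hm0
    rw [← ofReal_measureReal (measure_ne_top μ S1), ← ofReal_measureReal (measure_ne_top μ S2),
      ← ENNReal.ofReal_mul (by positivity)]
    exact ENNReal.ofReal_le_ofReal h1
  calc μ {x | ∃ b ≤ T, Chain (big x) m b}
      ≤ μ ({x | γ * m < Hsum r s (D x) (E x) T} ∪ S1) := by
        refine measure_mono ?_
        rintro x ⟨b, hbT, hch⟩
        by_cases hx : γ * m < Hsum r s (D x) (E x) T
        · exact Or.inl hx
        · right
          push Not at hx
          constructor
          · refine chain_forces (M x) (N x) (D x) (E x) (hM.D0 x) (hN.D0 x) (hM.hM x) (hN.hM x)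
              r s hr hr2 hs hs2 (big x) T m b (fun a b h1 _ h2 => hbig x a b h1 h2) hch hbT ?_
            have : 216 * Hsum r s (D x) (E x) T ≤ m := by nlinarith
            exact this
          · have := Hsum_six r s hr hr2 hs hs2 (D x) (E x) (hM.D0 x) (hN.D0 x) T
            change Hsum r s (fun n => 6 * D x n) (fun n => 6 * E x n) T ≤ _
            linarith
    _ ≤ μ {x | γ * m < Hsum r s (D x) (E x) T} + μ S1 := measure_union_le _ _
    _ ≤ _ := by
        refine add_le_add le_rfl (hA'.trans (mul_le_mul le_rfl (measure_mono ?_) zero_le zero_le))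
        intro x hx
        exact mach_chain' (M' x) (N' x) (D' x) (E' x) T m hx

lemma iterB [IsFiniteMeasure μ] (hπ : Filt π)
    (r s : ℝ) (hr : 1 ≤ r) (hr2 : r ≤ 2) (hs : 1 ≤ s) (hs2 : s ≤ 2) (m : ℕ) (hm : 1 ≤ m)
    (γ : ℝ) (hγ : 0 ≤ γ) (hγ1 : γ ≤ 1 / 216) (T : ℕ) (n : ℕ) :
    ∀ (M N : Ω → ℕ → ℂ) (D E : Ω → ℕ → ℝ), Mart π μ M D → Mart π μ N E →
    ∀ (big : Ω → ℕ → ℕ → Prop), (∀ x a b, a < b → big x a b →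
      ∑ k ∈ Finset.Icc a b, (D x k ^ r + E x k ^ s) ≤ 1 / 36 → bigMN (M x) (N x) a b) →
    μ {x | ∃ b ≤ T, Chain (big x) m b} ≤
      ∑ l ∈ Finset.range n, ENNReal.ofReal (72 * γ) ^ l *
        μ {x | γ * m < 36 ^ l * Hsum r s (D x) (E x) T} +
      ENNReal.ofReal (72 * γ) ^ n * μ Set.univ := by
  induction n with
  | zero =>
    intro M N D E hM hN big hbig
    simpa using measure_mono (Set.subset_univ _)
  | succ n ih =>
    intro M N D E hM hN big hbig
    refine (stepB hπ hM hN r s hr hr2 hs hs2 m hm γ hγ hγ1 T big hbig).trans ?_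
    have hM' := hM.smul 6 (by norm_num)
    have hN' := hN.smul 6 (by norm_num)
    have := ih _ _ _ _ hM' hN' (fun x => bigMN (fun n => ((6 : ℝ) : ℂ) * M x n)
        (fun n => ((6 : ℝ) : ℂ) * N x n)) (fun x a b _ h _ => h)
    refine (add_le_add le_rfl (mul_le_mul le_rfl this zero_le zero_le)).trans ?_
    rw [Finset.sum_range_succ', mul_add, Finset.mul_sum, pow_zero, one_mul, pow_zero,
      add_comm, add_right_comm]
    simp only [one_mul]
    refine add_le_add (add_le_add (Finset.sum_le_sum fun l _ => ?_) le_rfl) (le_of_eq ?_)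
    · rw [← mul_assoc, ← pow_succ']
      refine mul_le_mul le_rfl (measure_mono fun x hx => ?_) zero_le zero_le
      have h6 := Hsum_six r s hr hr2 hs hs2 (D x) (E x) (hM.D0 x) (hN.D0 x) T
      simp only [Set.mem_ofPred_eq] at hx ⊢
      refine hx.trans_le ?_
      rw [pow_succ, mul_assoc]
      exact mul_le_mul_of_nonneg_left h6 (by positivity)
    · rw [← mul_assoc, ← pow_succ']

/-- Main distributional inequality for couplings. -/
lemma dist_main [IsFiniteMeasure μ] (hπ : Filt π) {M N X Y : Ω → ℕ → ℂ} {D E : Ω → ℕ → ℝ}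
    (hM : Mart π μ M D) (hN : Mart π μ N E)
    (r s : ℝ) (hr : 1 ≤ r) (hr2 : r ≤ 2) (hs : 1 ≤ s) (hs2 : s ≤ 2) (hne : r ≠ 1 ∨ s ≠ 1)
    (hX : ∀ x, Coup r (M x) (X x) (D x)) (hY : ∀ x, Coup s (N x) (Y x) (E x))
    (m : ℕ) (hm : 1 ≤ m) (γ : ℝ) (hγ : 0 ≤ γ) (hγ1 : γ ≤ 1 / 216) (T : ℕ) :
    μ {x | ∃ b ≤ T, Chain (bigXY (X x) (Y x)) m b} ≤
      ∑' l : ℕ, ENNReal.ofReal (72 * γ) ^ l *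
        μ {x | γ * m < 36 ^ l * Hsum r s (D x) (E x) T} := by
  have h1 := fun n => iterB (μ := μ) hπ r s hr hr2 hs hs2 m hm γ hγ hγ1 T n M N D E hM hN
    (fun x => bigXY (X x) (Y x)) (fun x a b hab hb hsm =>
      bigXY_big (M x) (N x) (X x) (Y x) (D x) (E x) (hM.D0 x) (hN.D0 x) (hM.hM x) r s hr hr2 hs hs2
        hne (hX x) (hY x) a b hab hb hsm)
  have hlim : Filter.Tendsto (fun n => (∑' l : ℕ, ENNReal.ofReal (72 * γ) ^ l *
        μ {x | γ * m < 36 ^ l * Hsum r s (D x) (E x) T}) +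
      ENNReal.ofReal (72 * γ) ^ n * μ Set.univ) Filter.atTop (nhds ((∑' l : ℕ,
        ENNReal.ofReal (72 * γ) ^ l *
        μ {x | γ * m < 36 ^ l * Hsum r s (D x) (E x) T}) + 0 * μ Set.univ)) := by
    refine Filter.Tendsto.add tendsto_const_nhds (ENNReal.Tendsto.mul_const ?_ (Or.inr (measure_ne_top _ _)))
    refine ENNReal.tendsto_pow_atTop_nhds_zero_of_lt_one ?_
    rw [ENNReal.ofReal_lt_one]
    linarith
  rw [zero_mul, add_zero] at hlim
  refine ge_of_tendsto' hlim fun n => (h1 n).trans ?_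
  exact add_le_add (ENNReal.sum_le_tsum _) le_rfl

end stepB

/-! ### Square-function type inequalities -/

lemma power_trick {ι : Type*} (c y : ι → ℝ≥0∞) (θ : ℝ) (hθ : 0 < θ) :
    (∑' k, c k * y k) ^ θ ≤ (∑' k, c k ^ (1 / 2 : ℝ)) ^ θ * ∑' k, c k ^ (θ / 2) * y k ^ θ := by
  set W := (∑' k, c k ^ (θ / 2) * y k ^ θ) ^ (1 / θ) with hW
  have hWθ : W ^ θ = ∑' k, c k ^ (θ / 2) * y k ^ θ := by
    rw [hW, ← ENNReal.rpow_mul, one_div_mul_cancel hθ.ne', ENNReal.rpow_one]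
  have h1 : ∀ k, c k ^ (1 / 2 : ℝ) * y k ≤ W := by
    intro k
    rw [← ENNReal.rpow_le_rpow_iff hθ, hWθ, ENNReal.mul_rpow_of_nonneg _ _ hθ.le,
      ← ENNReal.rpow_mul]
    have : 1 / 2 * θ = θ / 2 := by ring
    rw [this]
    exact ENNReal.le_tsum k
  rw [← hWθ, ← ENNReal.mul_rpow_of_nonneg _ _ hθ.le]
  refine ENNReal.rpow_le_rpow ?_ hθ.le
  rw [← ENNReal.tsum_mul_right]
  refine ENNReal.tsum_le_tsum fun k => ?_
  have : c k = c k ^ (1 / 2 : ℝ) * c k ^ (1 / 2 : ℝ) := by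
    rw [← ENNReal.rpow_add_of_nonneg _ _ (by norm_num) (by norm_num)]
    norm_num
  calc c k * y k = c k ^ (1 / 2 : ℝ) * (c k ^ (1 / 2 : ℝ) * y k) := by
        rw [← mul_assoc, ← this]
    _ ≤ _ := mul_le_mul le_rfl (h1 k) zero_le zero_le

lemma rpow_add_le (A a : ℝ≥0∞) (θ : ℝ) (hθ : 1 ≤ θ) :
    (A + a) ^ θ ≤ A ^ θ + ENNReal.ofReal θ * (a * (A + a) ^ (θ - 1)) := by
  by_cases ha : a = ⊤
  · have h1 : (A + a) ^ (θ - 1) ≠ 0 := by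
      rw [ha, add_top]
      rcases hθ.eq_or_lt with h | h
      · rw [← h]; simp
      · rw [ENNReal.top_rpow_of_pos (by linarith)]; simp
    have h2 : a * (A + a) ^ (θ - 1) = ⊤ := by rw [ha] at *; exact ENNReal.top_mul h1
    rw [h2, ENNReal.mul_top (by simp; linarith)]
    simp
  by_cases hA : A = ⊤
  · rw [hA, ENNReal.top_rpow_of_pos (by linarith)]
    simp
  lift A to ℝ≥0 using hA
  lift a to ℝ≥0 using ha
  by_cases hS : A + a = 0
  · have : A = 0 ∧ a = 0 := by simpa using hS
    rw [this.1, this.2]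
    simp [ENNReal.zero_rpow_of_pos (by linarith : 0 < θ)]
  have hSpos : (0 : ℝ) < A + a := by
    have : 0 < A + a := pos_iff_ne_zero.2 hS
    exact_mod_cast this
  have key : ((A : ℝ) + a) ^ θ ≤ (A : ℝ) ^ θ + θ * (a * ((A : ℝ) + a) ^ (θ - 1)) := by
    set S : ℝ := A + a with hSd
    have hB := one_add_mul_self_le_rpow_one_add (s := -(a / S))
      (by rw [neg_le_neg_iff, div_le_one hSpos]; rw [hSd]; simp) hθ
    have e1 : 1 + -((a : ℝ) / S) = A / S := by field_simp; rw [hSd]; ring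
    rw [e1, Real.div_rpow (by positivity) hSpos.le] at hB
    have hSθ : 0 < S ^ θ := Real.rpow_pos_of_pos hSpos _
    have e2 : S ^ (θ - 1) = S ^ θ / S := by rw [Real.rpow_sub_one hSpos.ne']
    rw [e2]
    have h3 := mul_le_mul_of_nonneg_left hB hSθ.le
    have e3 : S ^ θ * ((A : ℝ) ^ θ / S ^ θ) = (A : ℝ) ^ θ := by field_simp
    rw [e3] at h3
    have e4 : S ^ θ * (1 + θ * -(a / S)) = S ^ θ - θ * (a * (S ^ θ / S)) := by ring
    rw [e4] at h3
    linarith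
  have h0 : (0:ℝ) ≤ θ - 1 := by linarith
  have := ENNReal.ofReal_le_ofReal key
  rw [ENNReal.ofReal_add (by positivity) (by positivity), ENNReal.ofReal_mul (by positivity),
    ENNReal.ofReal_mul (by positivity), ← ENNReal.ofReal_rpow_of_nonneg (by positivity) (by positivity),
    ← ENNReal.ofReal_rpow_of_nonneg (by positivity) (by positivity),
    ← ENNReal.ofReal_rpow_of_nonneg (by positivity) h0,
    ENNReal.ofReal_add (by positivity) (by positivity)] at this
  simpa using this

lemma sum_rpow_le (s : Finset ℤ) (a : ℤ → ℝ≥0∞) (θ : ℝ) (hθ : 1 ≤ θ) :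
    (∑ i ∈ s, a i) ^ θ ≤ ENNReal.ofReal θ *
      ∑ i ∈ s, a i * (∑ j ∈ s.filter (· ≤ i), a j) ^ (θ - 1) := by
  induction s using Finset.induction_on_max with
  | empty => simp [ENNReal.zero_rpow_of_pos (by linarith : 0 < θ)]
  | insert m s hm ih =>
    have hnot : m ∉ s := fun h => lt_irrefl _ (hm m h)
    rw [Finset.sum_insert hnot, Finset.sum_insert hnot, add_comm (a m)]
    refine (rpow_add_le _ _ θ hθ).trans ?_
    rw [mul_add, add_comm]
    refine add_le_add ?_ (ih.trans ?_)
    · have : (insert m s).filter (· ≤ m) = insert m s := by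
        refine Finset.filter_true_of_mem fun x hx => ?_
        rcases Finset.mem_insert.1 hx with h | h
        · exact h.le
        · exact (hm x h).le
      rw [this, Finset.sum_insert hnot, add_comm (a m)]
    · refine mul_le_mul le_rfl (Finset.sum_le_sum fun i hi => ?_) zero_le zero_le
      refine mul_le_mul le_rfl (ENNReal.rpow_le_rpow ?_ (by linarith)) zero_le zero_le
      refine Finset.sum_le_sum_of_subset ?_
      intro x hx
      simp at hx ⊢
      exact ⟨Or.inr hx.1, hx.2⟩

/-- local averaging operator -/
def Kop (i : ℤ) (h : ℝ → ℝ≥0∞) (x : ℝ) : ℝ≥0∞ :=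
  ∫⁻ y, (if |x - y| < (2 : ℝ) ^ (-i) then (2 : ℝ≥0∞) ^ i else 0) * h y

lemma kern_meas (i : ℤ) : Measurable (fun z : ℝ × ℝ =>
    (if |z.1 - z.2| < (2 : ℝ) ^ (-i) then (2 : ℝ≥0∞) ^ i else 0)) := by
  refine Measurable.ite ?_ measurable_const measurable_const
  exact measurableSet_lt (by fun_prop) measurable_const

lemma kern_meas' (i : ℤ) (x : ℝ) : Measurable (fun y : ℝ =>
    (if |x - y| < (2 : ℝ) ^ (-i) then (2 : ℝ≥0∞) ^ i else 0)) :=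
  (kern_meas i).comp measurable_prodMk_left

lemma Kop_meas (i : ℤ) {h : ℝ → ℝ≥0∞} (hh : Measurable h) : Measurable (Kop i h) := by
  unfold Kop
  exact Measurable.lintegral_prod_right' (f := fun z : ℝ × ℝ =>
    (if |z.1 - z.2| < (2 : ℝ) ^ (-i) then (2 : ℝ≥0∞) ^ i else 0) * h z.2)
    ((kern_meas i).mul (hh.comp measurable_snd))

lemma Kop_mono (i : ℤ) {h h' : ℝ → ℝ≥0∞} (hh : ∀ x, h x ≤ h' x) (x : ℝ) :
    Kop i h x ≤ Kop i h' x :=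
  lintegral_mono fun y => mul_le_mul le_rfl (hh y) zero_le zero_le

lemma Kop_symm (i : ℤ) {f g : ℝ → ℝ≥0∞} (hf : Measurable f) (hg : Measurable g) :
    ∫⁻ x, Kop i f x * g x = ∫⁻ x, f x * Kop i g x := by
  have e1 : ∀ x, Kop i f x * g x = ∫⁻ y,
      (if |x - y| < (2 : ℝ) ^ (-i) then (2 : ℝ≥0∞) ^ i else 0) * f y * g x := by
    intro x
    exact (lintegral_mul_const _ (f := fun y => (if |x - y| < (2 : ℝ) ^ (-i) then (2 : ℝ≥0∞) ^ i else 0) * f y)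
      ((kern_meas' i x).mul hf)).symm
  have e2 : ∀ y, f y * Kop i g y = ∫⁻ x,
      (if |x - y| < (2 : ℝ) ^ (-i) then (2 : ℝ≥0∞) ^ i else 0) * f y * g x := by
    intro y
    unfold Kop
    rw [← lintegral_const_mul _ (f := fun z => (if |y - z| < (2 : ℝ) ^ (-i) then (2 : ℝ≥0∞) ^ i else 0) * g z)
      ((kern_meas' i y).mul hg)]
    refine lintegral_congr fun x => ?_
    rw [abs_sub_comm]
    ring
  simp only [e1, e2]
  refine lintegral_lintegral_swap ?_
  refine Measurable.aemeasurable ?_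
  exact ((kern_meas i).mul (hf.comp measurable_snd)).mul (hg.comp measurable_fst)

lemma two_zpow_real (i : ℤ) : ENNReal.ofReal ((2 : ℝ) ^ i) = (2 : ℝ≥0∞) ^ i := by
  have h : ((2 : ℝ≥0) : ℝ≥0∞) = 2 := rfl
  rw [← h, ← ENNReal.coe_zpow (by norm_num), ← ENNReal.ofReal_coe_nnreal]
  simp

lemma kern_mass (i : ℤ) (x : ℝ) :
    ∫⁻ y, (if |x - y| < (2 : ℝ) ^ (-i) then (2 : ℝ≥0∞) ^ i else 0) = 2 := by
  have : (fun y : ℝ => (if |x - y| < (2 : ℝ) ^ (-i) then (2 : ℝ≥0∞) ^ i else 0)) =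
      (Metric.ball x ((2 : ℝ) ^ (-i))).indicator (fun _ => (2 : ℝ≥0∞) ^ i) := by
    funext y
    by_cases h : |x - y| < (2 : ℝ) ^ (-i)
    · rw [if_pos h, Set.indicator_of_mem]
      rw [Metric.mem_ball, Real.dist_eq, abs_sub_comm]
      exact h
    · rw [if_neg h, Set.indicator_of_notMem]
      rw [Metric.mem_ball, Real.dist_eq, abs_sub_comm]
      exact h
  rw [this, lintegral_indicator_const measurableSet_ball, Real.volume_ball,
    ENNReal.ofReal_mul (by norm_num), two_zpow_real]
  rw [mul_left_comm, ← ENNReal.zpow_add (by norm_num) (by norm_num)]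
  simp

lemma Kop_const (i : ℤ) (c : ℝ≥0∞) (x : ℝ) : Kop i (fun _ => c) x = 2 * c := by
  unfold Kop
  rw [lintegral_mul_const _ (kern_meas' i x), kern_mass]

lemma Kop_shift {i j : ℤ} (hji : j ≤ i) (h : ℝ → ℝ≥0∞) {x y : ℝ}
    (hxy : |x - y| < (2 : ℝ) ^ (-i)) : Kop j h y ≤ 2 * Kop (j - 1) h x := by
  unfold Kop
  rw [← lintegral_const_mul' _ _ (by norm_num)]
  refine lintegral_mono fun z => ?_
  rw [← mul_assoc]
  refine mul_le_mul ?_ le_rfl zero_le zero_le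
  split_ifs with h1 h2
  · rw [ENNReal.zpow_sub (by norm_num) (by norm_num), mul_comm, zpow_one, mul_assoc,
      ENNReal.inv_mul_cancel (by norm_num) (by norm_num), mul_one]
  · exfalso
    apply h2
    have h3 : (2 : ℝ) ^ (-i) ≤ (2 : ℝ) ^ (-j) := zpow_le_zpow_right₀ (by norm_num) (by omega)
    have h4 : (2 : ℝ) ^ (-(j - 1)) = 2 ^ (-j) * 2 := by
      rw [neg_sub, sub_eq_neg_add, zpow_add₀ (by norm_num), zpow_one]
    rw [h4]
    have : |x - z| ≤ |x - y| + |y - z| := abs_sub_le _ _ _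
    linarith
  · exact zero_le
  · exact zero_le

lemma holder_const {α : Type*} [MeasurableSpace α] (μ : Measure α) (θ : ℝ) (hθ : 1 ≤ θ)
    {k h : α → ℝ≥0∞} (hk : Measurable k) (hh : Measurable h) :
    (∫⁻ y, k y * h y ∂μ) ^ θ ≤ (∫⁻ y, k y ∂μ) ^ (θ - 1) * ∫⁻ y, k y * h y ^ θ ∂μ := by
  rcases hθ.eq_or_lt with h1 | h1
  · rw [← h1]; simp
  have hpq : θ.HolderConjugate (Real.conjExponent θ) := Real.HolderConjugate.conjExponent h1
  set q := Real.conjExponent θ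
  have hq0 : 0 < q := hpq.symm.pos
  have hθ0 : 0 < θ := hpq.pos
  have h2 := ENNReal.lintegral_mul_le_Lp_mul_Lq μ hpq (f := fun y => k y ^ (1 / θ) * h y)
    (g := fun y => k y ^ (1 / q)) (by fun_prop) (by fun_prop)
  have e1 : ∀ y, ((fun y => k y ^ (1 / θ) * h y) * fun y => k y ^ (1 / q)) y = k y * h y := by
    intro y
    simp only [Pi.mul_apply]
    rw [mul_right_comm, ← ENNReal.rpow_add_of_nonneg _ _ (by positivity) (by positivity)]
    have : 1 / θ + 1 / q = 1 := by
      rw [one_div, one_div]; exact hpq.inv_add_inv_eq_one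
    rw [this, ENNReal.rpow_one]
  have e2 : ∀ y, (k y ^ (1 / θ) * h y) ^ θ = k y * h y ^ θ := by
    intro y
    rw [ENNReal.mul_rpow_of_nonneg _ _ hθ0.le, ← ENNReal.rpow_mul, one_div_mul_cancel hθ0.ne',
      ENNReal.rpow_one]
  have e3 : ∀ y, (k y ^ (1 / q)) ^ q = k y := by
    intro y
    rw [← ENNReal.rpow_mul, one_div_mul_cancel hq0.ne', ENNReal.rpow_one]
  rw [lintegral_congr e1] at h2
  simp only [e2, e3] at h2
  have h3 := ENNReal.rpow_le_rpow h2 hθ0.le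
  rw [ENNReal.mul_rpow_of_nonneg _ _ hθ0.le, ← ENNReal.rpow_mul, one_div_mul_cancel hθ0.ne',
      ENNReal.rpow_one, ← ENNReal.rpow_mul] at h3
  have e4 : 1 / q * θ = θ - 1 := by
    have := hpq.inv_add_inv_eq_one
    field_simp at this ⊢
    linarith
  rw [e4, mul_comm] at h3
  exact h3

lemma Kop_jensen (i : ℤ) {h : ℝ → ℝ≥0∞} (hh : Measurable h) (θ : ℝ) (hθ : 1 ≤ θ) (x : ℝ) :
    Kop i h x ^ θ ≤ 2 ^ (θ - 1) * Kop i (fun y => h y ^ θ) x := by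
  have := holder_const volume θ hθ (kern_meas' i x) hh
  rwa [kern_mass] at this

lemma Kop_lint (i : ℤ) {h : ℝ → ℝ≥0∞} (hh : Measurable h) :
    ∫⁻ x, Kop i h x = 2 * ∫⁻ x, h x := by
  have := Kop_symm i hh (measurable_const (a := (1 : ℝ≥0∞)))
  simp only [mul_one, Kop_const] at this
  rw [this, lintegral_mul_const _ hh, mul_comm]

lemma cancel_pow (x a : ℝ≥0∞) (η : ℝ) (hη : 0 < η) (hη1 : η ≤ 1) (hx : x ≠ ⊤)
    (h : x ≤ a * x ^ (1 - η)) : x ^ η ≤ a := by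
  by_cases hx0 : x = 0
  · rw [hx0, ENNReal.zero_rpow_of_pos hη]; exact zero_le
  have e : x = x ^ η * x ^ (1 - η) := by
    rw [← ENNReal.rpow_add _ _ hx0 hx]; simp
  rw [e] at h
  have e' : (x ^ η * x ^ (1 - η)) ^ (1 - η) = x ^ (1 - η) := by rw [← e]
  rw [e'] at h
  refine (ENNReal.mul_le_mul_iff_left ?_ ?_).1 h
  · simp [hx0, hx]
  · exact ENNReal.rpow_ne_top_of_nonneg (by linarith) hx

lemma holder_pow (θ : ℝ) (hθ : 1 ≤ θ) {f g : ℝ → ℝ≥0∞} (hf : Measurable f) (hg : Measurable g) :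
    ∫⁻ x, f x * g x ^ (θ - 1) ≤ (∫⁻ x, f x ^ θ) ^ (1 / θ) * (∫⁻ x, g x ^ θ) ^ (1 - 1 / θ) := by
  rcases hθ.eq_or_lt with h1 | h1
  · rw [← h1]; simp
  have hpq : θ.HolderConjugate (Real.conjExponent θ) := Real.HolderConjugate.conjExponent h1
  set q := Real.conjExponent θ
  have := ENNReal.lintegral_mul_le_Lp_mul_Lq volume hpq (f := f) (g := fun x => g x ^ (θ - 1))
    hf.aemeasurable (by fun_prop)
  have e : ∀ x, (g x ^ (θ - 1)) ^ q = g x ^ θ := by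
    intro x
    rw [← ENNReal.rpow_mul, hpq.sub_one_mul_conj]
  have e2 : 1 / q = 1 - 1 / θ := by
    have := hpq.inv_add_inv_eq_one
    rw [one_div, one_div]; linarith
  simp only [e, e2] at this
  exact this

lemma fs_apriori (θ : ℝ) (hθ : 1 ≤ θ) (s : Finset ℤ) (h : ℤ → ℝ → ℝ≥0∞)
    (hh : ∀ i, Measurable (h i)) (c : ℤ) :
    ∫⁻ x, (∑ i ∈ s, Kop (i + c) (h i) x) ^ θ ≤
      (s.card : ℝ≥0∞) ^ (θ - 1) * (s.card * (2 ^ (θ - 1) * (2 * ∫⁻ x, (∑ i ∈ s, h i x) ^ θ))) := by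
  have hθ0 : 0 ≤ θ := by linarith
  calc ∫⁻ x, (∑ i ∈ s, Kop (i + c) (h i) x) ^ θ
      ≤ ∫⁻ x, (s.card : ℝ≥0∞) ^ (θ - 1) * ∑ i ∈ s, 2 ^ (θ - 1) * Kop (i + c) (fun y => h i y ^ θ) x := by
        refine lintegral_mono fun x => ?_
        refine (ENNReal.rpow_sum_le_const_mul_sum_rpow s _ hθ).trans ?_
        refine mul_le_mul le_rfl (Finset.sum_le_sum fun i _ => ?_) zero_le zero_le
        exact Kop_jensen _ (hh i) θ hθ x
    _ = (s.card : ℝ≥0∞) ^ (θ - 1) * ∑ i ∈ s, 2 ^ (θ - 1) * (2 * ∫⁻ x, h i x ^ θ) := by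
        have hm : ∀ i, Measurable (fun x => Kop (i + c) (fun y => h i y ^ θ) x) :=
          fun i => Kop_meas _ ((hh i).pow_const θ)
        rw [lintegral_const_mul _ (Finset.measurable_sum _ fun i _ => (hm i).const_mul _),
          lintegral_finsetSum _ fun i _ => (hm i).const_mul _]
        congr 1
        refine Finset.sum_congr rfl fun i _ => ?_
        rw [lintegral_const_mul _ (hm i), Kop_lint _ ((hh i).pow_const θ)]
    _ ≤ _ := by
        refine mul_le_mul le_rfl ?_ zero_le zero_le
        rw [← nsmul_eq_mul, ← Finset.sum_const]
        refine Finset.sum_le_sum fun i hi => ?_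
        gcongr with x
        exact Finset.single_le_sum (f := fun i => h i x) (fun _ _ => zero_le) hi

lemma fs_base (θ : ℝ) (hθ : 1 ≤ θ) : ∃ C : ℝ≥0∞, C ≠ ⊤ ∧ ∀ (s : Finset ℤ) (h : ℤ → ℝ → ℝ≥0∞),
    (∀ i, Measurable (h i)) → ∀ c : ℤ,
    ∫⁻ x, (∑ i ∈ s, Kop (i + c) (h i) x) ^ θ ≤ C * ∫⁻ x, (∑ i ∈ s, h i x) ^ θ := by
  have hθ0 : 0 < θ := by linarith
  have hθ1 : 0 ≤ θ - 1 := by linarith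
  set A : ℝ≥0∞ := ENNReal.ofReal θ * (2 * 2 ^ (θ - 1)) with hA
  have hAtop : A ≠ ⊤ := by
    rw [hA]
    refine ENNReal.mul_ne_top (by simp) (ENNReal.mul_ne_top (by simp) ?_)
    exact ENNReal.rpow_ne_top_of_nonneg hθ1 (by simp)
  have hApos : A ≠ 0 := by
    rw [hA]
    simp [hθ0]
  refine ⟨A ^ θ, ENNReal.rpow_ne_top_of_nonneg hθ0.le hAtop, ?_⟩
  intro s h hh c
  set I := ∫⁻ x, (∑ i ∈ s, h i x) ^ θ with hI
  by_cases hItop : I = ⊤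
  · rw [hItop, ENNReal.mul_top]
    · exact le_top
    · simp [hApos, hAtop]
  set φ : ℤ → ℝ≥0∞ := fun c => ∫⁻ x, (∑ i ∈ s, Kop (i + c) (h i) x) ^ θ with hφ
  have hKm : ∀ c i, Measurable (fun x => Kop (i + c) (h i) x) := fun c i => Kop_meas _ (hh i)
  have step : ∀ c, φ c ≤ A * I ^ (1 / θ) * φ (c - 1) ^ (1 - 1 / θ) := by
    intro c
    set B : ℝ → ℝ≥0∞ := fun x => ∑ j ∈ s, Kop (j + (c - 1)) (h j) x with hB
    have hBm : Measurable B := Finset.measurable_sum _ fun j _ => hKm (c - 1) j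
    have hpm : ∀ i, Measurable (fun x => (∑ j ∈ s.filter (· ≤ i), Kop (j + c) (h j) x) ^ (θ - 1)) :=
      fun i => (Finset.measurable_sum _ fun j _ => hKm c j).pow_const _
    have hm2 : ∀ i, Measurable (fun x => Kop (i + c) (h i) x *
        (∑ j ∈ s.filter (· ≤ i), Kop (j + c) (h j) x) ^ (θ - 1)) := fun i => (hKm c i).mul (hpm i)
    have hm3 : ∀ i, Measurable (fun x => h i x * (2 * 2 ^ (θ - 1) * B x ^ (θ - 1))) :=
      fun i => (hh i).mul ((hBm.pow_const _).const_mul _)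
    have hm4 : Measurable (fun x => (∑ i ∈ s, h i x) * B x ^ (θ - 1)) :=
      (Finset.measurable_sum _ fun i _ => hh i).mul (hBm.pow_const _)
    calc φ c ≤ ∫⁻ x, ENNReal.ofReal θ * ∑ i ∈ s, Kop (i + c) (h i) x *
          (∑ j ∈ s.filter (· ≤ i), Kop (j + c) (h j) x) ^ (θ - 1) :=
          lintegral_mono fun x => sum_rpow_le s _ θ hθ
      _ = ENNReal.ofReal θ * ∑ i ∈ s, ∫⁻ x, Kop (i + c) (h i) x *
          (∑ j ∈ s.filter (· ≤ i), Kop (j + c) (h j) x) ^ (θ - 1) := by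
          rw [lintegral_const_mul _ (Finset.measurable_sum _ fun i _ => hm2 i),
            lintegral_finsetSum _ fun i _ => hm2 i]
      _ ≤ ENNReal.ofReal θ * ∑ i ∈ s, ∫⁻ x, h i x * (2 * 2 ^ (θ - 1) * B x ^ (θ - 1)) := by
          refine mul_le_mul le_rfl (Finset.sum_le_sum fun i _ => ?_) zero_le zero_le
          rw [Kop_symm _ (hh i) (hpm i)]
          refine lintegral_mono fun x => mul_le_mul le_rfl ?_ zero_le zero_le
          have hle : ∀ y, |x - y| < (2 : ℝ) ^ (-(i + c)) →
              (∑ j ∈ s.filter (· ≤ i), Kop (j + c) (h j) y) ^ (θ - 1) ≤ (2 * B x) ^ (θ - 1) := by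
            intro y hy
            refine ENNReal.rpow_le_rpow ?_ hθ1
            rw [hB, Finset.mul_sum]
            refine (Finset.sum_le_sum fun j hj => ?_).trans
              (Finset.sum_le_sum_of_subset (Finset.filter_subset (· ≤ i) s))
            have hji : j ≤ i := (Finset.mem_filter.1 hj).2
            have := Kop_shift (i := i + c) (j := j + c) (by omega) (h j) hy
            rwa [add_sub_assoc] at this
          calc Kop (i + c) (fun y => (∑ j ∈ s.filter (· ≤ i), Kop (j + c) (h j) y) ^ (θ - 1)) x
              ≤ Kop (i + c) (fun _ => (2 * B x) ^ (θ - 1)) x := by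
                unfold Kop
                refine lintegral_mono fun y => ?_
                by_cases hy : |x - y| < (2 : ℝ) ^ (-(i + c))
                · simp only [if_pos hy]
                  exact mul_le_mul le_rfl (hle y hy) zero_le zero_le
                · simp only [if_neg hy, zero_mul, le_refl]
            _ = _ := by
                rw [Kop_const, ENNReal.mul_rpow_of_nonneg _ _ hθ1, mul_assoc]
      _ = A * ∫⁻ x, (∑ i ∈ s, h i x) * B x ^ (θ - 1) := by
          rw [← lintegral_finsetSum _ fun i _ => hm3 i,
            hA, mul_assoc, ← lintegral_const_mul _ hm4]
          congr 1
          refine lintegral_congr fun x => ?_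
          rw [← Finset.sum_mul]
          ring
      _ ≤ A * (I ^ (1 / θ) * φ (c - 1) ^ (1 - 1 / θ)) :=
          mul_le_mul le_rfl (holder_pow θ hθ (Finset.measurable_sum _ fun i _ => hh i) hBm)
            zero_le zero_le
      _ = _ := (mul_assoc _ _ _).symm
  set Φ := ⨆ c, φ c with hΦ
  have hΦtop : Φ ≠ ⊤ := by
    refine ne_top_of_le_ne_top ?_ (iSup_le fun c => fs_apriori θ hθ s h hh c)
    refine ENNReal.mul_ne_top (ENNReal.rpow_ne_top_of_nonneg hθ1 (by simp))
      (ENNReal.mul_ne_top (by simp) (ENNReal.mul_ne_top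
        (ENNReal.rpow_ne_top_of_nonneg hθ1 (by simp)) (ENNReal.mul_ne_top (by simp) hItop)))
  have h1θ : 1 / θ ≤ 1 := by rw [div_le_one hθ0]; exact hθ
  have hΦs : Φ ≤ A * I ^ (1 / θ) * Φ ^ (1 - 1 / θ) := by
    refine iSup_le fun c => (step c).trans ?_
    refine mul_le_mul le_rfl (ENNReal.rpow_le_rpow ?_ (by linarith)) zero_le zero_le
    exact le_iSup φ (c - 1)
  have h2 := cancel_pow Φ _ (1 / θ) (by positivity) h1θ hΦtop hΦs
  have h3 := ENNReal.rpow_le_rpow h2 hθ0.le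
  rw [ENNReal.mul_rpow_of_nonneg _ _ hθ0.le, ← ENNReal.rpow_mul, ← ENNReal.rpow_mul,
    one_div_mul_cancel hθ0.ne', ENNReal.rpow_one, ENNReal.rpow_one] at h3
  exact (le_iSup φ c).trans h3

lemma fs1 (p r : ℝ) (hr : 1 ≤ r) (hpr : r ≤ p) : ∃ C : ℝ≥0∞, C ≠ ⊤ ∧
    ∀ (s : Finset ℤ) (h : ℤ → ℝ → ℝ≥0∞), (∀ i, Measurable (h i)) → ∀ c : ℤ,
    ∫⁻ x, (∑ i ∈ s, Kop (i + c) (h i) x ^ r) ^ (p / r) ≤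
      C * ∫⁻ x, (∑ i ∈ s, h i x ^ r) ^ (p / r) := by
  have hr0 : 0 < r := by linarith
  have hθ : 1 ≤ p / r := by rw [one_le_div hr0]; exact hpr
  obtain ⟨C, hC, hb⟩ := fs_base (p / r) hθ
  refine ⟨((2 : ℝ≥0∞) ^ (r - 1)) ^ (p / r) * C, ENNReal.mul_ne_top
    (ENNReal.rpow_ne_top_of_nonneg (by linarith)
      (ENNReal.rpow_ne_top_of_nonneg (by linarith) (by simp))) hC, ?_⟩
  intro s h hh c
  have := hb s (fun i x => h i x ^ r) (fun i => (hh i).pow_const r) c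
  calc ∫⁻ x, (∑ i ∈ s, Kop (i + c) (h i) x ^ r) ^ (p / r)
      ≤ ∫⁻ x, ((2 : ℝ≥0∞) ^ (r - 1)) ^ (p / r) *
          (∑ i ∈ s, Kop (i + c) (fun y => h i y ^ r) x) ^ (p / r) := by
        refine lintegral_mono fun x => ?_
        rw [← ENNReal.mul_rpow_of_nonneg _ _ (by linarith), Finset.mul_sum]
        exact ENNReal.rpow_le_rpow (Finset.sum_le_sum fun i _ => Kop_jensen _ (hh i) r hr x)
          (by linarith)
    _ = ((2 : ℝ≥0∞) ^ (r - 1)) ^ (p / r) *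
          ∫⁻ x, (∑ i ∈ s, Kop (i + c) (fun y => h i y ^ r) x) ^ (p / r) := by
        rw [lintegral_const_mul]
        exact (Finset.measurable_sum _ fun i _ => Kop_meas _ ((hh i).pow_const r)).pow_const _
    _ ≤ _ := by rw [mul_assoc]; exact mul_le_mul le_rfl this zero_le zero_le

lemma fs2_core (p r p' r' : ℝ) (hp : p.HolderConjugate p') (hr : r.HolderConjugate r')
    (C : ℝ≥0∞)
    (s : Finset ℤ) (h : ℤ → ℝ → ℝ≥0∞) (hh : ∀ i, Measurable (h i)) (c : ℤ)
    (hC : ∀ (k : ℤ → ℝ → ℝ≥0∞), (∀ i, Measurable (k i)) →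
      ∫⁻ x, (∑ i ∈ s, Kop (i + c) (k i) x ^ r') ^ (p' / r') ≤
      C * ∫⁻ x, (∑ i ∈ s, k i x ^ r') ^ (p' / r'))
    (E : Set ℝ) (hE : MeasurableSet E) (hEv : volume E ≠ ⊤) (N : ℝ≥0∞) (hN : N ≠ ⊤)
    (hE0 : ∀ x ∈ E, (∑ i ∈ s, Kop (i + c) (h i) x ^ r) ≠ 0)
    (hE1 : ∀ x ∈ E, (∑ i ∈ s, Kop (i + c) (h i) x ^ r) ≤ N) :
    ∫⁻ x in E, (∑ i ∈ s, Kop (i + c) (h i) x ^ r) ^ (p / r) ≤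
      C ^ (p - 1) * ∫⁻ x, (∑ i ∈ s, h i x ^ r) ^ (p / r) := by
  have hp0 : 0 < p := hp.pos
  have hp0' : 0 < p' := hp.symm.pos
  have hr0 : 0 < r := hr.pos
  have hr0' : 0 < r' := hr.symm.pos
  have hpi := hp.inv_add_inv_eq_one
  have hri := hr.inv_add_inv_eq_one
  set S : ℝ → ℝ≥0∞ := fun x => ∑ i ∈ s, Kop (i + c) (h i) x ^ r with hS
  set I := ∫⁻ x in E, S x ^ (p / r) with hI
  set R := ∫⁻ x, (∑ i ∈ s, h i x ^ r) ^ (p / r) with hR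
  have hKm : ∀ i, Measurable (fun x => Kop (i + c) (h i) x) := fun i => Kop_meas _ (hh i)
  have hSm : Measurable S := Finset.measurable_sum _ fun i _ => (hKm i).pow_const r
  have hItop : I ≠ ⊤ := by
    have : I ≤ ∫⁻ x in E, N ^ (p / r) :=
      setLIntegral_mono measurable_const fun x hx =>
        ENNReal.rpow_le_rpow (hE1 x hx) (by positivity)
    refine ne_top_of_le_ne_top ?_ this
    rw [setLIntegral_const]
    exact ENNReal.mul_ne_top (ENNReal.rpow_ne_top_of_nonneg (by positivity) hN) hEv
  set k : ℤ → ℝ → ℝ≥0∞ := fun i => E.indicator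
    (fun x => Kop (i + c) (h i) x ^ (r - 1) * S x ^ (p / r - 1)) with hk
  have hkm : ∀ i, Measurable (k i) := fun i =>
    Measurable.indicator (((hKm i).pow_const _).mul (hSm.pow_const _)) hE
  have e1 : ∀ x, E.indicator (fun x => S x ^ (p / r)) x
      = ∑ i ∈ s, Kop (i + c) (h i) x * k i x := by
    intro x
    by_cases hx : x ∈ E
    · simp only [hk, Set.indicator_of_mem hx]
      have hS0 := hE0 x hx
      have hS1 : S x ≠ ⊤ := ne_top_of_le_ne_top hN (hE1 x hx)
      have e : ∀ i, Kop (i + c) (h i) x * (Kop (i + c) (h i) x ^ (r - 1) * S x ^ (p / r - 1))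
          = Kop (i + c) (h i) x ^ r * S x ^ (p / r - 1) := by
        intro i
        rw [← mul_assoc]
        congr 1
        have : r = 1 + (r - 1) := by ring
        conv_rhs => rw [this, ENNReal.rpow_add_of_nonneg _ _ (by norm_num)
          (by linarith [hr.lt]), ENNReal.rpow_one]
      simp only [e]
      rw [← Finset.sum_mul]
      change _ = S x * _
      have : p / r = 1 + (p / r - 1) := by ring
      conv_lhs => rw [this, ENNReal.rpow_add _ _ hS0 hS1, ENNReal.rpow_one]
    · simp [hk, Set.indicator_of_notMem hx]
  have e2 : ∫⁻ x, (∑ i ∈ s, k i x ^ r') ^ (p' / r') = I := by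
    rw [hI, ← lintegral_indicator hE]
    refine lintegral_congr fun x => ?_
    by_cases hx : x ∈ E
    · simp only [hk, Set.indicator_of_mem hx]
      have hS0 := hE0 x hx
      have hS1 : S x ≠ ⊤ := ne_top_of_le_ne_top hN (hE1 x hx)
      have e : ∀ i, (Kop (i + c) (h i) x ^ (r - 1) * S x ^ (p / r - 1)) ^ r'
          = Kop (i + c) (h i) x ^ r * (S x ^ (p / r - 1)) ^ r' := by
        intro i
        rw [ENNReal.mul_rpow_of_nonneg _ _ hr0'.le, ← ENNReal.rpow_mul, hr.sub_one_mul_conj]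
      simp only [e]
      rw [← Finset.sum_mul]
      change (S x * _) ^ _ = _
      rw [← ENNReal.rpow_mul]
      conv_lhs => rw [← ENNReal.rpow_one (S x)]
      rw [ENNReal.rpow_one (S x)]
      nth_rewrite 1 [← ENNReal.rpow_one (S x)]
      rw [← ENNReal.rpow_add _ _ hS0 hS1, ← ENNReal.rpow_mul]
      congr 1
      have h1 : 1 / r' = 1 - 1 / r := by rw [one_div, one_div]; linarith
      have h2 : p' * (p - 1) = p := by rw [mul_comm]; exact hp.sub_one_mul_conj
      calc (1 + (p / r - 1) * r') * (p' / r') = p' * (1 / r' + (p / r - 1)) := by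
            field_simp
        _ = (p' * (p - 1)) / r := by rw [h1]; ring
        _ = _ := by rw [h2]
    · simp only [hk, Set.indicator_of_notMem hx]
      rw [ENNReal.zero_rpow_of_pos hr0', Finset.sum_const_zero,
        ENNReal.zero_rpow_of_pos (by positivity)]
  have hmk : ∀ i, Measurable (fun x => Kop (i + c) (h i) x * k i x) :=
    fun i => (hKm i).mul (hkm i)
  have hmk' : ∀ i, Measurable (fun x => h i x * Kop (i + c) (k i) x) :=
    fun i => (hh i).mul (Kop_meas _ (hkm i))
  have key : I ≤ R ^ (1 / p) * (C * I) ^ (1 / p') := by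
    calc I = ∫⁻ x, ∑ i ∈ s, Kop (i + c) (h i) x * k i x := by
          rw [hI, ← lintegral_indicator hE]
          exact lintegral_congr e1
      _ = ∫⁻ x, ∑ i ∈ s, h i x * Kop (i + c) (k i) x := by
          rw [lintegral_finsetSum _ fun i _ => hmk i, lintegral_finsetSum _ fun i _ => hmk' i]
          exact Finset.sum_congr rfl fun i _ => Kop_symm _ (hh i) (hkm i)
      _ ≤ ∫⁻ x, ((fun x => (∑ i ∈ s, h i x ^ r) ^ (1 / r)) *
            (fun x => (∑ i ∈ s, Kop (i + c) (k i) x ^ r') ^ (1 / r'))) x :=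
          lintegral_mono fun x => ENNReal.inner_le_Lp_mul_Lq s _ _ hr
      _ ≤ _ := ENNReal.lintegral_mul_le_Lp_mul_Lq volume hp
            ((Finset.measurable_sum _ fun i _ => (hh i).pow_const r).pow_const _).aemeasurable
            ((Finset.measurable_sum _ fun i _ =>
              (Kop_meas _ (hkm i)).pow_const r').pow_const _).aemeasurable
      _ ≤ R ^ (1 / p) * (C * I) ^ (1 / p') := by
          simp only [← ENNReal.rpow_mul, one_div_mul_eq_div]
          refine mul_le_mul le_rfl (ENNReal.rpow_le_rpow ?_ (by positivity)) zero_le zero_le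
          rw [← e2]
          exact hC k hkm
  have hpe : 1 / p' = 1 - 1 / p := by rw [one_div, one_div]; linarith
  rw [ENNReal.mul_rpow_of_nonneg _ _ (by positivity), ← mul_assoc] at key
  rw [show I ^ (1 / p') = I ^ (1 - 1 / p) by rw [hpe]] at key
  have h2 := cancel_pow I _ (1 / p) (by positivity) (by
    rw [div_le_one hp0]; exact hp.lt.le) hItop key
  have h3 := ENNReal.rpow_le_rpow h2 hp0.le
  rw [ENNReal.mul_rpow_of_nonneg _ _ hp0.le, ← ENNReal.rpow_mul, ← ENNReal.rpow_mul,
    ← ENNReal.rpow_mul,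
    one_div_mul_cancel hp0.ne', ENNReal.rpow_one, ENNReal.rpow_one, mul_comm] at h3
  have : 1 / p' * p = p - 1 := by rw [hpe]; field_simp
  rwa [this] at h3

lemma Kop_le_lint (i : ℤ) (h : ℝ → ℝ≥0∞) (x : ℝ) :
    Kop i h x ≤ (2 : ℝ≥0∞) ^ i * ∫⁻ y, h y := by
  unfold Kop
  rw [← lintegral_const_mul' _ _ (ENNReal.zpow_ne_top (by norm_num) (by norm_num) i)]
  refine lintegral_mono fun y => mul_le_mul ?_ le_rfl zero_le zero_le
  split_ifs
  · exact le_rfl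
  · exact zero_le

lemma fs2 (p r : ℝ) (hp : 1 < p) (hpr : p < r) : ∃ C : ℝ≥0∞, C ≠ ⊤ ∧
    ∀ (s : Finset ℤ) (h : ℤ → ℝ → ℝ≥0∞), (∀ i, Measurable (h i)) → ∀ c : ℤ,
    ∫⁻ x, (∑ i ∈ s, Kop (i + c) (h i) x ^ r) ^ (p / r) ≤
      C * ∫⁻ x, (∑ i ∈ s, h i x ^ r) ^ (p / r) := by
  have hr1 : 1 < r := hp.trans hpr
  have hp0 : 0 < p := by linarith
  have hr0 : 0 < r := by linarith
  have hpc : p.HolderConjugate (Real.conjExponent p) := Real.HolderConjugate.conjExponent hp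
  have hrc : r.HolderConjugate (Real.conjExponent r) := Real.HolderConjugate.conjExponent hr1
  have hle : Real.conjExponent r ≤ Real.conjExponent p := by
    unfold Real.conjExponent
    rw [div_le_div_iff₀ (by linarith) (by linarith)]
    nlinarith
  obtain ⟨C, hC, hb⟩ := fs1 (Real.conjExponent p) (Real.conjExponent r) hrc.symm.lt.le hle
  refine ⟨C ^ (p - 1) + 1, by
    simp [ENNReal.rpow_ne_top_of_nonneg (by linarith : 0 ≤ p - 1) hC], ?_⟩
  intro s h hh c
  set R := ∫⁻ x, (∑ i ∈ s, h i x ^ r) ^ (p / r) with hR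
  by_cases hRtop : R = ⊤
  · rw [hRtop, ENNReal.mul_top (by simp)]
    exact le_top
  set S : ℝ → ℝ≥0∞ := fun x => ∑ i ∈ s, Kop (i + c) (h i) x ^ r with hS
  have hSm : Measurable S := Finset.measurable_sum _ fun i _ => (Kop_meas _ (hh i)).pow_const r
  have hStop : ∀ x, S x ≠ ⊤ := by
    intro x
    refine (ENNReal.sum_lt_top.2 fun i hi => ?_).ne
    refine ENNReal.rpow_lt_top_of_nonneg hr0.le ?_
    have h1 : Kop (i + c) (h i) x ^ p ≤ 2 ^ (p - 1) * ((2 : ℝ≥0∞) ^ (i + c) * R) := by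
      refine (Kop_jensen _ (hh i) p hp.le x).trans ?_
      refine mul_le_mul le_rfl ((Kop_le_lint _ _ _).trans ?_) zero_le zero_le
      refine mul_le_mul le_rfl (lintegral_mono fun y => ?_) zero_le zero_le
      have : h i y ^ p = (h i y ^ r) ^ (p / r) := by
        rw [← ENNReal.rpow_mul]; congr 1; field_simp
      simp only [this]
      exact ENNReal.rpow_le_rpow
        (Finset.single_le_sum (f := fun i => h i y ^ r) (fun _ _ => zero_le) hi) (by positivity)
    intro htop
    rw [htop, ENNReal.top_rpow_of_pos hp0, top_le_iff] at h1
    refine ENNReal.mul_ne_top (ENNReal.rpow_ne_top_of_nonneg (by linarith) (by simp))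
      (ENNReal.mul_ne_top (ENNReal.zpow_ne_top (by norm_num) (by norm_num) _) hRtop) h1
  set E : ℕ → Set ℝ := fun N => {x | S x ≠ 0 ∧ S x ≤ (N : ℝ≥0∞)} ∩ Set.Icc (-(N : ℝ)) N with hE
  have hEm : ∀ N, MeasurableSet (E N) := by
    intro N
    refine MeasurableSet.inter (MeasurableSet.inter ?_ ?_) measurableSet_Icc
    · exact (hSm (measurableSet_singleton 0)).compl
    · exact measurableSet_le hSm measurable_const
  have hmono : Monotone E := by
    intro a b hab x hx
    have hab' : (a : ℝ) ≤ b := by exact_mod_cast hab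
    refine ⟨⟨hx.1.1, hx.1.2.trans (by exact_mod_cast hab)⟩, ?_, ?_⟩
    · linarith [hx.2.1]
    · linarith [hx.2.2]
  have hsupp : (fun x => S x ^ (p / r)).support ⊆ ⋃ N, E N := by
    intro x hx
    have hS0 : S x ≠ 0 := by
      intro h0
      apply hx
      simp only [h0]
      exact ENNReal.zero_rpow_of_pos (by positivity)
    obtain ⟨n1, hn1⟩ := ENNReal.exists_nat_gt (hStop x)
    obtain ⟨n2, hn2⟩ := exists_nat_gt |x|
    refine Set.mem_iUnion.2 ⟨max n1 n2, ⟨hS0, hn1.le.trans ?_⟩, ?_⟩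
    · exact_mod_cast le_max_left n1 n2
    · have : |x| ≤ ((max n1 n2 : ℕ) : ℝ) := hn2.le.trans (by exact_mod_cast le_max_right n1 n2)
      exact abs_le.1 this
  rw [← setLIntegral_eq_of_support_subset hsupp,
    setLIntegral_iUnion_of_directed _ hmono.directed_le]
  refine iSup_le fun N => ?_
  refine (fs2_core p r _ _ hpc hrc C s h hh c (fun k hk => hb s k hk c) (E N) (hEm N) ?_
    (N : ℝ≥0∞) (by simp) (fun x hx => hx.1.1) (fun x hx => hx.1.2)).trans ?_
  · refine ne_top_of_le_ne_top ?_ (measure_mono Set.inter_subset_right)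
    simp
  · exact mul_le_mul (le_add_of_nonneg_right zero_le) le_rfl zero_le zero_le

lemma fsZ (p r : ℝ) (hp : 1 < p) (hr : 1 ≤ r) : ∃ C : ℝ≥0∞, C ≠ ⊤ ∧
    ∀ (h : ℤ → ℝ → ℝ≥0∞), (∀ i, Measurable (h i)) → ∀ c : ℤ,
    ∫⁻ x, (∑' i, Kop (i + c) (h i) x ^ r) ^ (p / r) ≤
      C * ∫⁻ x, (∑' i, h i x ^ r) ^ (p / r) := by
  have hr0 : 0 < r := by linarith
  have hθ : 0 < p / r := by positivity
  obtain ⟨C, hC, hb⟩ : ∃ C : ℝ≥0∞, C ≠ ⊤ ∧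
    ∀ (s : Finset ℤ) (h : ℤ → ℝ → ℝ≥0∞), (∀ i, Measurable (h i)) → ∀ c : ℤ,
    ∫⁻ x, (∑ i ∈ s, Kop (i + c) (h i) x ^ r) ^ (p / r) ≤
      C * ∫⁻ x, (∑ i ∈ s, h i x ^ r) ^ (p / r) := by
    rcases le_or_gt r p with h | h
    · exact fs1 p r hr h
    · exact fs2 p r hp h
  refine ⟨C, hC, fun h hh c => ?_⟩
  have e : ∀ x, (∑' i, Kop (i + c) (h i) x ^ r) ^ (p / r) =
      ⨆ s : Finset ℤ, (∑ i ∈ s, Kop (i + c) (h i) x ^ r) ^ (p / r) := by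
    intro x
    rw [ENNReal.tsum_eq_iSup_sum]
    exact (ENNReal.orderIsoRpow (p / r) hθ).map_iSup _
  simp only [e]
  rw [lintegral_iSup_directed]
  · refine iSup_le fun s => (hb s h hh c).trans ?_
    refine mul_le_mul le_rfl (lintegral_mono fun x => ?_) zero_le zero_le
    exact ENNReal.rpow_le_rpow (ENNReal.sum_le_tsum s) hθ.le
  · intro s
    exact ((Finset.measurable_sum _ fun i _ =>
      (Kop_meas _ (hh i)).pow_const r).pow_const _).aemeasurable
  · refine Monotone.directed_le ?_
    intro s t hst x
    exact ENNReal.rpow_le_rpow (Finset.sum_le_sum_of_subset hst) hθ.le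

lemma mix_sum (p r : ℝ) (hp : 0 < p) (hr : 0 < r) {ι : Type} [Countable ι] (w : ι → ℝ≥0∞)
    (hw : ∀ θ : ℝ, 0 < θ → ∑' d, w d ^ θ ≠ ⊤) : ∃ C : ℝ≥0∞, C ≠ ⊤ ∧
    ∀ (G : ι → ℤ → ℝ → ℝ≥0∞), (∀ d n, Measurable (G d n)) → ∀ B : ℝ≥0∞,
      (∀ d, ∫⁻ x, (∑' n, G d n x ^ r) ^ (p / r) ≤ B) →
      ∫⁻ x, (∑' n, (∑' d, w d * G d n x) ^ r) ^ (p / r) ≤ C * B := by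
  have hθ : 0 < p / r := by positivity
  set C1 := (∑' d, w d ^ (1 / 2 : ℝ)) ^ r with hC1
  set C2 := (∑' d, (w d ^ (r / 2)) ^ (1 / 2 : ℝ)) ^ (p / r) with hC2
  set C3 := ∑' d, (w d ^ (r / 2)) ^ (p / r / 2) with hC3
  have h1 : C1 ≠ ⊤ := ENNReal.rpow_ne_top_of_nonneg hr.le (hw _ (by norm_num))
  have h2 : C2 ≠ ⊤ := by
    refine ENNReal.rpow_ne_top_of_nonneg hθ.le ?_
    simp only [← ENNReal.rpow_mul]
    exact hw _ (by positivity)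
  have h3 : C3 ≠ ⊤ := by
    rw [hC3]
    simp only [← ENNReal.rpow_mul]
    exact hw _ (by positivity)
  refine ⟨C1 ^ (p / r) * (C2 * C3), ENNReal.mul_ne_top
    (ENNReal.rpow_ne_top_of_nonneg hθ.le h1) (ENNReal.mul_ne_top h2 h3), ?_⟩
  intro G hG B hB
  have hSm : ∀ d, Measurable (fun x => (∑' n, G d n x ^ r) ^ (p / r)) := fun d =>
    (Measurable.tsum fun n => (hG d n).pow_const r).pow_const _
  have hpt : ∀ x, (∑' n, (∑' d, w d * G d n x) ^ r) ^ (p / r) ≤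
      C1 ^ (p / r) * (C2 * ∑' d, (w d ^ (r / 2)) ^ (p / r / 2) * (∑' n, G d n x ^ r) ^ (p / r)) := by
    intro x
    calc (∑' n, (∑' d, w d * G d n x) ^ r) ^ (p / r)
        ≤ (∑' n, C1 * ∑' d, w d ^ (r / 2) * G d n x ^ r) ^ (p / r) :=
          ENNReal.rpow_le_rpow (ENNReal.tsum_le_tsum fun n => power_trick _ _ r hr) hθ.le
      _ = C1 ^ (p / r) * (∑' d, w d ^ (r / 2) * ∑' n, G d n x ^ r) ^ (p / r) := by
          rw [ENNReal.tsum_mul_left, ENNReal.mul_rpow_of_nonneg _ _ hθ.le, ENNReal.tsum_comm]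
          simp only [ENNReal.tsum_mul_left]
      _ ≤ _ := mul_le_mul le_rfl (power_trick _ _ _ hθ) zero_le zero_le
  calc ∫⁻ x, (∑' n, (∑' d, w d * G d n x) ^ r) ^ (p / r)
      ≤ ∫⁻ x, C1 ^ (p / r) *
        (C2 * ∑' d, (w d ^ (r / 2)) ^ (p / r / 2) * (∑' n, G d n x ^ r) ^ (p / r)) :=
        lintegral_mono hpt
    _ = C1 ^ (p / r) *
        (C2 * ∑' d, (w d ^ (r / 2)) ^ (p / r / 2) * ∫⁻ x, (∑' n, G d n x ^ r) ^ (p / r)) := by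
        rw [lintegral_const_mul' _ _ (ENNReal.rpow_ne_top_of_nonneg hθ.le h1),
          lintegral_const_mul' _ _ h2, lintegral_tsum fun d => ((hSm d).const_mul _).aemeasurable]
        simp only [lintegral_const_mul _ (hSm _)]
    _ ≤ C1 ^ (p / r) * (C2 * ∑' d, (w d ^ (r / 2)) ^ (p / r / 2) * B) := by
        refine mul_le_mul le_rfl (mul_le_mul le_rfl (ENNReal.tsum_le_tsum fun d =>
          mul_le_mul le_rfl (hB d) zero_le zero_le) zero_le zero_le) zero_le zero_le
    _ = _ := by rw [ENNReal.tsum_mul_right, mul_assoc, mul_assoc]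

lemma geom_w (κ : ℝ≥0∞) (hκ : κ < 1) (θ : ℝ) (hθ : 0 < θ) : ∑' d : ℕ, (κ ^ d) ^ θ ≠ ⊤ := by
  have e : ∀ d : ℕ, (κ ^ d) ^ θ = (κ ^ θ) ^ d := by
    intro d
    rw [← ENNReal.rpow_natCast, ← ENNReal.rpow_mul, mul_comm, ENNReal.rpow_mul,
      ENNReal.rpow_natCast]
  simp only [e]
  rw [ENNReal.tsum_geometric]
  simp only [ne_eq, ENNReal.inv_eq_top, tsub_eq_zero_iff_le, not_le]
  exact ENNReal.rpow_lt_one hκ hθ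

lemma geom_wZ (κ : ℝ≥0∞) (hκ : κ < 1) (θ : ℝ) (hθ : 0 < θ) :
    ∑' d : ℤ, (κ ^ d.natAbs) ^ θ ≠ ⊤ := by
  have h := geom_w κ hκ θ hθ
  have hle : ∑' d : ℤ, (κ ^ d.natAbs) ^ θ ≤ ∑' z : ℕ ⊕ ℕ, Sum.elim
      (fun d : ℕ => (κ ^ d) ^ θ) (fun d : ℕ => (κ ^ d) ^ θ) z := by
    let g : ℤ → ℕ ⊕ ℕ := fun d => if 0 ≤ d then Sum.inl d.natAbs else Sum.inr d.natAbs
    have hg : Function.Injective g := by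
      intro a b hab
      simp only [g] at hab
      split_ifs at hab with h1 h2 h2
      · have := Sum.inl.inj hab; omega
      · have := Sum.inr.inj hab; omega
    calc ∑' d : ℤ, (κ ^ d.natAbs) ^ θ = ∑' d : ℤ,
          (Sum.elim (fun d : ℕ => (κ ^ d) ^ θ) (fun d : ℕ => (κ ^ d) ^ θ) (g d) : ℝ≥0∞) := by
          refine tsum_congr fun d => ?_
          simp only [g]
          split_ifs <;> simp
      _ ≤ _ := ENNReal.tsum_comp_le_tsum_of_injective hg _
  refine ne_top_of_le_ne_top ?_ hle
  rw [ENNReal.summable.tsum_sum (ENNReal.summable)]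
  simpa using h

/-- the weight -/
def wR (u : ℝ) : ℝ := 1 / (1 + u ^ 2)

lemma wR_pos (u : ℝ) : 0 < wR u := by unfold wR; positivity

lemma wR_cont : Continuous wR := by
  unfold wR
  exact continuous_const.div (by fun_prop) (fun u => by positivity)

/-- Poisson-like averaging operator -/
def Pop (i : ℤ) (h : ℝ → ℝ≥0∞) (x : ℝ) : ℝ≥0∞ :=
  ∫⁻ y, ENNReal.ofReal ((2 : ℝ) ^ i * wR (2 ^ i * (x - y))) * h y

lemma pkern_meas (i : ℤ) : Measurable (fun z : ℝ × ℝ =>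
    ENNReal.ofReal ((2 : ℝ) ^ i * wR (2 ^ i * (z.1 - z.2)))) := by
  have := wR_cont
  fun_prop

lemma pkern_meas' (i : ℤ) (x : ℝ) : Measurable (fun y : ℝ =>
    ENNReal.ofReal ((2 : ℝ) ^ i * wR (2 ^ i * (x - y)))) := by
  have := wR_cont
  fun_prop

lemma Pop_meas (i : ℤ) {h : ℝ → ℝ≥0∞} (hh : Measurable h) : Measurable (Pop i h) := by
  have hm : Measurable (fun z : ℝ × ℝ =>
    ENNReal.ofReal ((2 : ℝ) ^ i * wR (2 ^ i * (z.1 - z.2))) * h z.2) :=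
    (pkern_meas i).mul (hh.comp measurable_snd)
  exact Measurable.lintegral_prod_right (f := fun x y =>
    ENNReal.ofReal ((2 : ℝ) ^ i * wR (2 ^ i * (x - y))) * h y) hm

lemma wR_le_sum (u : ℝ) : ENNReal.ofReal (wR u) ≤
    4 * ∑' m : ℕ, (4 : ℝ≥0∞)⁻¹ ^ m * (if |u| < 2 ^ m then 1 else 0) := by
  classical
  have hex : ∃ m : ℕ, |u| < 2 ^ m := pow_unbounded_of_one_lt _ (by norm_num)
  set m := Nat.find hex with hm
  have h1 : |u| < 2 ^ m := Nat.find_spec hex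
  have h2 : wR u ≤ 4 * (4⁻¹ : ℝ) ^ m := by
    unfold wR
    rcases Nat.eq_zero_or_pos m with h0 | h0
    · rw [h0, pow_zero, div_le_iff₀ (by positivity)]
      nlinarith [sq_nonneg u]
    · have h3 : ¬ |u| < 2 ^ (m - 1) := Nat.find_min hex (by omega)
      push Not at h3
      have h4 : (2 ^ (m - 1)) ^ 2 ≤ u ^ 2 := by
        rw [← sq_abs u]
        exact pow_le_pow_left₀ (by positivity) h3 2
      have h5 : (4 : ℝ) ^ m = 4 * (2 ^ (m - 1)) ^ 2 := by
        obtain ⟨k, hk⟩ : ∃ k, m = k + 1 := ⟨m - 1, by omega⟩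
        rw [hk]; simp only [Nat.add_sub_cancel]
        rw [← pow_mul, mul_comm k 2, pow_mul, pow_succ]; norm_num; ring
      rw [inv_pow, ← div_eq_mul_inv, div_le_div_iff₀ (by positivity) (by positivity), h5]
      linarith
  calc ENNReal.ofReal (wR u) ≤ ENNReal.ofReal (4 * (4⁻¹ : ℝ) ^ m) := ENNReal.ofReal_le_ofReal h2
    _ = 4 * ((4 : ℝ≥0∞)⁻¹ ^ m * (if |u| < 2 ^ m then 1 else 0)) := by
        rw [if_pos h1, mul_one, ENNReal.ofReal_mul (by norm_num), ENNReal.ofReal_pow (by norm_num),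
          ENNReal.ofReal_inv_of_pos (by norm_num)]
        norm_num
    _ ≤ _ := mul_le_mul le_rfl (ENNReal.le_tsum m) zero_le zero_le

lemma Pop_le_Kop (i : ℤ) {h : ℝ → ℝ≥0∞} (hh : Measurable h) (x : ℝ) :
    Pop i h x ≤ 4 * ∑' m : ℕ, (2 : ℝ≥0∞)⁻¹ ^ m * Kop (i - m) h x := by
  have hpt : ∀ y, ENNReal.ofReal ((2 : ℝ) ^ i * wR (2 ^ i * (x - y))) * h y ≤
      4 * ∑' m : ℕ, (2 : ℝ≥0∞)⁻¹ ^ m *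
        ((if |x - y| < (2 : ℝ) ^ (-(i - m)) then (2 : ℝ≥0∞) ^ (i - m) else 0) * h y) := by
    intro y
    rw [ENNReal.ofReal_mul (by positivity), two_zpow_real]
    refine (mul_le_mul (mul_le_mul le_rfl (wR_le_sum _) zero_le zero_le) le_rfl zero_le zero_le).trans ?_
    rw [mul_left_comm, mul_assoc]
    refine mul_le_mul le_rfl ?_ zero_le zero_le
    rw [← ENNReal.tsum_mul_left, ← ENNReal.tsum_mul_right]
    refine ENNReal.tsum_le_tsum fun m => ?_
    rw [← mul_assoc ((2 : ℝ≥0∞)⁻¹ ^ m)]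
    refine mul_le_mul ?_ le_rfl zero_le zero_le
    have hiff : |2 ^ i * (x - y)| < (2 : ℝ) ^ m ↔ |x - y| < (2 : ℝ) ^ (-(i - m)) := by
      rw [abs_mul, abs_of_pos (by positivity : (0 : ℝ) < 2 ^ i), neg_sub, zpow_sub₀ (by norm_num),
        zpow_natCast, lt_div_iff₀ (by positivity), mul_comm]
    by_cases hc : |x - y| < (2 : ℝ) ^ (-(i - m))
    · rw [if_pos hc, if_pos (hiff.2 hc), mul_one, ENNReal.zpow_sub (by norm_num) (by norm_num),
        zpow_natCast, mul_left_comm]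
      refine mul_le_mul le_rfl ?_ zero_le zero_le
      rw [← ENNReal.inv_pow, ← ENNReal.inv_pow, show (4 : ℝ≥0∞) = 2 * 2 by norm_num, mul_pow,
        ENNReal.mul_inv (by simp) (by simp)]
    · rw [if_neg hc, if_neg (fun h => hc (hiff.1 h))]
      simp
  unfold Pop
  refine (lintegral_mono hpt).trans (le_of_eq ?_)
  have hkm : ∀ m : ℕ, Measurable (fun y => (if |x - y| < (2 : ℝ) ^ (-(i - m)) then
      (2 : ℝ≥0∞) ^ (i - m) else 0) * h y) := fun m => (kern_meas' _ x).mul hh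
  rw [lintegral_const_mul' _ _ (by norm_num), lintegral_tsum fun m =>
    ((hkm m).const_mul _).aemeasurable]
  congr 1
  refine tsum_congr fun m => ?_
  rw [lintegral_const_mul _ (hkm m)]
  rfl

lemma fsP (p r : ℝ) (hp : 1 < p) (hr : 1 ≤ r) : ∃ C : ℝ≥0∞, C ≠ ⊤ ∧
    ∀ (h : ℤ → ℝ → ℝ≥0∞), (∀ i, Measurable (h i)) → ∀ c : ℤ,
    ∫⁻ x, (∑' i, Pop (i + c) (h i) x ^ r) ^ (p / r) ≤
      C * ∫⁻ x, (∑' i, h i x ^ r) ^ (p / r) := by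
  have hr0 : 0 < r := by linarith
  have hp0 : 0 < p := by linarith
  have hθ : 0 < p / r := by positivity
  obtain ⟨C, hC, hb⟩ := fsZ p r hp hr
  obtain ⟨C', hC', hb'⟩ := mix_sum p r hp0 hr0 (fun m : ℕ => (2 : ℝ≥0∞)⁻¹ ^ m)
    (fun θ hθ => geom_w _ (by norm_num) θ hθ)
  refine ⟨((4 : ℝ≥0∞) ^ r) ^ (p / r) * (C' * C), ENNReal.mul_ne_top
    (ENNReal.rpow_ne_top_of_nonneg hθ.le (ENNReal.rpow_ne_top_of_nonneg hr0.le (by norm_num)))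
    (ENNReal.mul_ne_top hC' hC), fun h hh c => ?_⟩
  have h1 := hb' (fun m i => Kop (i + c - m) (h i)) (fun m i => Kop_meas _ (hh i))
    (C * ∫⁻ x, (∑' i, h i x ^ r) ^ (p / r)) (fun m => by
      have := hb h hh (c - m)
      simp only [← add_sub_assoc] at this
      exact this)
  calc ∫⁻ x, (∑' i, Pop (i + c) (h i) x ^ r) ^ (p / r)
      ≤ ∫⁻ x, ((4 : ℝ≥0∞) ^ r) ^ (p / r) *
        (∑' i, (∑' m : ℕ, (2 : ℝ≥0∞)⁻¹ ^ m * Kop (i + c - m) (h i) x) ^ r) ^ (p / r) := by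
        refine lintegral_mono fun x => ?_
        rw [← ENNReal.mul_rpow_of_nonneg _ _ hθ.le, ← ENNReal.tsum_mul_left]
        refine ENNReal.rpow_le_rpow (ENNReal.tsum_le_tsum fun i => ?_) hθ.le
        rw [← ENNReal.mul_rpow_of_nonneg _ _ hr0.le]
        exact ENNReal.rpow_le_rpow (Pop_le_Kop _ (hh i) x) hr0.le
    _ = ((4 : ℝ≥0∞) ^ r) ^ (p / r) * ∫⁻ x,
        (∑' i, (∑' m : ℕ, (2 : ℝ≥0∞)⁻¹ ^ m * Kop (i + c - m) (h i) x) ^ r) ^ (p / r) := by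
        rw [lintegral_const_mul' _ _ (ENNReal.rpow_ne_top_of_nonneg hθ.le
          (ENNReal.rpow_ne_top_of_nonneg hr0.le (by norm_num)))]
    _ ≤ _ := by
        rw [mul_assoc, mul_assoc]
        exact mul_le_mul le_rfl h1 zero_le zero_le

/-- the majorant -/
def Dti (ρ δ : ℝ) (h : ℤ → ℝ → ℝ≥0∞) (n : ℤ) (x : ℝ) : ℝ≥0∞ :=
  ∑' i : ℤ, ((2 : ℝ≥0∞) ^ (-δ)) ^ (i - n).natAbs * Pop (min i n) (fun y => h i y ^ ρ) x ^ (1 / ρ)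

lemma fsD (p r ρ δ : ℝ) (hρ : 1 ≤ ρ) (hρp : ρ < p) (hρr : ρ ≤ r) (hδ : 0 < δ) :
    ∃ C : ℝ≥0∞, C ≠ ⊤ ∧
    ∀ (h : ℤ → ℝ → ℝ≥0∞), (∀ i, Measurable (h i)) →
    ∫⁻ x, (∑' n, Dti ρ δ h n x ^ r) ^ (p / r) ≤
      C * ∫⁻ x, (∑' i, h i x ^ r) ^ (p / r) := by
  have hρ0 : 0 < ρ := by linarith
  have hr0 : 0 < r := by linarith
  have hp0 : 0 < p := by linarith
  have hθ : 0 < p / r := by positivity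
  obtain ⟨C, hC, hb⟩ := fsP (p / ρ) (r / ρ) (by rwa [one_lt_div hρ0]) (by rwa [one_le_div hρ0])
  have hquot : p / ρ / (r / ρ) = p / r := by field_simp
  rw [hquot] at hb
  have hκ : (2 : ℝ≥0∞) ^ (-δ) < 1 := ENNReal.rpow_lt_one_of_one_lt_of_neg (by norm_num) (by linarith)
  obtain ⟨C', hC', hb'⟩ := mix_sum p r hp0 hr0 (fun d : ℤ => ((2 : ℝ≥0∞) ^ (-δ)) ^ d.natAbs)
    (fun θ hθ => geom_wZ _ hκ θ hθ)
  refine ⟨C' * C, ENNReal.mul_ne_top hC' hC, fun h hh => ?_⟩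
  have h1 := hb' (fun d n x => Pop (min (n + d) n) (fun y => h (n + d) y ^ ρ) x ^ (1 / ρ))
    (fun d n => (Pop_meas _ ((hh _).pow_const _)).pow_const _)
    (C * ∫⁻ x, (∑' i, h i x ^ r) ^ (p / r)) (fun d => by
      have := hb (fun i y => h i y ^ ρ) (fun i => (hh i).pow_const _) (-d + min d 0)
      simp only [← ENNReal.rpow_mul] at this ⊢
      have e1 : ρ * (r / ρ) = r := by field_simp
      have e2 : 1 / ρ * r = r / ρ := by ring
      rw [e1] at this
      rw [e2]
      refine le_trans (le_of_eq ?_) this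
      refine lintegral_congr fun x => ?_
      congr 1
      rw [← (Equiv.addRight d).tsum_eq (fun i => Pop (i + (-d + min d 0)) (fun y => h i y ^ ρ) x ^ (r / ρ))]
      refine tsum_congr fun n => ?_
      simp only [Equiv.coe_addRight]
      congr 2
      omega)
  rw [mul_assoc]
  refine le_trans (le_of_eq ?_) h1
  refine lintegral_congr fun x => ?_
  congr 1
  refine tsum_congr fun n => ?_
  congr 1
  unfold Dti
  rw [← (Equiv.addLeft n).tsum_eq]
  refine tsum_congr fun d => ?_
  simp

/-! ### Kernel bounds -/

lemma wR_shift (u v d : ℝ) (h : |u - v| ≤ d) : wR u ≤ 2 * (1 + d ^ 2) * wR v := by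
  unfold wR
  rw [mul_one_div, div_le_div_iff₀ (by positivity) (by positivity)]
  have h1 : (u - v) ^ 2 ≤ d ^ 2 := by
    rw [← sq_abs (u - v)]
    exact pow_le_pow_left₀ (abs_nonneg _) h 2
  nlinarith [sq_nonneg (u + (u - v)), sq_nonneg (d * u), sq_nonneg u, sq_nonneg d]

lemma schwartz_zero_mean (φ : SchwartzMap ℝ ℂ) (Nb : ℝ)
    (hφ : ∀ ξ : ℝ, 𝓕 (⇑φ) ξ ≠ 0 → (2 : ℝ) ^ (-Nb) < |ξ| ∧ |ξ| < (2 : ℝ) ^ Nb) :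
    ∫ x, φ x = 0 := by
  by_contra h
  have h0 : 𝓕 (⇑φ) 0 = ∫ x, φ x := by
    rw [Real.fourier_eq']
    simp
  have := (hφ 0 (by rwa [h0])).1
  rw [abs_zero] at this
  exact absurd this (not_lt.2 (Real.rpow_nonneg (by norm_num) _))

lemma schwartz_bds (φ : SchwartzMap ℝ ℂ) (h0 : ∫ x, φ x = 0) : ∃ C : ℝ, 0 < C ∧
    (∀ u, ‖φ u‖ ≤ C * wR u) ∧
    (∀ u v, |u - v| ≤ 2 → ‖φ u - φ v‖ ≤ C * |u - v| * wR u) ∧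
    (∀ u, ‖∫ t in Set.Iic u, φ t‖ ≤ C * wR u) := by
  set A : ℝ := 2 ^ 4 * ((Finset.Iic ((4, 1) : ℕ × ℕ)).sup fun m => SchwartzMap.seminorm ℝ m.1 m.2) φ
    with hA
  have hA0 : 0 ≤ A := by
    rw [hA]
    exact mul_nonneg (by norm_num) (apply_nonneg _ _)
  have hpow : ∀ x : ℝ, (1 + x ^ 2) ^ 2 ≤ (1 + ‖x‖) ^ 4 := by
    intro x
    rw [Real.norm_eq_abs, ← sq_abs x]
    have : 1 + |x| ^ 2 ≤ (1 + |x|) ^ 2 := by nlinarith [abs_nonneg x]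
    calc (1 + |x| ^ 2) ^ 2 ≤ ((1 + |x|) ^ 2) ^ 2 := pow_le_pow_left₀ (by positivity) this 2
      _ = _ := by ring
  have hb : ∀ (n : ℕ), n ≤ 1 → ∀ x, ‖iteratedFDeriv ℝ n φ x‖ ≤ A * wR x ^ 2 := by
    intro n hn x
    have := SchwartzMap.one_add_le_sup_seminorm_apply (𝕜 := ℝ) (m := (4, 1)) (k := 4) (n := n)
      le_rfl hn φ x
    have h2 : (1 + x ^ 2) ^ 2 * ‖iteratedFDeriv ℝ n φ x‖ ≤ A :=
      (mul_le_mul_of_nonneg_right (hpow x) (norm_nonneg _)).trans this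
    unfold wR
    rw [div_pow, one_pow, mul_one_div, le_div_iff₀ (by positivity), mul_comm]
    exact h2
  have hφ2 : ∀ x, ‖φ x‖ ≤ A * wR x ^ 2 := by
    intro x
    have := hb 0 (by norm_num) x
    rwa [norm_iteratedFDeriv_zero] at this
  have hw1 : ∀ x, wR x ≤ 1 := by
    intro x
    unfold wR
    rw [div_le_one (by positivity)]
    nlinarith [sq_nonneg x]
  have hw2 : ∀ x, wR x ^ 2 ≤ wR x := by
    intro x
    nlinarith [hw1 x, wR_pos x]
  have hd : ∀ x, ‖deriv φ x‖ ≤ A * wR x := by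
    intro x
    have := hb 1 le_rfl x
    rw [norm_iteratedFDeriv_eq_norm_iteratedDeriv, iteratedDeriv_one] at this
    exact this.trans (mul_le_mul_of_nonneg_left (hw2 x) hA0)
  have hwi : Integrable wR := by
    have e : wR = fun x : ℝ => (1 + x ^ 2)⁻¹ := by funext x; simp [wR]
    rw [e]
    exact integrable_inv_one_add_sq
  have hwint : ∫ x, wR x = Real.pi := by
    simp [wR]
  have hmono : ∀ (s : Set ℝ) (u : ℝ), (∀ t ∈ s, u ^ 2 ≤ t ^ 2) → MeasurableSet s →
      ‖∫ t in s, φ t‖ ≤ A * Real.pi * wR u := by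
    intro s u hs hsm
    calc ‖∫ t in s, φ t‖ ≤ ∫ t in s, (A * wR u) * wR t := by
          refine norm_integral_le_of_norm_le ((hwi.const_mul _).integrableOn) ?_
          refine (ae_restrict_iff' hsm).2 (Filter.Eventually.of_forall fun t ht => ?_)
          refine (hφ2 t).trans ?_
          rw [sq, ← mul_assoc]
          refine mul_le_mul_of_nonneg_right (mul_le_mul_of_nonneg_left ?_ hA0) (wR_pos t).le
          unfold wR
          exact one_div_le_one_div_of_le (by positivity) (by linarith [hs t ht])
      _ ≤ ∫ t, (A * wR u) * wR t := by
          refine setIntegral_le_integral (hwi.const_mul _) (Filter.Eventually.of_forall fun t => ?_)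
          have := wR_pos t
          have := wR_pos u
          positivity
      _ = _ := by rw [integral_const_mul, hwint]; ring
  refine ⟨A * 10 + 1, by positivity, ?_, ?_, ?_⟩
  · intro u
    have h1 := hφ2 u
    have h2 := mul_le_mul_of_nonneg_left (hw2 u) hA0
    nlinarith [wR_pos u]
  · intro u v huv
    have := Convex.norm_image_sub_le_of_norm_deriv_le (𝕜 := ℝ) (f := φ) (s := Set.uIcc u v)
      (x := v) (y := u) (C := A * (10 * wR u)) (fun x _ => φ.differentiableAt)
      (fun x hx => ?_) (convex_uIcc _ _) Set.right_mem_uIcc Set.left_mem_uIcc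
    · rw [Real.norm_eq_abs] at this
      refine this.trans ?_
      have h1 : 0 ≤ wR u * |u - v| := mul_nonneg (wR_pos u).le (abs_nonneg _)
      nlinarith
    · refine (hd x).trans (mul_le_mul_of_nonneg_left ?_ hA0)
      have hxu : |x - u| ≤ 2 := by
        have := Set.abs_sub_left_of_mem_uIcc hx
        rw [abs_sub_comm u v] at huv
        exact this.trans huv
      have := wR_shift x u 2 hxu
      norm_num at this
      linarith
  · intro u
    have hpi : Real.pi ≤ 4 := Real.pi_le_four
    have key : ‖∫ t in Set.Iic u, φ t‖ ≤ A * Real.pi * wR u := by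
      rcases le_or_gt u 0 with hu | hu
      · refine hmono _ _ (fun t ht => ?_) measurableSet_Iic
        have : t ≤ u := ht
        nlinarith
      · have := integral_add_compl (measurableSet_Iic (a := u)) φ.integrable (μ := volume)
        rw [h0] at this
        rw [eq_neg_of_add_eq_zero_left this, norm_neg, Set.compl_Iic]
        refine hmono _ _ (fun t ht => ?_) measurableSet_Ioi
        have : u < t := ht
        nlinarith
    refine key.trans ?_
    have := wR_pos u
    have h1 : 0 ≤ A * wR u := by positivity
    nlinarith
  
/-! ### Properties of `Pop` -/

lemma Pop_mono (i : ℤ) {h h' : ℝ → ℝ≥0∞} (hh : ∀ x, h x ≤ h' x) (x : ℝ) :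
    Pop i h x ≤ Pop i h' x :=
  lintegral_mono fun y => mul_le_mul le_rfl (hh y) zero_le zero_le

lemma Pop_shift (i : ℤ) (h : ℝ → ℝ≥0∞) (x z d : ℝ) (hd : 2 ^ i * |x - z| ≤ d) :
    Pop i h x ≤ ENNReal.ofReal (2 * (1 + d ^ 2)) * Pop i h z := by
  unfold Pop
  rw [← lintegral_const_mul' _ _ ENNReal.ofReal_ne_top]
  refine lintegral_mono fun y => ?_
  rw [← mul_assoc, ← ENNReal.ofReal_mul (by positivity)]
  refine mul_le_mul (ENNReal.ofReal_le_ofReal ?_) le_rfl zero_le zero_le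
  have := wR_shift (2 ^ i * (x - y)) (2 ^ i * (z - y)) d (by
    rw [← mul_sub, abs_mul, abs_of_pos (by positivity : (0 : ℝ) < 2 ^ i)]
    simpa using hd)
  have h2 : (0 : ℝ) < 2 ^ i := by positivity
  nlinarith

lemma Pop_up {i n : ℤ} (hni : n ≤ i) (h : ℝ → ℝ≥0∞) (x : ℝ) :
    Pop i h x ≤ (2 : ℝ≥0∞) ^ (i - n) * Pop n h x := by
  unfold Pop
  rw [← lintegral_const_mul' _ _ (ENNReal.zpow_ne_top (by norm_num) (by norm_num) _)]
  refine lintegral_mono fun y => ?_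
  rw [← mul_assoc, ← two_zpow_real, ← ENNReal.ofReal_mul (by positivity)]
  refine mul_le_mul (ENNReal.ofReal_le_ofReal ?_) le_rfl zero_le zero_le
  rw [← mul_assoc, ← zpow_add₀ (by norm_num), sub_add_cancel]
  refine mul_le_mul_of_nonneg_left ?_ (by positivity)
  unfold wR
  refine one_div_le_one_div_of_le (by positivity) ?_
  rw [mul_pow, mul_pow]
  have h1 : (2 : ℝ) ^ n ≤ 2 ^ i := zpow_le_zpow_right₀ (by norm_num) hni
  have h2 : ((2 : ℝ) ^ n) ^ 2 ≤ (2 ^ i) ^ 2 := pow_le_pow_left₀ (by positivity) h1 2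
  nlinarith [sq_nonneg (x - y)]

lemma Pop_down (k : ℤ) (h : ℝ → ℝ≥0∞) (x : ℝ) :
    Pop (k - 1) h x ≤ 2 * Pop k h x := by
  unfold Pop
  rw [← lintegral_const_mul' _ _ (by norm_num)]
  refine lintegral_mono fun y => ?_
  rw [← mul_assoc, show (2 : ℝ≥0∞) = ENNReal.ofReal 2 by simp, ← ENNReal.ofReal_mul (by positivity)]
  refine mul_le_mul (ENNReal.ofReal_le_ofReal ?_) le_rfl zero_le zero_le
  have e : (2 : ℝ) ^ (k - 1) = 2 ^ k / 2 := by rw [zpow_sub_one₀ (by norm_num)]; ring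
  rw [e]
  have h2 : (0 : ℝ) < 2 ^ k := by positivity
  generalize (2 : ℝ) ^ k = a at *
  have : wR (a / 2 * (x - y)) ≤ 4 * wR (a * (x - y)) := by
    unfold wR
    rw [mul_one_div, div_le_div_iff₀ (by positivity) (by positivity)]
    nlinarith [sq_nonneg (a * (x - y))]
  nlinarith

lemma Pop_mass (i : ℤ) (x : ℝ) :
    ∫⁻ y, ENNReal.ofReal ((2 : ℝ) ^ i * wR (2 ^ i * (x - y))) ≤ 16 := by
  have h := Pop_le_Kop i (measurable_const (a := (1 : ℝ≥0∞))) x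
  simp only [Kop_const, mul_one] at h
  have e : Pop i (fun _ => (1 : ℝ≥0∞)) x =
    ∫⁻ y, ENNReal.ofReal ((2 : ℝ) ^ i * wR (2 ^ i * (x - y))) := by simp [Pop]
  rw [e] at h
  refine h.trans (le_of_eq ?_)
  rw [ENNReal.tsum_mul_right, ENNReal.tsum_geometric, ENNReal.one_sub_inv_two, inv_inv]
  norm_num

lemma Pop_jensen (i : ℤ) {h : ℝ → ℝ≥0∞} (hh : Measurable h) (θ : ℝ) (hθ : 1 ≤ θ) (x : ℝ) :
    Pop i h x ^ θ ≤ 16 ^ (θ - 1) * Pop i (fun y => h y ^ θ) x :=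
  (holder_const volume θ hθ (pkern_meas' i x) hh).trans
    (mul_le_mul (ENNReal.rpow_le_rpow (Pop_mass i x) (by linarith)) le_rfl zero_le zero_le)

lemma Pop_finite (i : ℤ) {h : ℝ → ℝ≥0∞} (hh : Measurable h) (ρ p : ℝ) (hρ : 0 < ρ) (hρp : ρ ≤ p)
    (hfin : ∫⁻ y, h y ^ p ≠ ⊤) (x : ℝ) : Pop i (fun y => h y ^ ρ) x ≠ ⊤ := by
  have hθ : 1 ≤ p / ρ := by rwa [one_le_div hρ]
  have h1 := Pop_jensen i (hh.pow_const ρ) (p / ρ) hθ x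
  have e : ∀ y, (h y ^ ρ) ^ (p / ρ) = h y ^ p := by
    intro y
    rw [← ENNReal.rpow_mul]; congr 1; field_simp
  simp only [e] at h1
  have h2 : Pop i (fun y => h y ^ p) x ≤ (2 : ℝ≥0∞) ^ i * ∫⁻ y, h y ^ p := by
    unfold Pop
    rw [← lintegral_const_mul' _ _ (ENNReal.zpow_ne_top (by norm_num) (by norm_num) i)]
    refine lintegral_mono fun y => mul_le_mul ?_ le_rfl zero_le zero_le
    rw [← two_zpow_real]
    refine ENNReal.ofReal_le_ofReal ?_
    have : wR (2 ^ i * (x - y)) ≤ 1 := by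
      unfold wR
      rw [div_le_one (by positivity)]
      nlinarith [sq_nonneg (2 ^ i * (x - y))]
    have h3 : (0 : ℝ) < 2 ^ i := by positivity
    nlinarith
  intro htop
  rw [htop, ENNReal.top_rpow_of_pos (by linarith)] at h1
  have h3 : (16 : ℝ≥0∞) ^ (p / ρ - 1) * Pop i (fun y => h y ^ p) x ≠ ⊤ := by
    refine ENNReal.mul_ne_top (ENNReal.rpow_ne_top_of_nonneg (by linarith) (by norm_num)) ?_
    exact ne_top_of_le_ne_top (ENNReal.mul_ne_top
      (ENNReal.zpow_ne_top (by norm_num) (by norm_num) i) hfin) h2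
  exact h3 (top_le_iff.1 h1)

/-- package of kernel bounds -/
structure KB (φ : SchwartzMap ℝ ℂ) (C : ℝ) : Prop where
  pos : 0 < C
  size : ∀ u, ‖φ u‖ ≤ C * wR u
  lip : ∀ u v, |u - v| ≤ 2 → ‖φ u - φ v‖ ≤ C * |u - v| * wR u
  prim : ∀ u, ‖∫ t in Set.Iic u, φ t‖ ≤ C * wR u

lemma dilate_meas (φ : SchwartzMap ℝ ℂ) (i : ℤ) : Continuous (dilate φ i) := by
  unfold dilate
  have := φ.continuous
  fun_prop

lemma enorm_le_of_real {a : ℂ} {b : ℝ} (h : ‖a‖ ≤ b) : ‖a‖ₑ ≤ ENNReal.ofReal b := by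
  rw [← ofReal_norm]
  exact ENNReal.ofReal_le_ofReal h

lemma dil_size {φ : SchwartzMap ℝ ℂ} {C : ℝ} (hK : KB φ C) (i : ℤ) (u : ℝ) :
    ‖dilate φ i u‖ₑ ≤ ENNReal.ofReal C * ENNReal.ofReal (2 ^ i * wR (2 ^ i * u)) := by
  rw [← ENNReal.ofReal_mul hK.pos.le]
  apply enorm_le_of_real
  unfold dilate
  rw [norm_smul, Real.norm_of_nonneg (by positivity)]
  have := hK.size (2 ^ i * u)
  have h2 : (0 : ℝ) < 2 ^ i := by positivity
  nlinarith

lemma conv_lint {φ : SchwartzMap ℝ ℂ} {C : ℝ} (hK : KB φ C) (i : ℤ) (f : ℝ → ℂ)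
    (x : ℝ) : ∫⁻ y, ‖dilate φ i (x - y) * f y‖ₑ ≤ ENNReal.ofReal C * Pop i (fun y => ‖f y‖ₑ) x := by
  unfold Pop
  rw [← lintegral_const_mul' _ _ ENNReal.ofReal_ne_top]
  refine lintegral_mono fun y => ?_
  rw [enorm_mul, ← mul_assoc]
  exact mul_le_mul (dil_size hK i _) le_rfl zero_le zero_le

lemma conv_int {φ : SchwartzMap ℝ ℂ} {C : ℝ} (hK : KB φ C) (i : ℤ) {f : ℝ → ℂ}
    (hf : Measurable f) {x : ℝ} (hfin : Pop i (fun y => ‖f y‖ₑ) x ≠ ⊤) :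
    Integrable (fun y => dilate φ i (x - y) * f y) := by
  refine ⟨?_, ?_⟩
  · have := (dilate_meas φ i).measurable
    exact Measurable.aestronglyMeasurable (by fun_prop)
  · exact lt_of_le_of_lt (conv_lint hK i f x) (ENNReal.mul_lt_top ENNReal.ofReal_lt_top hfin.lt_top)

lemma conv_a {φ : SchwartzMap ℝ ℂ} {C : ℝ} (hK : KB φ C) (i : ℤ) (f : ℝ → ℂ) (x : ℝ) :
    ‖conv (dilate φ i) f x‖ₑ ≤ ENNReal.ofReal C * Pop i (fun y => ‖f y‖ₑ) x :=
  (enorm_integral_le_lintegral_enorm _).trans (conv_lint hK i f x)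

lemma conv_b {φ : SchwartzMap ℝ ℂ} {C : ℝ} (hK : KB φ C) (i : ℤ) {f : ℝ → ℂ}
    (hf : Measurable f) (hfin : ∀ x, Pop i (fun y => ‖f y‖ₑ) x ≠ ⊤) (x z : ℝ)
    (hxz : 2 ^ i * |x - z| ≤ 2) :
    ‖conv (dilate φ i) f x - conv (dilate φ i) f z‖ₑ ≤
      ENNReal.ofReal (C * (2 ^ i * |x - z|)) * Pop i (fun y => ‖f y‖ₑ) x := by
  unfold conv
  rw [← integral_sub (conv_int hK i hf (hfin x)) (conv_int hK i hf (hfin z))]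
  refine (enorm_integral_le_lintegral_enorm _).trans ?_
  unfold Pop
  rw [← lintegral_const_mul' _ _ ENNReal.ofReal_ne_top]
  refine lintegral_mono fun y => ?_
  have hC := hK.pos
  rw [← sub_mul, enorm_mul, ← mul_assoc, ← ENNReal.ofReal_mul (by positivity)]
  refine mul_le_mul ?_ le_rfl zero_le zero_le
  apply enorm_le_of_real
  unfold dilate
  have h2 : (0 : ℝ) < 2 ^ i := by positivity
  have e : |2 ^ i * (x - y) - 2 ^ i * (z - y)| = 2 ^ i * |x - z| := by
    rw [← mul_sub, abs_mul, abs_of_pos h2]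
    congr 2
    ring
  have := hK.lip (2 ^ i * (x - y)) (2 ^ i * (z - y)) (by rw [e]; exact hxz)
  rw [e] at this
  rw [← smul_sub, norm_smul, Real.norm_of_nonneg h2.le]
  calc 2 ^ i * ‖φ (2 ^ i * (x - y)) - φ (2 ^ i * (z - y))‖ ≤
      2 ^ i * (C * (2 ^ i * |x - z|) * wR (2 ^ i * (x - y))) := mul_le_mul_of_nonneg_left this h2.le
    _ = _ := by ring

lemma conv_cont {φ : SchwartzMap ℝ ℂ} {C : ℝ} (hK : KB φ C) (i : ℤ) {f : ℝ → ℂ}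
    (hf : Measurable f) (hfin : ∀ x, Pop i (fun y => ‖f y‖ₑ) x ≠ ⊤) :
    Continuous (conv (dilate φ i) f) := by
  rw [continuous_iff_continuousAt]
  intro x
  set a := (Pop i (fun y => ‖f y‖ₑ) x).toReal with ha
  have hC := hK.pos
  have hb : ∀ᶠ z in nhds x, ‖conv (dilate φ i) f z - conv (dilate φ i) f x‖ ≤
      C * (2 ^ i * |x - z|) * a := by
    have : ∀ᶠ z in nhds x, 2 ^ i * |x - z| < 2 := by
      have hc : Continuous (fun z : ℝ => 2 ^ i * |x - z|) := by fun_prop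
      have := hc.tendsto x
      simp only [sub_self, abs_zero, mul_zero] at this
      exact this.eventually (gt_mem_nhds (by norm_num))
    filter_upwards [this] with z hz
    have := conv_b hK i hf hfin x z hz.le
    rw [norm_sub_rev, ← toReal_enorm]
    have h3 := ENNReal.toReal_mono (ENNReal.mul_ne_top ENNReal.ofReal_ne_top (hfin x)) this
    rwa [ENNReal.toReal_mul, ENNReal.toReal_ofReal (by positivity)] at h3
  rw [ContinuousAt, tendsto_iff_norm_sub_tendsto_zero]
  refine squeeze_zero' (Filter.Eventually.of_forall fun z => norm_nonneg _) hb ?_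
  have hc : Continuous (fun z : ℝ => C * (2 ^ i * |x - z|) * a) := by fun_prop
  have := hc.tendsto x
  simpa using this

lemma dil_prim (φ : SchwartzMap ℝ ℂ) (i : ℤ) (l r y : ℝ) :
    ∫ z in l..r, dilate φ i (z - y) =
      (∫ t in Set.Iic (2 ^ i * (r - y)), φ t) - ∫ t in Set.Iic (2 ^ i * (l - y)), φ t := by
  rw [intervalIntegral.integral_Iic_sub_Iic φ.integrable.integrableOn φ.integrable.integrableOn]
  unfold dilate
  rw [intervalIntegral.integral_smul]
  simp only [mul_sub]
  exact intervalIntegral.smul_integral_comp_mul_sub (fun t => φ t) _ _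

lemma conv_c {φ : SchwartzMap ℝ ℂ} {C : ℝ} (hK : KB φ C) (i : ℤ) {f : ℝ → ℂ}
    (hf : Measurable f) (hfin : ∀ x, Pop i (fun y => ‖f y‖ₑ) x ≠ ⊤) (l r : ℝ) (hlr : l ≤ r) :
    ‖∫ z in l..r, conv (dilate φ i) f z‖ₑ ≤
      ENNReal.ofReal (C * 2 ^ (-i)) * (Pop i (fun y => ‖f y‖ₑ) l + Pop i (fun y => ‖f y‖ₑ) r) := by
  have hdm := (dilate_meas φ i).measurable
  have hC := hK.pos
  have hintg : Integrable (Function.uncurry fun z y => dilate φ i (z - y) * f y)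
      ((volume.restrict (Set.Ioc l r)).prod volume) := by
    have hm : Measurable (Function.uncurry fun z y => dilate φ i (z - y) * f y) := by
      unfold Function.uncurry
      fun_prop
    refine ⟨hm.aestronglyMeasurable, ?_⟩
    unfold HasFiniteIntegral
    rw [lintegral_prod _ hm.enorm.aemeasurable]
    refine lt_of_le_of_lt (b := ∫⁻ z in Set.Ioc l r, ENNReal.ofReal C *
      (ENNReal.ofReal (2 * (1 + (2 ^ i * (r - l)) ^ 2)) * Pop i (fun y => ‖f y‖ₑ) l)) ?_ ?_
    · refine setLIntegral_mono measurable_const fun z hz => ?_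
      refine (conv_lint hK i f z).trans (mul_le_mul le_rfl ?_ zero_le zero_le)
      refine Pop_shift i _ z l _ (mul_le_mul_of_nonneg_left ?_ (by positivity))
      rw [abs_of_nonneg (by linarith [hz.1])]
      linarith [hz.2]
    · rw [setLIntegral_const]
      refine ENNReal.mul_lt_top (ENNReal.mul_lt_top ENNReal.ofReal_lt_top
        (ENNReal.mul_lt_top ENNReal.ofReal_lt_top (hfin l).lt_top)) ?_
      simp
  have e : ∫ z in l..r, conv (dilate φ i) f z = ∫ y,
      ((∫ t in Set.Iic (2 ^ i * (r - y)), φ t) - ∫ t in Set.Iic (2 ^ i * (l - y)), φ t) * f y := by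
    rw [intervalIntegral.integral_of_le hlr]
    unfold conv
    rw [integral_integral_swap hintg]
    refine integral_congr_ae (Filter.Eventually.of_forall fun y => ?_)
    simp only
    rw [integral_mul_const, ← intervalIntegral.integral_of_le hlr, dil_prim]
  rw [e]
  refine (enorm_integral_le_lintegral_enorm _).trans ?_
  have hm5 : Measurable (fun y => ENNReal.ofReal ((2:ℝ) ^ i * wR (2 ^ i * (l - y))) * ‖f y‖ₑ) :=
    (pkern_meas' i l).mul hf.enorm
  unfold Pop
  beta_reduce
  rw [← lintegral_add_left hm5,
    ← lintegral_const_mul' _ _ ENNReal.ofReal_ne_top]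
  refine lintegral_mono fun y => ?_
  rw [← add_mul, enorm_mul, ← mul_assoc]
  refine mul_le_mul ?_ le_rfl zero_le zero_le
  have hw1 := (wR_pos (2 ^ i * (l - y))).le
  have hw2 := (wR_pos (2 ^ i * (r - y))).le
  rw [← ENNReal.ofReal_add (by positivity) (by positivity), ← ENNReal.ofReal_mul (by positivity)]
  apply enorm_le_of_real
  refine (norm_sub_le _ _).trans ?_
  have h1 := hK.prim (2 ^ i * (r - y))
  have h2 := hK.prim (2 ^ i * (l - y))
  have e3 : (2 : ℝ) ^ (-i) * 2 ^ i = 1 := by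
    rw [← zpow_add₀ (by norm_num)]; simp
  calc _ ≤ C * wR (2 ^ i * (r - y)) + C * wR (2 ^ i * (l - y)) := add_le_add h1 h2
    _ = C * ((2 : ℝ) ^ (-i) * 2 ^ i) * (wR (2 ^ i * (l - y)) + wR (2 ^ i * (r - y))) := by
        rw [e3]; ring
    _ = _ := by ring

/-- left end point of the dyadic interval of length `2^(-n)` containing `x` -/
def lep (n : ℤ) (x : ℝ) : ℝ := (⌊(2:ℝ) ^ n * x⌋ : ℝ) * 2 ^ (-n)

/-- dyadic averages -/
def davg (n : ℤ) (F : ℝ → ℂ) (x : ℝ) : ℂ :=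
  ((2:ℝ) ^ n) • ∫ z in (lep n x)..(lep n x + 2 ^ (-n)), F z

lemma zpow_neg_mul_self' (n : ℤ) : (2:ℝ) ^ (-n) * 2 ^ n = 1 := by
  rw [← zpow_add₀ (by norm_num)]; simp

lemma lep_le (n : ℤ) (x : ℝ) : lep n x ≤ x := by
  have h := Int.floor_le ((2:ℝ) ^ n * x)
  have h2 : (0:ℝ) < 2 ^ (-n) := by positivity
  unfold lep
  calc _ ≤ ((2:ℝ) ^ n * x) * 2 ^ (-n) := mul_le_mul_of_nonneg_right h h2.le
    _ = (2 ^ (-n) * 2 ^ n) * x := by ring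
    _ = x := by rw [zpow_neg_mul_self', one_mul]

lemma lt_lep (n : ℤ) (x : ℝ) : x < lep n x + 2 ^ (-n) := by
  have h := Int.lt_floor_add_one ((2:ℝ) ^ n * x)
  have h2 : (0:ℝ) < 2 ^ (-n) := by positivity
  unfold lep
  calc x = (2 ^ (-n) * 2 ^ n) * x := by rw [zpow_neg_mul_self', one_mul]
    _ = ((2:ℝ) ^ n * x) * 2 ^ (-n) := by ring
    _ < ((⌊(2:ℝ) ^ n * x⌋ : ℝ) + 1) * 2 ^ (-n) := mul_lt_mul_of_pos_right h h2
    _ = _ := by ring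

lemma cell_eq (n j : ℤ) : {x : ℝ | ⌊(2:ℝ) ^ n * x⌋ = j} =
    Set.Ico ((j:ℝ) * 2 ^ (-n)) ((j:ℝ) * 2 ^ (-n) + 2 ^ (-n)) := by
  ext x
  simp only [Set.mem_ofPred_eq, Set.mem_Ico, Int.floor_eq_iff]
  have h2 : (0:ℝ) < 2 ^ n := by positivity
  have e : (2:ℝ) ^ (-n) = (2 ^ n)⁻¹ := zpow_neg _ _
  rw [e, ← add_one_mul, ← div_eq_mul_inv, ← div_eq_mul_inv, div_le_iff₀ h2, lt_div_iff₀ h2,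
    mul_comm x]

lemma floor_refine (n : ℤ) (x y : ℝ) (h : ⌊(2:ℝ) ^ (n + 1) * x⌋ = ⌊(2:ℝ) ^ (n + 1) * y⌋) :
    ⌊(2:ℝ) ^ n * x⌋ = ⌊(2:ℝ) ^ n * y⌋ := by
  have key : ∀ z : ℝ, ⌊z⌋ = ⌊2 * z⌋ / 2 := by
    intro z
    have h1 := Int.floor_le z
    have h2 := Int.lt_floor_add_one z
    have h3 := Int.floor_le (2 * z)
    have h4 := Int.lt_floor_add_one (2 * z)
    have h5 : 2 * ⌊z⌋ ≤ ⌊2 * z⌋ := by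
      rw [Int.le_floor]; push_cast; linarith
    have h6 : ⌊2 * z⌋ < 2 * ⌊z⌋ + 2 := by
      rw [Int.floor_lt]; push_cast; linarith
    omega
  have e : ∀ z : ℝ, (2:ℝ) ^ (n + 1) * z = 2 * (2 ^ n * z) := by
    intro z; rw [zpow_add₀ (by norm_num), zpow_one]; ring
  rw [e, e] at h
  rw [key, key (2 ^ n * y), h]

lemma lep_congr {n : ℤ} {x y : ℝ} (h : ⌊(2:ℝ) ^ n * x⌋ = ⌊(2:ℝ) ^ n * y⌋) : lep n x = lep n y := by
  unfold lep; rw [h]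

lemma davg_congr {n : ℤ} {x y : ℝ} (F : ℝ → ℂ) (h : ⌊(2:ℝ) ^ n * x⌋ = ⌊(2:ℝ) ^ n * y⌋) :
    davg n F x = davg n F y := by
  unfold davg; rw [lep_congr h]

lemma box_eq (L : ℕ) (n : ℤ) (hn : 0 ≤ n + L) : Set.Ico (-(2:ℝ) ^ L) (2 ^ L) =
    ⋃ j ∈ Finset.Ico (-(2:ℤ) ^ (n + L).toNat) (2 ^ (n + L).toNat), {x : ℝ | ⌊(2:ℝ) ^ n * x⌋ = j} := by
  ext x
  simp only [Set.mem_iUnion, Finset.mem_Ico, Set.mem_ofPred_eq, exists_prop, exists_eq_right',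
    Set.mem_Ico]
  have e : (2:ℝ) ^ (n + L).toNat = 2 ^ n * 2 ^ L := by
    rw [← zpow_natCast, Int.toNat_of_nonneg hn, zpow_add₀ (by norm_num), zpow_natCast]
  have h2 : (0:ℝ) < 2 ^ n := by positivity
  rw [Int.le_floor, Int.floor_lt]
  push_cast
  rw [e, ← mul_neg, mul_le_mul_iff_right₀ h2, mul_lt_mul_iff_right₀ h2]

lemma orth_aux (L : ℕ) (n : ℤ) (hn : 0 ≤ n + L) (G : ℝ → ℂ) (hG : Continuous G) (ξ : ℝ → ℂ)
    (hξ : ∀ x y, ⌊(2:ℝ) ^ n * x⌋ = ⌊(2:ℝ) ^ n * y⌋ → ξ x = ξ y) :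
    IntegrableOn (fun x => ξ x * davg n G x) (Set.Ico (-(2:ℝ) ^ L) (2 ^ L)) ∧
    ∫ x in Set.Ico (-(2:ℝ) ^ L) (2 ^ L), ξ x * davg n G x =
      ∫ x in Set.Ico (-(2:ℝ) ^ L) (2 ^ L), ξ x * G x := by
  have hms : ∀ j : ℤ, MeasurableSet {x : ℝ | ⌊(2:ℝ) ^ n * x⌋ = j} := by
    intro j; rw [cell_eq]; exact measurableSet_Ico
  have hpt : ∀ j : ℤ, ∃ x0 : ℝ, ⌊(2:ℝ) ^ n * x0⌋ = j := by
    intro j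
    refine ⟨(j:ℝ) * 2 ^ (-n), ?_⟩
    have : (2:ℝ) ^ n * ((j:ℝ) * 2 ^ (-n)) = j := by
      calc _ = (2 ^ (-n) * 2 ^ n) * (j:ℝ) := by ring
        _ = j := by rw [zpow_neg_mul_self', one_mul]
    rw [this, Int.floor_intCast]
  have hi1 : ∀ j : ℤ, IntegrableOn (fun x => ξ x * davg n G x) {x : ℝ | ⌊(2:ℝ) ^ n * x⌋ = j} := by
    intro j
    obtain ⟨x0, hx0⟩ := hpt j
    refine IntegrableOn.congr_fun (f := fun _ => ξ x0 * davg n G x0) ?_ ?_ (hms j)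
    · rw [cell_eq]
      exact integrableOn_const (by simp)
    · intro x hx
      have hx' : ⌊(2:ℝ) ^ n * x0⌋ = ⌊(2:ℝ) ^ n * x⌋ := hx0.trans hx.symm
      simp only
      rw [hξ _ _ hx', davg_congr G hx']
  have hi2 : ∀ j : ℤ, IntegrableOn (fun x => ξ x * G x) {x : ℝ | ⌊(2:ℝ) ^ n * x⌋ = j} := by
    intro j
    obtain ⟨x0, hx0⟩ := hpt j
    refine IntegrableOn.congr_fun (f := fun x => ξ x0 * G x) ?_ ?_ (hms j)
    · rw [cell_eq]
      have : Continuous (fun x => ξ x0 * G x) := by fun_prop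
      exact (this.integrableOn_Icc).mono_set Set.Ico_subset_Icc_self
    · intro x hx
      have hx' : ⌊(2:ℝ) ^ n * x0⌋ = ⌊(2:ℝ) ^ n * x⌋ := hx0.trans hx.symm
      simp only
      rw [hξ _ _ hx']
  have hdis : Set.PairwiseDisjoint (↑(Finset.Ico (-(2:ℤ) ^ (n + L).toNat) (2 ^ (n + L).toNat)) : Set ℤ)
      (fun j => {x : ℝ | ⌊(2:ℝ) ^ n * x⌋ = j}) := by
    intro j _ k _ hjk
    rw [Function.onFun, Set.disjoint_left]
    intro x hx hx2
    exact hjk (hx.symm.trans hx2)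
  rw [box_eq L n hn]
  refine ⟨?_, ?_⟩
  · rw [integrableOn_finset_iUnion]
    exact fun j _ => hi1 j
  · rw [integral_biUnion_finset _ (fun j _ => hms j) hdis (fun j _ => hi1 j),
      integral_biUnion_finset _ (fun j _ => hms j) hdis (fun j _ => hi2 j)]
    refine Finset.sum_congr rfl fun j _ => ?_
    obtain ⟨x0, hx0⟩ := hpt j
    have h1 : ∫ x in {x : ℝ | ⌊(2:ℝ) ^ n * x⌋ = j}, ξ x * davg n G x =
        ∫ x in {x : ℝ | ⌊(2:ℝ) ^ n * x⌋ = j}, ξ x0 * davg n G x0 := by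
      refine setIntegral_congr_fun (hms j) fun x hx => ?_
      have hx' : ⌊(2:ℝ) ^ n * x0⌋ = ⌊(2:ℝ) ^ n * x⌋ := hx0.trans hx.symm
      rw [hξ _ _ hx', davg_congr G hx']
    have h2 : ∫ x in {x : ℝ | ⌊(2:ℝ) ^ n * x⌋ = j}, ξ x * G x =
        ∫ x in {x : ℝ | ⌊(2:ℝ) ^ n * x⌋ = j}, ξ x0 * G x := by
      refine setIntegral_congr_fun (hms j) fun x hx => ?_
      have hx' : ⌊(2:ℝ) ^ n * x0⌋ = ⌊(2:ℝ) ^ n * x⌋ := hx0.trans hx.symm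
      rw [hξ _ _ hx']
    have h2p : (0:ℝ) < 2 ^ (-n) := by positivity
    rw [h1, h2, setIntegral_const, cell_eq, integral_Ico_eq_integral_Ioc,
      ← intervalIntegral.integral_of_le (by linarith)]
    have hv : (volume : Measure ℝ).real (Set.Ico ((j:ℝ) * 2 ^ (-n)) ((j:ℝ) * 2 ^ (-n) + 2 ^ (-n))) =
        2 ^ (-n) := by
      rw [Real.volume_real_Ico_of_le (by linarith)]; ring
    rw [hv]
    unfold davg
    have hl : lep n x0 = (j:ℝ) * 2 ^ (-n) := by unfold lep; rw [hx0]
    rw [hl, ← mul_smul_comm, smul_smul, zpow_neg_mul_self', one_smul,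
      intervalIntegral.integral_const_mul]

/-- the partitions -/
def dpart (L : ℕ) (n : ℕ) (x : ℝ) : ℤ := ⌊(2:ℝ) ^ ((n:ℤ) - L) * x⌋

lemma dpart_filt (L : ℕ) : Filt (dpart L) where
  meas n := by
    unfold dpart
    exact Int.measurable_floor.comp (measurable_const_mul _)
  refine' n x y h := by
    unfold dpart at h ⊢
    refine floor_refine _ x y ?_
    have : ((n + 1 : ℕ) : ℤ) - L = n - L + 1 := by push_cast; ring
    rw [this] at h
    exact h

lemma davg_orth (L n : ℕ) (G : ℝ → ℂ) (hG : Continuous G) (ξ : ℝ → ℂ) (hξ : Adap (dpart L) n ξ) :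
    ∫ x in Set.Ico (-(2:ℝ) ^ L) (2 ^ L),
      ξ x * (davg (((n + 1 : ℕ) : ℤ) - L) G x - davg ((n:ℤ) - L) G x) = 0 := by
  obtain ⟨a1, a2⟩ := orth_aux L ((n:ℤ) - L) (by omega) G hG ξ hξ
  obtain ⟨b1, b2⟩ := orth_aux L (((n + 1 : ℕ) : ℤ) - L) (by omega) G hG ξ (hξ.succ (dpart_filt L))
  simp only [mul_sub]
  rw [integral_sub b1 a1, a2, b2, sub_self]

/-- one term of `Dti` -/
def dterm (ρ δ : ℝ) (h : ℝ → ℝ≥0∞) (i n : ℤ) (x : ℝ) : ℝ≥0∞ :=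
  ((2 : ℝ≥0∞) ^ (-δ)) ^ (i - n).natAbs * Pop (min i n) (fun y => h y ^ ρ) x ^ (1 / ρ)

lemma Dti_eq (ρ δ : ℝ) (h : ℤ → ℝ → ℝ≥0∞) (n : ℤ) (x : ℝ) :
    Dti ρ δ h n x = ∑' i, dterm ρ δ (h i) i n x := rfl

lemma zpow_rpow (z : ℤ) : ENNReal.ofReal ((2:ℝ) ^ z) = (2:ℝ≥0∞) ^ (z:ℝ) := by
  rw [two_zpow_real, ENNReal.rpow_intCast]

lemma wt_eq (δ : ℝ) (m : ℕ) : ((2 : ℝ≥0∞) ^ (-δ)) ^ m = 2 ^ (-δ * m) := by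
  rw [← ENNReal.rpow_natCast, ← ENNReal.rpow_mul]

lemma Pop_one (i : ℤ) {h : ℝ → ℝ≥0∞} (hh : Measurable h) (ρ : ℝ) (hρ : 1 ≤ ρ) (x : ℝ) :
    Pop i h x ≤ 16 * Pop i (fun y => h y ^ ρ) x ^ (1 / ρ) := by
  have hρ0 : 0 < ρ := by linarith
  have h1 := ENNReal.rpow_le_rpow (Pop_jensen i hh ρ hρ x) (by positivity : 0 ≤ 1 / ρ)
  rw [← ENNReal.rpow_mul, mul_one_div_cancel hρ0.ne', ENNReal.rpow_one,
    ENNReal.mul_rpow_of_nonneg _ _ (by positivity), ← ENNReal.rpow_mul] at h1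
  refine h1.trans (mul_le_mul ?_ le_rfl zero_le zero_le)
  calc (16:ℝ≥0∞) ^ ((ρ - 1) * (1 / ρ)) ≤ 16 ^ (1:ℝ) := by
        refine ENNReal.rpow_le_rpow_of_exponent_le (by norm_num) ?_
        rw [mul_one_div, div_le_one hρ0]; linarith
    _ = 16 := ENNReal.rpow_one _

lemma dterm_le (ρ δ : ℝ) (h : ℤ → ℝ → ℝ≥0∞) (i n : ℤ) (x : ℝ) :
    dterm ρ δ (h i) i n x ≤ Dti ρ δ h n x := ENNReal.le_tsum (f := fun i => dterm ρ δ (h i) i n x) i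

lemma bd_C {φ : SchwartzMap ℝ ℂ} {C : ℝ} (hK : KB φ C) (i : ℤ) {f : ℝ → ℂ} (hf : Measurable f) (ρ δ : ℝ) (hρ : 1 ≤ ρ) (x : ℝ) :
    ‖conv (dilate φ i) f x‖ₑ ≤ ENNReal.ofReal (16 * C) * dterm ρ δ (fun y => ‖f y‖ₑ) i i x := by
  refine (conv_a hK i f x).trans ?_
  unfold dterm
  simp only [sub_self, Int.natAbs_zero, pow_zero, one_mul, min_self]
  refine (mul_le_mul le_rfl (Pop_one i hf.enorm ρ hρ x) zero_le zero_le).trans ?_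
  rw [← mul_assoc]
  refine mul_le_mul (le_of_eq ?_) le_rfl zero_le zero_le
  rw [ENNReal.ofReal_mul (by norm_num), mul_comm]
  congr 1
  simp

lemma bd_A0 {φ : SchwartzMap ℝ ℂ} {C : ℝ} (hK : KB φ C) {i n : ℤ} (hin : i ≤ n) {f : ℝ → ℂ} (hf : Measurable f)
    (hfin : ∀ x, Pop i (fun y => ‖f y‖ₑ) x ≠ ⊤) (x : ℝ) :
    ‖conv (dilate φ i) f x - davg n (conv (dilate φ i) f) x‖ₑ ≤
      ENNReal.ofReal (C * 2 ^ (i - n)) * Pop i (fun y => ‖f y‖ₑ) x := by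
  set F := conv (dilate φ i) f with hF
  have hcont : Continuous F := conv_cont hK i hf hfin
  have hC := hK.pos
  have h2 : (0:ℝ) < 2 ^ (-n) := by positivity
  have h2n : (0:ℝ) < 2 ^ n := by positivity
  set l := lep n x with hl
  have hlx := lep_le n x
  have hxl := lt_lep n x
  have e : F x - davg n F x = ((2:ℝ) ^ n) • ∫ z in l..(l + 2 ^ (-n)), (F x - F z) := by
    rw [intervalIntegral.integral_sub (by simp) (hcont.intervalIntegrable _ _), smul_sub,
      intervalIntegral.integral_const, add_sub_cancel_left, smul_smul, mul_comm ((2:ℝ) ^ n),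
      zpow_neg_mul_self', one_smul]
    rfl
  set A := Pop i (fun y => ‖f y‖ₑ) x with hA
  have hAf : A ≠ ⊤ := hfin x
  have hz : ∀ z ∈ Set.uIoc l (l + 2 ^ (-n)), ‖F x - F z‖ ≤ C * 2 ^ (i - n) * A.toReal := by
    intro z hz
    rw [Set.uIoc_of_le (by linarith)] at hz
    have hd : |x - z| ≤ 2 ^ (-n) := by
      rw [abs_le]; constructor <;> linarith [hz.1, hz.2]
    have h3 : (2:ℝ) ^ i * |x - z| ≤ 2 ^ (i - n) := by
      calc _ ≤ (2:ℝ) ^ i * 2 ^ (-n) := mul_le_mul_of_nonneg_left hd (by positivity)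
        _ = _ := by rw [← zpow_add₀ (by norm_num)]; rfl
    have h4 : (2:ℝ) ^ (i - n) ≤ 1 := zpow_le_one_of_nonpos₀ (by norm_num) (by omega)
    have h5 := conv_b hK i hf hfin x z (by linarith)
    rw [← toReal_enorm]
    have h6 := ENNReal.toReal_mono (ENNReal.mul_ne_top ENNReal.ofReal_ne_top hAf) h5
    rw [ENNReal.toReal_mul, ENNReal.toReal_ofReal (by positivity)] at h6
    refine h6.trans (mul_le_mul_of_nonneg_right (mul_le_mul_of_nonneg_left h3 hC.le)
      ENNReal.toReal_nonneg)
  have h7 := intervalIntegral.norm_integral_le_of_norm_le_const hz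
  rw [add_sub_cancel_left, abs_of_pos h2] at h7
  have h8 : ‖F x - davg n F x‖ ≤ C * 2 ^ (i - n) * A.toReal := by
    rw [e, norm_smul, Real.norm_of_nonneg h2n.le]
    calc _ ≤ (2:ℝ) ^ n * (C * 2 ^ (i - n) * A.toReal * 2 ^ (-n)) :=
          mul_le_mul_of_nonneg_left h7 h2n.le
      _ = (2 ^ (-n) * 2 ^ n) * (C * 2 ^ (i - n) * A.toReal) := by ring
      _ = _ := by rw [zpow_neg_mul_self', one_mul]
  refine (enorm_le_of_real h8).trans ?_
  rw [ENNReal.ofReal_mul (by positivity), ENNReal.ofReal_toReal hAf]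

lemma bd_A {φ : SchwartzMap ℝ ℂ} {C : ℝ} (hK : KB φ C) {i n : ℤ} (hin : i ≤ n) {f : ℝ → ℂ} (hf : Measurable f) (ρ δ : ℝ) (hρ : 1 ≤ ρ)
    (hδ1 : δ ≤ 1)
    (hfin : ∀ x, Pop i (fun y => ‖f y‖ₑ) x ≠ ⊤) (x : ℝ) :
    ‖conv (dilate φ i) f x - davg n (conv (dilate φ i) f) x‖ₑ ≤
      ENNReal.ofReal (16 * C) * dterm ρ δ (fun y => ‖f y‖ₑ) i n x := by
  have hC := hK.pos
  refine (bd_A0 hK hin hf hfin x).trans ?_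
  unfold dterm
  rw [min_eq_left hin, ENNReal.ofReal_mul hC.le, zpow_rpow, wt_eq]
  have hw : (2:ℝ≥0∞) ^ (((i - n : ℤ)) : ℝ) ≤ 2 ^ (-δ * ((i - n).natAbs : ℝ)) := by
    refine ENNReal.rpow_le_rpow_of_exponent_le (by norm_num) ?_
    have e1 : (((i - n).natAbs : ℝ)) = n - i := by
      rw [Nat.cast_natAbs, abs_of_nonpos (by omega)]
      push_cast
      ring
    rw [e1]
    push_cast
    have : (i:ℝ) ≤ n := by exact_mod_cast hin
    nlinarith
  calc _ ≤ ENNReal.ofReal C * 2 ^ (-δ * ((i - n).natAbs : ℝ)) *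
        (16 * Pop i (fun y => ‖f y‖ₑ ^ ρ) x ^ (1 / ρ)) :=
        mul_le_mul (mul_le_mul le_rfl hw zero_le zero_le) (Pop_one i hf.enorm ρ hρ x) zero_le zero_le
    _ = _ := by
        rw [ENNReal.ofReal_mul (by norm_num : (0:ℝ) ≤ 16), show ENNReal.ofReal 16 = 16 by simp]
        ring

lemma bd_B {φ : SchwartzMap ℝ ℂ} {C : ℝ} (hK : KB φ C) {i n : ℤ} (hin : n < i) {f : ℝ → ℂ} (hf : Measurable f) (ρ δ : ℝ) (hρ : 1 ≤ ρ)
    (hδ : δ = 1 - 1 / ρ)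
    (hfin : ∀ x, Pop i (fun y => ‖f y‖ₑ) x ≠ ⊤) (x : ℝ) :
    ‖davg n (conv (dilate φ i) f) x‖ₑ ≤
      ENNReal.ofReal (128 * C) * dterm ρ δ (fun y => ‖f y‖ₑ) i n x := by
  have hC := hK.pos
  have hρ0 : 0 < ρ := by linarith
  have h2 : (0:ℝ) < 2 ^ (-n) := by positivity
  have h2n : (0:ℝ) < 2 ^ n := by positivity
  have hlx := lep_le n x
  have hxl := lt_lep n x
  set P := Pop n (fun y => ‖f y‖ₑ ^ ρ) x with hP
  have key : ∀ z, |z - x| ≤ 2 ^ (-n) → Pop i (fun y => ‖f y‖ₑ) z ≤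
      64 * (2 ^ ((i - n : ℤ) * (1 / ρ)) * P ^ (1 / ρ)) := by
    intro z hz
    refine (Pop_one i hf.enorm ρ hρ z).trans ?_
    have h3 := Pop_up hin.le (fun y => ‖f y‖ₑ ^ ρ) z
    have h4 := Pop_shift n (fun y => ‖f y‖ₑ ^ ρ) z x 1 (by
      calc (2:ℝ) ^ n * |z - x| ≤ 2 ^ n * 2 ^ (-n) := mul_le_mul_of_nonneg_left hz h2n.le
        _ = 1 := by rw [mul_comm, zpow_neg_mul_self'])
    have h5 : Pop i (fun y => ‖f y‖ₑ ^ ρ) z ≤ 2 ^ ((i - n : ℤ) : ℝ) * (4 * P) := by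
      refine h3.trans (mul_le_mul (le_of_eq (ENNReal.rpow_intCast _ _).symm) ?_ zero_le zero_le)
      refine h4.trans (le_of_eq ?_)
      norm_num
      rfl
    have h6 := ENNReal.rpow_le_rpow h5 (by positivity : 0 ≤ 1 / ρ)
    rw [ENNReal.mul_rpow_of_nonneg _ _ (by positivity), ← ENNReal.rpow_mul,
      ENNReal.mul_rpow_of_nonneg _ _ (by positivity)] at h6
    have h7 : (4:ℝ≥0∞) ^ (1 / ρ) ≤ 4 := by
      calc (4:ℝ≥0∞) ^ (1 / ρ) ≤ 4 ^ (1:ℝ) :=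
            ENNReal.rpow_le_rpow_of_exponent_le (by norm_num) (by rw [div_le_one hρ0]; exact hρ)
        _ = 4 := ENNReal.rpow_one _
    calc _ ≤ 16 * (2 ^ ((i - n : ℤ) * (1 / ρ)) * (4 ^ (1 / ρ) * P ^ (1 / ρ))) :=
          mul_le_mul le_rfl h6 zero_le zero_le
      _ ≤ 16 * (2 ^ ((i - n : ℤ) * (1 / ρ)) * (4 * P ^ (1 / ρ))) := by gcongr
      _ = _ := by
          rw [show (64:ℝ≥0∞) = 16 * 4 by norm_num]; ring
  unfold davg
  rw [enorm_smul]
  have h10 := conv_c hK i hf hfin (lep n x) (lep n x + 2 ^ (-n)) (by linarith)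
  have h11 := key (lep n x) (by rw [abs_le]; constructor <;> linarith)
  have h12 := key (lep n x + 2 ^ (-n)) (by rw [abs_le]; constructor <;> linarith)
  have hen : ‖(2:ℝ) ^ n‖ₑ = ENNReal.ofReal (2 ^ n) := by
    rw [← ofReal_norm, Real.norm_of_nonneg h2n.le]
  rw [hen]
  set Q := (2:ℝ≥0∞) ^ ((i - n : ℤ) * (1 / ρ)) with hQ
  calc _ ≤ ENNReal.ofReal (2 ^ n) * (ENNReal.ofReal (C * 2 ^ (-i)) *
        (64 * (Q * P ^ (1 / ρ)) + 64 * (Q * P ^ (1 / ρ)))) := by gcongr; exact h10.trans (by gcongr)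
    _ = 128 * ENNReal.ofReal C * (ENNReal.ofReal (2 ^ n) * ENNReal.ofReal (2 ^ (-i)) * Q) *
        P ^ (1 / ρ) := by
        rw [ENNReal.ofReal_mul hC.le, show (128:ℝ≥0∞) = 64 + 64 by norm_num]; ring
    _ = _ := by
        unfold dterm
        rw [min_eq_right hin.le, ENNReal.ofReal_mul (by norm_num : (0:ℝ) ≤ 128),
          show ENNReal.ofReal 128 = 128 by simp]
        refine Eq.trans ?_ (mul_assoc _ _ _)
        refine congrArg (· * P ^ (1 / ρ)) (congrArg (128 * ENNReal.ofReal C * ·) ?_)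
        rw [zpow_rpow, zpow_rpow, hQ, wt_eq, ← ENNReal.rpow_add _ _ (by norm_num) (by norm_num),
          ← ENNReal.rpow_add _ _ (by norm_num) (by norm_num)]
        congr 1
        have e1 : (((i - n).natAbs : ℝ)) = i - n := by
          rw [Nat.cast_natAbs, abs_of_nonneg (by omega)]
          push_cast
          ring
        rw [e1, hδ]
        push_cast
        ring

lemma dterm_shift (ρ δ : ℝ) (hρ : 1 ≤ ρ) (h : ℝ → ℝ≥0∞) (i n : ℤ) (x z : ℝ)
    (hxz : 2 ^ n * |x - z| ≤ 2) : dterm ρ δ h i n x ≤ 10 * dterm ρ δ h i n z := by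
  have hρ0 : 0 < ρ := by linarith
  have h1 := Pop_shift (min i n) (fun y => h y ^ ρ) x z 2 (by
    refine le_trans (mul_le_mul_of_nonneg_right ?_ (abs_nonneg _)) hxz
    exact zpow_le_zpow_right₀ (by norm_num) (min_le_right _ _))
  have h2 := ENNReal.rpow_le_rpow h1 (by positivity : 0 ≤ 1 / ρ)
  rw [ENNReal.mul_rpow_of_nonneg _ _ (by positivity)] at h2
  have h3 : ENNReal.ofReal (2 * (1 + 2 ^ 2)) ^ (1 / ρ) ≤ 10 := by
    rw [show (2:ℝ) * (1 + 2 ^ 2) = 10 by norm_num, show ENNReal.ofReal 10 = 10 by simp]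
    calc (10:ℝ≥0∞) ^ (1 / ρ) ≤ 10 ^ (1:ℝ) :=
          ENNReal.rpow_le_rpow_of_exponent_le (by norm_num) (by rw [div_le_one hρ0]; exact hρ)
      _ = 10 := ENNReal.rpow_one _
  unfold dterm
  calc _ ≤ ((2 : ℝ≥0∞) ^ (-δ)) ^ (i - n).natAbs *
        (10 * Pop (min i n) (fun y => h y ^ ρ) z ^ (1 / ρ)) := by
        gcongr
        exact h2.trans (by gcongr)
    _ = _ := by ring

lemma Dti_shift (ρ δ : ℝ) (hρ : 1 ≤ ρ) (h : ℤ → ℝ → ℝ≥0∞) (n : ℤ) (x z : ℝ)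
    (hxz : 2 ^ n * |x - z| ≤ 2) : Dti ρ δ h n x ≤ 10 * Dti ρ δ h n z := by
  rw [Dti_eq, Dti_eq, ← ENNReal.tsum_mul_left]
  exact ENNReal.tsum_le_tsum fun i => dterm_shift ρ δ hρ (h i) i n x z hxz

lemma dterm_next (ρ δ : ℝ) (hρ : 1 ≤ ρ) (hδ0 : 0 ≤ δ) (hδ1 : δ ≤ 1) (h : ℝ → ℝ≥0∞) (i n : ℤ) (x : ℝ) :
    dterm ρ δ h i n x ≤ 4 * dterm ρ δ h i (n + 1) x := by
  have hρ0 : 0 < ρ := by linarith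
  have h1 : Pop (min i n) (fun y => h y ^ ρ) x ≤ 2 * Pop (min i (n + 1)) (fun y => h y ^ ρ) x := by
    by_cases hin : i ≤ n
    · rw [min_eq_left hin, min_eq_left (by omega), two_mul]
      exact le_self_add
    · rw [min_eq_right (by omega), min_eq_right (by omega)]
      have := Pop_down (n + 1) (fun y => h y ^ ρ) x
      rwa [add_sub_cancel_right] at this
  have h2 := ENNReal.rpow_le_rpow h1 (by positivity : 0 ≤ 1 / ρ)
  rw [ENNReal.mul_rpow_of_nonneg _ _ (by positivity)] at h2
  have h3 : (2:ℝ≥0∞) ^ (1 / ρ) ≤ 2 := by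
    calc (2:ℝ≥0∞) ^ (1 / ρ) ≤ 2 ^ (1:ℝ) :=
          ENNReal.rpow_le_rpow_of_exponent_le (by norm_num) (by rw [div_le_one hρ0]; exact hρ)
      _ = 2 := ENNReal.rpow_one _
  have h4 : ((2 : ℝ≥0∞) ^ (-δ)) ^ (i - n).natAbs ≤ 2 * ((2 : ℝ≥0∞) ^ (-δ)) ^ (i - (n + 1)).natAbs := by
    rw [wt_eq, wt_eq]
    calc _ ≤ (2:ℝ≥0∞) ^ (1 + -δ * ((i - (n + 1)).natAbs : ℝ)) := by
          refine ENNReal.rpow_le_rpow_of_exponent_le (by norm_num) ?_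
          have : ((i - (n + 1)).natAbs : ℝ) ≤ ((i - n).natAbs : ℝ) + 1 := by
            exact_mod_cast (by omega : (i - (n + 1)).natAbs ≤ (i - n).natAbs + 1)
          nlinarith
      _ = _ := by rw [ENNReal.rpow_add _ _ (by norm_num) (by norm_num), ENNReal.rpow_one]
  unfold dterm
  calc _ ≤ (2 * ((2 : ℝ≥0∞) ^ (-δ)) ^ (i - (n + 1)).natAbs) *
        (2 * Pop (min i (n + 1)) (fun y => h y ^ ρ) x ^ (1 / ρ)) := by
        gcongr
        exact h2.trans (by gcongr)
    _ = _ := by rw [show (4:ℝ≥0∞) = 2 * 2 by norm_num]; ring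

lemma Dti_next (ρ δ : ℝ) (hρ : 1 ≤ ρ) (hδ0 : 0 ≤ δ) (hδ1 : δ ≤ 1) (h : ℤ → ℝ → ℝ≥0∞) (n : ℤ) (x : ℝ) :
    Dti ρ δ h n x ≤ 4 * Dti ρ δ h (n + 1) x := by
  rw [Dti_eq, Dti_eq, ← ENNReal.tsum_mul_left]
  exact ENNReal.tsum_le_tsum fun i => dterm_next ρ δ hρ hδ0 hδ1 (h i) i n x

/-- the truncated partial sums, indexed from scale `-L` on -/
def Xp (L : ℕ) (F : ℤ → ℝ → ℂ) (x : ℝ) (n : ℕ) : ℂ :=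
  ∑ i ∈ Finset.Ioc (-(L:ℤ)) (min (L:ℤ) ((n:ℤ) - L)), F i x

lemma Xp_succ (L : ℕ) (F : ℤ → ℝ → ℂ) (x : ℝ) (n : ℕ) :
    Xp L F x (n + 1) - Xp L F x n = if ((n + 1 : ℕ) : ℤ) - L ≤ L then F (((n + 1 : ℕ) : ℤ) - L) x else 0 := by
  unfold Xp
  split_ifs with h
  · rw [min_eq_right h, min_eq_right (by push_cast at h; omega)]
    have : Finset.Ioc (-(L:ℤ)) (((n + 1 : ℕ) : ℤ) - L) =
        insert (((n + 1 : ℕ) : ℤ) - L) (Finset.Ioc (-(L:ℤ)) ((n : ℤ) - L)) := by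
      ext i
      simp only [Finset.mem_Ioc, Finset.mem_insert]
      push_cast
      omega
    rw [this, Finset.sum_insert (by simp)]
    ring
  · rw [min_eq_left (by omega), min_eq_left (by push_cast at h; omega), sub_self]

lemma lep_dist (m : ℤ) (x : ℝ) : (2:ℝ) ^ m * |x - lep (m - 1) x| ≤ 2 := by
  have h1 := lep_le (m - 1) x
  have h2 := lt_lep (m - 1) x
  rw [abs_of_nonneg (by linarith)]
  calc (2:ℝ) ^ m * (x - lep (m - 1) x) ≤ 2 ^ m * 2 ^ (-(m - 1)) :=
        mul_le_mul_of_nonneg_left (by linarith) (by positivity)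
    _ = 2 := by rw [← zpow_add₀ (by norm_num)]; ring_nf; norm_num

lemma mkMart (L : ℕ) (r : ℝ) (F : ℤ → ℝ → ℂ) (A : ℤ → ℝ → ℝ≥0∞) (K : ℝ≥0∞) (hK : K ≠ ⊤)
    (hfin : ∀ n x, A n x ≠ ⊤) (hsh : ∀ n x z, 2 ^ n * |x - z| ≤ 2 → A n x ≤ 10 * A n z)
    (hF : ∀ n x, ‖F n x‖ₑ ≤ K * A n x) (G : ℝ → ℂ) (hG : Continuous G)
    (hdG : ∀ n x, ‖davg (n + 1) G x - davg n G x‖ₑ ≤ K * A (n + 1) x)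
    (hX : (∀ (n : ℕ) x, ‖Xp L F x n - davg ((n:ℤ) - L) G x‖ₑ ≤ K * A ((n:ℤ) - L) x) ∨ r = 1) :
    ∃ (M : ℝ → ℕ → ℂ) (D : ℝ → ℕ → ℝ),
      Mart (dpart L) (volume.restrict (Set.Ico (-(2:ℝ) ^ L) (2 ^ L))) M D ∧
      (∀ x, Coup r (M x) (Xp L F x) (D x)) ∧
      ∀ x (n : ℕ), ENNReal.ofReal (D x n) ≤ 100 * K * A ((n:ℤ) - L) x := by
  set D : ℝ → ℕ → ℝ := fun x n => (10 * K * A ((n:ℤ) - L) (lep ((n:ℤ) - L - 1) x)).toReal with hD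
  have hDf : ∀ x (n : ℕ), 10 * K * A ((n:ℤ) - L) (lep ((n:ℤ) - L - 1) x) ≠ ⊤ := fun x n =>
    ENNReal.mul_ne_top (ENNReal.mul_ne_top (by norm_num) hK) (hfin _ _)
  have hle : ∀ (v : ℂ) x (n : ℕ), ‖v‖ₑ ≤ K * A ((n:ℤ) - L) x → ‖v‖ ≤ D x n := by
    intro v x n hv
    have h1 := hsh ((n:ℤ) - L) x _ (lep_dist _ x)
    have h2 : ‖v‖ₑ ≤ 10 * K * A ((n:ℤ) - L) (lep ((n:ℤ) - L - 1) x) := by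
      calc _ ≤ K * (10 * A ((n:ℤ) - L) (lep ((n:ℤ) - L - 1) x)) := hv.trans (by gcongr)
        _ = _ := by ring
    rw [← toReal_enorm]
    exact ENNReal.toReal_mono (hDf x n) h2
  refine ⟨fun x n => davg ((n:ℤ) - L) G x, D, ?_, ?_, ?_⟩
  · refine ⟨?_, ?_, ?_, ?_, ?_, ?_⟩
    · intro n x y hxy
      exact davg_congr G hxy
    · intro n x y hxy
      have e : ((n + 1 : ℕ) : ℤ) - L - 1 = n - L := by push_cast; ring
      have : lep (((n + 1 : ℕ) : ℤ) - L - 1) x = lep (((n + 1 : ℕ) : ℤ) - L - 1) y := by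
        rw [e]; exact lep_congr hxy
      simp only [hD, this]
    · intro x y hxy
      have : lep (((0 : ℕ) : ℤ) - L - 1) x = lep (((0 : ℕ) : ℤ) - L - 1) y := by
        refine lep_congr (floor_refine _ _ _ ?_)
        rw [sub_add_cancel]
        exact hxy
      simp only [hD, this]
    · intro x n
      exact ENNReal.toReal_nonneg
    · intro x n
      refine hle _ x (n + 1) ?_
      have := hdG ((n:ℤ) - L) x
      have e : ((n + 1 : ℕ) : ℤ) - L = n - L + 1 := by push_cast; ring
      simp only [e]
      exact this
    · intro n ξ hξ _
      exact davg_orth L n G hG ξ hξ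
  · intro x
    refine ⟨?_, ?_⟩
    · intro n
      rw [Xp_succ]
      split_ifs with h
      · exact hle _ x (n + 1) (hF _ x)
      · rw [norm_zero]; exact ENNReal.toReal_nonneg
    · rcases hX with hX | hX
      · exact Or.inl fun n => hle _ x n (hX n x)
      · exact Or.inr hX
  · intro x n
    simp only [hD]
    rw [ENNReal.ofReal_toReal (hDf x n)]
    have h1 := hsh ((n:ℤ) - L) (lep ((n:ℤ) - L - 1) x) x (by
      rw [abs_sub_comm]; exact lep_dist _ x)
    calc _ ≤ 10 * K * (10 * A ((n:ℤ) - L) x) := by gcongr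
      _ = 100 * K * A ((n:ℤ) - L) x := by rw [show (100:ℝ≥0∞) = 10 * 10 by norm_num]; ring

lemma mixed_pow (p r : ℝ) (hp : 0 < p) (f : ℤ → ℝ → ℂ) :
    mixedNorm p r f ^ p = ∫⁻ x, (∑' i, ‖f i x‖ₑ ^ r) ^ (p / r) := by
  unfold mixedNorm
  rw [← ENNReal.rpow_mul, one_div_mul_cancel hp.ne', ENNReal.rpow_one]
  refine lintegral_congr fun x => ?_
  rw [← ENNReal.rpow_mul, one_div_mul_eq_div]
  simp only [ofReal_norm]

lemma fin_each (p r : ℝ) (hp : 0 < p) (hr : 0 < r) (f : ℤ → ℝ → ℂ) (hf : mixedNorm p r f < ⊤) (i : ℤ) :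
    ∫⁻ y, ‖f i y‖ₑ ^ p ≠ ⊤ := by
  have h1 : mixedNorm p r f ^ p < ⊤ := ENNReal.rpow_lt_top_of_nonneg hp.le hf.ne
  rw [mixed_pow p r hp] at h1
  refine (lt_of_le_of_lt (lintegral_mono fun y => ?_) h1).ne
  calc ‖f i y‖ₑ ^ p = (‖f i y‖ₑ ^ r) ^ (p / r) := by
        rw [← ENNReal.rpow_mul]; congr 1; field_simp
    _ ≤ _ := ENNReal.rpow_le_rpow (ENNReal.le_tsum (f := fun i => ‖f i y‖ₑ ^ r) i) (by positivity)

lemma Dti_meas (ρ δ : ℝ) (h : ℤ → ℝ → ℝ≥0∞) (hh : ∀ i, Measurable (h i)) (n : ℤ) :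
    Measurable (Dti ρ δ h n) := by
  unfold Dti
  refine Measurable.tsum fun i => ?_
  exact ((Pop_meas (min i n) ((hh i).pow_const ρ)).pow_const _).const_mul _

lemma fin_everywhere (p r : ℝ) (hp : 0 < p) (hr : 0 < r) (A : ℤ → ℝ → ℝ≥0∞) (hA : ∀ n, Measurable (A n))
    (hsh : ∀ n x z, 2 ^ n * |x - z| ≤ 2 → A n x ≤ 10 * A n z)
    (hfin : ∫⁻ x, (∑' n, A n x ^ r) ^ (p / r) ≠ ⊤) (n : ℤ) (x : ℝ) : A n x ≠ ⊤ := by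
  have hm : Measurable (fun x => (∑' n, A n x ^ r) ^ (p / r)) :=
    (Measurable.tsum fun i => (hA i).pow_const r).pow_const _
  have hae := ae_lt_top hm hfin
  have hd := Measure.dense_of_ae hae
  obtain ⟨z, hz, hdist⟩ := hd.exists_dist_lt x (ε := 2 ^ (-n)) (by positivity)
  have h1 := hsh n x z (by
    rw [Real.dist_eq] at hdist
    calc (2:ℝ) ^ n * |x - z| ≤ 2 ^ n * 2 ^ (-n) := mul_le_mul_of_nonneg_left hdist.le (by positivity)
      _ = 1 := by rw [mul_comm, zpow_neg_mul_self']
      _ ≤ 2 := by norm_num)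
  intro htop
  rw [htop, top_le_iff, ENNReal.mul_eq_top] at h1
  have h2 : A n z = ⊤ := by
    rcases h1 with h1 | h1
    · exact h1.2
    · exact absurd h1.1 (by norm_num)
  have h3 : (∑' n, A n z ^ r) ^ (p / r) < ⊤ := hz
  have h4 : (⊤:ℝ≥0∞) ≤ ∑' n, A n z ^ r := by
    refine le_trans ?_ (ENNReal.le_tsum n)
    rw [h2, ENNReal.top_rpow_of_pos hr]
  rw [top_le_iff.1 h4, ENNReal.top_rpow_of_pos (by positivity)] at h3
  exact lt_irrefl _ h3

lemma sum_S (L : ℕ) (r : ℝ) (hr : 0 < r) (A : ℤ → ℝ≥0∞) (K : ℝ≥0∞) (D : ℕ → ℝ) (hD0 : ∀ n, 0 ≤ D n)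
    (hD : ∀ n : ℕ, ENNReal.ofReal (D n) ≤ K * A ((n:ℤ) - L)) (T : ℕ) :
    ∑ k ∈ Finset.range T, ENNReal.ofReal (D k ^ r) ≤ K ^ r * ∑' n, A n ^ r := by
  calc _ ≤ ∑ k ∈ Finset.range T, K ^ r * A ((k:ℤ) - L) ^ r := by
        refine Finset.sum_le_sum fun k _ => ?_
        rw [← ENNReal.ofReal_rpow_of_nonneg (hD0 k) hr.le, ← ENNReal.mul_rpow_of_nonneg _ _ hr.le]
        exact ENNReal.rpow_le_rpow (hD k) hr.le
    _ = K ^ r * ∑ k ∈ Finset.range T, A ((k:ℤ) - L) ^ r := by rw [Finset.mul_sum]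
    _ ≤ _ := by
        gcongr
        refine (ENNReal.sum_le_tsum _).trans ?_
        exact ENNReal.tsum_comp_le_tsum_of_injective (f := fun k : ℕ => (k:ℤ) - L)
          (fun a b hab => by simpa using hab) (fun n => A n ^ r)

lemma davg_sum (m : ℤ) (s : Finset ℤ) (F : ℤ → ℝ → ℂ) (hF : ∀ i, Continuous (F i)) (x : ℝ) :
    davg m (fun z => ∑ i ∈ s, F i z) x = ∑ i ∈ s, davg m (F i) x := by
  unfold davg
  rw [intervalIntegral.integral_finsetSum (fun i _ => (hF i).intervalIntegrable _ _), Finset.smul_sum]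

/-- truncated partial sums at all integer levels -/
def Xq (s : Finset ℤ) (F : ℤ → ℝ → ℂ) (m : ℤ) (x : ℝ) : ℂ := ∑ i ∈ s, if i ≤ m then F i x else 0

lemma Xp_eq_Xq (L : ℕ) (F : ℤ → ℝ → ℂ) (x : ℝ) (n : ℕ) :
    Xp L F x n = Xq (Finset.Ioc (-(L:ℤ)) L) F ((n:ℤ) - L) x := by
  unfold Xp Xq
  rw [← Finset.sum_filter]
  refine Finset.sum_congr ?_ fun _ _ => rfl
  ext i
  simp only [Finset.mem_Ioc, Finset.mem_filter, le_min_iff]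
  tauto

lemma Xq_succ (s : Finset ℤ) (F : ℤ → ℝ → ℂ) (m : ℤ) (x : ℝ) :
    Xq s F (m + 1) x - Xq s F m x = if m + 1 ∈ s then F (m + 1) x else 0 := by
  unfold Xq
  rw [← Finset.sum_sub_distrib]
  have : ∀ i ∈ s, ((if i ≤ m + 1 then F i x else 0) - if i ≤ m then F i x else 0) =
      if m + 1 = i then F (m + 1) x else 0 := by
    intro i _
    by_cases h1 : i ≤ m
    · rw [if_pos (by omega), if_pos h1, if_neg (by omega), sub_self]
    · by_cases h2 : m + 1 = i
      · subst h2; simp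
      · rw [if_neg (by omega), if_neg h1, if_neg h2, sub_self]
  rw [Finset.sum_congr rfl this, Finset.sum_ite_eq]

section
variable {φ : SchwartzMap ℝ ℂ} {C : ℝ}

lemma Xq_davg (hK : KB φ C) (f : ℤ → ℝ → ℂ) (hf : ∀ i, Measurable (f i))
    (ρ δ : ℝ) (hρ : 1 ≤ ρ) (hδ : δ = 1 - 1 / ρ)
    (hfin : ∀ i x, Pop i (fun y => ‖f i y‖ₑ) x ≠ ⊤) (s : Finset ℤ) (m : ℤ) (x : ℝ) :
    ‖Xq s (fun i => conv (dilate φ i) (f i)) m x -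
      davg m (fun z => ∑ i ∈ s, conv (dilate φ i) (f i) z) x‖ₑ ≤
      ENNReal.ofReal (128 * C) * Dti ρ δ (fun i y => ‖f i y‖ₑ) m x := by
  have hC := hK.pos
  have hρ0 : 0 < ρ := by linarith
  have hδ1 : δ ≤ 1 := by
    rw [hδ]; have : 0 < 1 / ρ := by positivity
    linarith
  rw [davg_sum m s (fun i => conv (dilate φ i) (f i)) (fun i => conv_cont hK i (hf i) (hfin i))]
  unfold Xq
  rw [← Finset.sum_sub_distrib]
  refine (enorm_sum_le _ _).trans ?_
  rw [Dti_eq, ← ENNReal.tsum_mul_left]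
  refine (Finset.sum_le_sum fun i _ => ?_).trans (ENNReal.sum_le_tsum s)
  split_ifs with h
  · refine (bd_A hK h (hf i) ρ δ hρ hδ1 (hfin i) x).trans ?_
    gcongr
    norm_num
  · rw [zero_sub, enorm_neg]
    exact bd_B hK (by omega) (hf i) ρ δ hρ hδ (hfin i) x

lemma davg_diff (hK : KB φ C) (f : ℤ → ℝ → ℂ) (hf : ∀ i, Measurable (f i))
    (ρ δ : ℝ) (hρ : 1 ≤ ρ) (hδ : δ = 1 - 1 / ρ)
    (hfin : ∀ i x, Pop i (fun y => ‖f i y‖ₑ) x ≠ ⊤) (s : Finset ℤ) (m : ℤ) (x : ℝ) :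
    ‖davg (m + 1) (fun z => ∑ i ∈ s, conv (dilate φ i) (f i) z) x -
      davg m (fun z => ∑ i ∈ s, conv (dilate φ i) (f i) z) x‖ₑ ≤
      ENNReal.ofReal (1000 * C) * Dti ρ δ (fun i y => ‖f i y‖ₑ) (m + 1) x := by
  have hC := hK.pos
  have hρ0 : 0 < ρ := by linarith
  have hρ1 : 1 / ρ ≤ 1 := by rw [div_le_one hρ0]; exact hρ
  have hρ2 : 0 < 1 / ρ := by positivity
  have h1 := Xq_davg hK f hf ρ δ hρ hδ hfin s m x
  have h2 := Xq_davg hK f hf ρ δ hρ hδ hfin s (m + 1) x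
  have h3 := Xq_succ s (fun i => conv (dilate φ i) (f i)) m x
  have h4 : ‖Xq s (fun i => conv (dilate φ i) (f i)) (m + 1) x -
      Xq s (fun i => conv (dilate φ i) (f i)) m x‖ₑ ≤
      ENNReal.ofReal (16 * C) * Dti ρ δ (fun i y => ‖f i y‖ₑ) (m + 1) x := by
    rw [h3]
    split_ifs with h
    · refine (bd_C hK (m + 1) (hf _) ρ δ hρ x).trans ?_
      gcongr
      exact dterm_le ρ δ (fun i y => ‖f i y‖ₑ) (m + 1) (m + 1) x
    · simp
  have h5 := Dti_next ρ δ hρ (by rw [hδ]; linarith) (by rw [hδ]; linarith) (fun i y => ‖f i y‖ₑ) m x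
  set P := Dti ρ δ (fun i y => ‖f i y‖ₑ) (m + 1) x
  set a := davg (m + 1) (fun z => ∑ i ∈ s, conv (dilate φ i) (f i) z) x
  set b := davg m (fun z => ∑ i ∈ s, conv (dilate φ i) (f i) z) x
  set c := Xq s (fun i => conv (dilate φ i) (f i)) (m + 1) x
  set d := Xq s (fun i => conv (dilate φ i) (f i)) m x
  have e : a - b = -(c - a) + (c - d) + (d - b) := by ring
  rw [e]
  calc _ ≤ ‖-(c - a)‖ₑ + ‖c - d‖ₑ + ‖d - b‖ₑ :=
        (enorm_add_le _ _).trans (by gcongr; exact enorm_add_le _ _)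
    _ ≤ ENNReal.ofReal (128 * C) * P + ENNReal.ofReal (16 * C) * P +
        ENNReal.ofReal (128 * C) * (4 * P) := by
        rw [enorm_neg]
        gcongr
        exact h1.trans (by gcongr)
    _ = ENNReal.ofReal (656 * C) * P := by
        rw [show (4:ℝ≥0∞) = ENNReal.ofReal 4 by simp, ← mul_assoc,
          ← ENNReal.ofReal_mul (by positivity), ← add_mul, ← add_mul,
          ← ENNReal.ofReal_add (by positivity) (by positivity),
          ← ENNReal.ofReal_add (by positivity) (by positivity)]
        congr 2
        ring
    _ ≤ _ := by gcongr; norm_num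

lemma transfer (hK : KB φ C) (p r : ℝ) (hp : 1 < p) (hr : 1 ≤ r) :
    ∃ C' : ℝ≥0∞, C' ≠ ⊤ ∧ ∀ f : ℤ → ℝ → ℂ, (∀ i, Measurable (f i)) → mixedNorm p r f < ⊤ →
      ∃ S : ℝ → ℝ≥0∞, Measurable S ∧ ∫⁻ x, S x ^ (p / r) ≤ C' * mixedNorm p r f ^ p ∧
      ∀ L : ℕ, ∃ (M : ℝ → ℕ → ℂ) (D : ℝ → ℕ → ℝ),
        Mart (dpart L) (volume.restrict (Set.Ico (-(2:ℝ) ^ L) (2 ^ L))) M D ∧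
        (∀ x, Coup r (M x) (Xp L (fun i => conv (dilate φ i) (f i)) x) (D x)) ∧
        ∀ x T, ∑ k ∈ Finset.range T, ENNReal.ofReal (D x k ^ r) ≤ S x := by
  have hr0 : 0 < r := by linarith
  have hp0 : 0 < p := by linarith
  have hC := hK.pos
  -- common reduction
  have main : ∀ (C1 : ℝ≥0∞) (hC1 : C1 ≠ ⊤) (A : (ℤ → ℝ → ℂ) → ℤ → ℝ → ℝ≥0∞),
      (∀ f : ℤ → ℝ → ℂ, (∀ i, Measurable (f i)) → mixedNorm p r f < ⊤ →
        (∀ n, Measurable (A f n)) ∧ (∀ n x z, 2 ^ n * |x - z| ≤ 2 → A f n x ≤ 10 * A f n z) ∧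
        (∫⁻ x, (∑' n, A f n x ^ r) ^ (p / r) ≤ C1 * mixedNorm p r f ^ p) ∧
        (∀ n x, ‖conv (dilate φ n) (f n) x‖ₑ ≤ ENNReal.ofReal (1000 * C) * A f n x) ∧
        ∀ L : ℕ, ∃ G : ℝ → ℂ, Continuous G ∧
          (∀ n x, ‖davg (n + 1) G x - davg n G x‖ₑ ≤ ENNReal.ofReal (1000 * C) * A f (n + 1) x) ∧
          ((∀ (n : ℕ) x, ‖Xp L (fun i => conv (dilate φ i) (f i)) x n - davg ((n:ℤ) - L) G x‖ₑ ≤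
            ENNReal.ofReal (1000 * C) * A f ((n:ℤ) - L) x) ∨ r = 1)) →
      ∃ C' : ℝ≥0∞, C' ≠ ⊤ ∧ ∀ f : ℤ → ℝ → ℂ, (∀ i, Measurable (f i)) → mixedNorm p r f < ⊤ →
      ∃ S : ℝ → ℝ≥0∞, Measurable S ∧ ∫⁻ x, S x ^ (p / r) ≤ C' * mixedNorm p r f ^ p ∧
      ∀ L : ℕ, ∃ (M : ℝ → ℕ → ℂ) (D : ℝ → ℕ → ℝ),
        Mart (dpart L) (volume.restrict (Set.Ico (-(2:ℝ) ^ L) (2 ^ L))) M D ∧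
        (∀ x, Coup r (M x) (Xp L (fun i => conv (dilate φ i) (f i)) x) (D x)) ∧
        ∀ x T, ∑ k ∈ Finset.range T, ENNReal.ofReal (D x k ^ r) ≤ S x := by
    intro C1 hC1 A hA
    set K : ℝ≥0∞ := ENNReal.ofReal (1000 * C) with hKd
    have hKt : 100 * K ≠ ⊤ := ENNReal.mul_ne_top (by norm_num) ENNReal.ofReal_ne_top
    refine ⟨(100 * K) ^ p * C1, ENNReal.mul_ne_top (ENNReal.rpow_ne_top_of_nonneg hp0.le hKt) hC1,
      fun f hf hfm => ?_⟩
    obtain ⟨hm, hsh, hintg, hF, hG⟩ := hA f hf hfm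
    refine ⟨fun x => (100 * K) ^ r * ∑' n, A f n x ^ r, ?_, ?_, ?_⟩
    · exact (Measurable.tsum fun i => (hm i).pow_const r).const_mul _
    · have e : ∀ x, ((100 * K) ^ r * ∑' n, A f n x ^ r) ^ (p / r) =
          (100 * K) ^ p * (∑' n, A f n x ^ r) ^ (p / r) := by
        intro x
        rw [ENNReal.mul_rpow_of_nonneg _ _ (by positivity), ← ENNReal.rpow_mul]
        congr 2; field_simp
      simp only [e]
      rw [lintegral_const_mul' _ _ (ENNReal.rpow_ne_top_of_nonneg hp0.le hKt), mul_assoc]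
      gcongr
    · intro L
      obtain ⟨G, hGc, hG1, hG2⟩ := hG L
      have hfin := fin_everywhere p r hp0 hr0 (A f) hm hsh (lt_of_le_of_lt hintg
        (ENNReal.mul_lt_top hC1.lt_top (ENNReal.rpow_lt_top_of_nonneg hp0.le hfm.ne))).ne
      obtain ⟨M, D, h1, h2, h3⟩ := mkMart L r (fun i => conv (dilate φ i) (f i)) (A f) K
        ENNReal.ofReal_ne_top hfin hsh hF G hGc hG1 hG2
      exact ⟨M, D, h1, h2, fun x T => sum_S L r hr0 (fun n => A f n x) (100 * K) (D x) (h1.D0 x)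
        (h3 x) T⟩
  by_cases hr1 : r = 1
  · obtain ⟨C1, hC1, hb⟩ := fsP p r hp hr
    refine main C1 hC1 (fun f n x => Pop n (fun y => ‖f n y‖ₑ) x) fun f hf hfm => ⟨?_, ?_, ?_, ?_, ?_⟩
    · exact fun n => Pop_meas n (hf n).enorm
    · intro n x z hxz
      have := Pop_shift n (fun y => ‖f n y‖ₑ) x z 2 hxz
      rw [show (2:ℝ) * (1 + 2 ^ 2) = 10 by norm_num, show ENNReal.ofReal 10 = 10 by simp] at this
      exact this
    · have := hb (fun i y => ‖f i y‖ₑ) (fun i => (hf i).enorm) 0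
      simp only [add_zero] at this
      rw [mixed_pow p r hp0]
      exact this
    · intro n x
      refine (conv_a hK n (f n) x).trans ?_
      gcongr
      linarith
    · intro L
      refine ⟨fun _ => 0, continuous_const, ?_, Or.inr hr1⟩
      intro n x
      simp [davg]
  · obtain ⟨ρ, h1ρ, hρm⟩ := exists_between (lt_min hp (lt_of_le_of_ne hr (Ne.symm hr1)))
    have hρp : ρ < p := hρm.trans_le (min_le_left _ _)
    have hρr : ρ < r := hρm.trans_le (min_le_right _ _)
    have hρ0 : 0 < ρ := by linarith
    set δ := 1 - 1 / ρ with hδ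
    have hδ0 : 0 < δ := by
      have : 1 / ρ < 1 := by rw [div_lt_one hρ0]; exact h1ρ
      linarith
    obtain ⟨C1, hC1, hb⟩ := fsD p r ρ δ h1ρ.le hρp hρr.le hδ0
    refine main C1 hC1 (fun f n x => Dti ρ δ (fun i y => ‖f i y‖ₑ) n x) fun f hf hfm =>
      ⟨?_, ?_, ?_, ?_, ?_⟩
    · exact fun n => Dti_meas ρ δ _ (fun i => (hf i).enorm) n
    · exact fun n x z hxz => Dti_shift ρ δ h1ρ.le _ n x z hxz
    · rw [mixed_pow p r hp0]
      exact hb (fun i y => ‖f i y‖ₑ) (fun i => (hf i).enorm)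
    · intro n x
      refine (bd_C hK n (hf n) ρ δ h1ρ.le x).trans ?_
      gcongr
      · norm_num
      · exact dterm_le ρ δ (fun i y => ‖f i y‖ₑ) n n x
    · intro L
      have hfin : ∀ i x, Pop i (fun y => ‖f i y‖ₑ) x ≠ ⊤ := by
        intro i x
        have := Pop_finite i (hf i).enorm 1 p one_pos hp.le (fin_each p r hp0 hr0 f hfm i) x
        simpa using this
      refine ⟨fun z => ∑ i ∈ Finset.Ioc (-(L:ℤ)) L, conv (dilate φ i) (f i) z, ?_, ?_, Or.inl ?_⟩
      · exact continuous_finsetSum _ fun i _ => conv_cont hK i (hf i) (hfin i)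
      · exact fun n x => davg_diff hK f hf ρ δ h1ρ.le hδ hfin _ n x
      · intro n x
        rw [Xp_eq_Xq]
        refine (Xq_davg hK f hf ρ δ h1ρ.le hδ hfin _ _ x).trans ?_
        gcongr
        norm_num
end

/-- the bilinear jump between two scales -/
def bjump (F G : ℤ → ℝ → ℂ) (A B : ℤ) (x : ℝ) : ℂ :=
  ∑ j ∈ Finset.Ioc A B, ∑ i ∈ Finset.Ioo A j, F i x * G j x

lemma Xp_sub (L : ℕ) (F : ℤ → ℝ → ℂ) (x : ℝ) (a j : ℕ) (haj : a ≤ j) (hj : (j:ℤ) - L ≤ L) :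
    Xp L F x j - Xp L F x a = ∑ i ∈ Finset.Ioc ((a:ℤ) - L) ((j:ℤ) - L), F i x := by
  unfold Xp
  rw [min_eq_right hj, min_eq_right (by omega)]
  have : Finset.Ioc (-(L:ℤ)) ((j:ℤ) - L) =
      Finset.Ioc (-(L:ℤ)) ((a:ℤ) - L) ∪ Finset.Ioc ((a:ℤ) - L) ((j:ℤ) - L) := by
    ext i; simp only [Finset.mem_Ioc, Finset.mem_union]; omega
  rw [this, Finset.sum_union]
  · ring
  · rw [Finset.disjoint_left]
    intro i hi hi2
    simp only [Finset.mem_Ioc] at hi hi2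
    omega

lemma area_jump (L : ℕ) (F G : ℤ → ℝ → ℂ) (x : ℝ) (A B : ℤ) (hA : -(L:ℤ) ≤ A) (hAB : A ≤ B)
    (hB : B ≤ L) :
    area (Xp L F x) (Xp L G x) (A + L).toNat (B + L).toNat = bjump F G A B x := by
  unfold area bjump
  refine Finset.sum_nbij' (fun j : ℕ => (j:ℤ) + 1 - L) (fun j : ℤ => (j - 1 + L).toNat) ?_ ?_ ?_ ?_ ?_
  · intro j hj
    simp only [Finset.mem_Ico, Finset.mem_Ioc] at hj ⊢
    omega
  · intro j hj
    simp only [Finset.mem_Ico, Finset.mem_Ioc] at hj ⊢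
    omega
  · intro j hj
    simp only [Finset.mem_Ico] at hj ⊢
    omega
  · intro j hj
    simp only [Finset.mem_Ioc] at hj ⊢
    omega
  · intro j hj
    simp only [Finset.mem_Ico] at hj
    rw [Xp_sub L F x _ j hj.1 (by omega), Xp_succ, if_pos (by push_cast; omega)]
    have e1 : (((A + L).toNat : ℕ) : ℤ) - L = A := by omega
    have e2 : (((j + 1 : ℕ)) : ℤ) - L = (j:ℤ) + 1 - L := by push_cast; ring
    have e3 : Finset.Ioc A ((j:ℤ) - L) = Finset.Ioo A ((j:ℤ) + 1 - L) := by
      ext i; simp only [Finset.mem_Ioc, Finset.mem_Ioo]; omega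
    rw [e1, e2, e3, Finset.sum_mul]

lemma chain_build (big : ℕ → ℕ → Prop) (P : ℕ → ℕ) (hP : Monotone P) (T : ℕ) (s : Finset ℕ)
    (hs : ∀ k ∈ s, P k < P (k + 1) ∧ P (k + 1) ≤ T ∧ big (P k) (P (k + 1))) :
    ∃ b ≤ T, Chain big s.card b ∧ ∀ K, (∀ k ∈ s, k < K) → b ≤ P K := by
  induction s using Finset.induction_on_max with
  | empty => exact ⟨0, Nat.zero_le _, by simpa using Chain.nil 0, fun K _ => Nat.zero_le _⟩
  | insert a s hmax ih =>
    obtain ⟨b, hbT, hch, hb⟩ := ih (fun k hk => hs k (Finset.mem_insert_of_mem hk))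
    obtain ⟨h1, h2, h3⟩ := hs a (Finset.mem_insert_self a s)
    have hna : a ∉ s := fun h => lt_irrefl _ (hmax a h)
    refine ⟨P (a + 1), h2, ?_, ?_⟩
    · rw [Finset.card_insert_of_notMem hna]
      exact Chain.cons hch (hb a hmax) h1 h3
    · intro K hK
      exact hP (hK a (Finset.mem_insert_self a s))

lemma area_smul2 (c d : ℝ) (M N : ℕ → ℂ) (a n : ℕ) :
    area (fun n => (c : ℂ) * M n) (fun n => (d : ℂ) * N n) a n = (c : ℂ) * d * area M N a n := by
  simp only [area, Finset.mul_sum]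
  refine Finset.sum_congr rfl fun j _ => ?_
  ring

lemma Coup.smul {r : ℝ} {M X : ℕ → ℂ} {D : ℕ → ℝ} (h : Coup r M X D) (c : ℝ) (hc : 0 ≤ c) :
    Coup r (fun n => (c:ℂ) * M n) (fun n => (c:ℂ) * X n) (fun n => c * D n) := by
  have e : ∀ v w : ℂ, ‖(c:ℂ) * v - (c:ℂ) * w‖ = c * ‖v - w‖ := by
    intro v w
    rw [← mul_sub, norm_mul, Complex.norm_real, Real.norm_of_nonneg hc]
  refine ⟨fun n => ?_, ?_⟩
  · simp only [e]; exact mul_le_mul_of_nonneg_left (h.1 n) hc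
  · rcases h.2 with h2 | h2
    · refine Or.inl fun n => ?_
      simp only [e]; exact mul_le_mul_of_nonneg_left (h2 n) hc
    · exact Or.inr h2

/-- truncated event -/
def evL (F G : ℤ → ℝ → ℂ) (Nk : ℕ → ℝ → ℤ) (lam : ℝ) (m L : ℕ) : Set ℝ :=
  {x | x ∈ Set.Ico (-(2:ℝ) ^ L) (2 ^ L) ∧ -(L:ℤ) ≤ Nk 0 x ∧ ∃ s : Finset ℕ, s.card = m ∧
    ∀ k ∈ s, Nk (k + 1) x ≤ L ∧ lam < ‖bjump F G (Nk k x) (Nk (k + 1) x) x‖}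

lemma evL_mono (F G : ℤ → ℝ → ℂ) (Nk : ℕ → ℝ → ℤ) (lam : ℝ) (m : ℕ) :
    Monotone (evL F G Nk lam m) := by
  intro L L' hL x hx
  obtain ⟨h1, h2, s, h3, h4⟩ := hx
  have hL' : (L:ℤ) ≤ L' := by exact_mod_cast hL
  have hp : (2:ℝ) ^ L ≤ 2 ^ L' := pow_le_pow_right₀ (by norm_num) hL
  refine ⟨⟨by linarith [h1.1], by linarith [h1.2]⟩, by omega, s, h3, fun k hk => ⟨?_, (h4 k hk).2⟩⟩
  have := (h4 k hk).1
  omega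

lemma evL_cover (F G : ℤ → ℝ → ℂ) (Nk : ℕ → ℝ → ℤ) (lam : ℝ) (m : ℕ) :
    {x | (m : ℕ∞) ≤ {k : ℕ | lam < ‖bjump F G (Nk k x) (Nk (k + 1) x) x‖}.encard} ⊆
      ⋃ L, evL F G Nk lam m L := by
  intro x hx
  obtain ⟨t, ht, htc⟩ := Set.exists_subset_encard_eq hx
  have hfin : t.Finite := Set.finite_of_encard_eq_coe htc
  obtain ⟨s, rfl⟩ : ∃ s : Finset ℕ, t = ↑s := ⟨hfin.toFinset, by simp⟩
  rw [Set.encard_coe_eq_coe_finsetCard] at htc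
  have hc : s.card = m := by exact_mod_cast htc
  obtain ⟨n, hn⟩ := pow_unbounded_of_one_lt (|x|) (by norm_num : (1:ℝ) < 2)
  set L : ℕ := n + (Nk 0 x).natAbs + ∑ k ∈ s, (Nk (k + 1) x).natAbs with hL
  rw [Set.mem_iUnion]
  refine ⟨L, ?_, ?_, s, hc, ?_⟩
  · have hp : (2:ℝ) ^ n ≤ 2 ^ L := pow_le_pow_right₀ (by norm_num) (by omega)
    have := abs_lt.1 (hn.trans_le hp)
    exact ⟨this.1.le, this.2⟩
  · omega
  · intro k hk
    refine ⟨?_, ht hk⟩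
    have : (Nk (k + 1) x).natAbs ≤ ∑ k ∈ s, (Nk (k + 1) x).natAbs :=
      Finset.single_le_sum (f := fun k => (Nk (k + 1) x).natAbs) (fun _ _ => Nat.zero_le _) hk
    omega

lemma evL_chain (F G : ℤ → ℝ → ℂ) (Nk : ℕ → ℝ → ℤ) (hN : ∀ k x, Nk k x ≤ Nk (k + 1) x) (lam : ℝ)
    (hlam : 0 < lam) (m L : ℕ) (c d : ℝ) (hc : 0 < c) (hd : 0 < d) (hcd : c * d * lam = 2) (x : ℝ)
    (hx : x ∈ evL F G Nk lam m L) :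
    ∃ b ≤ 2 * L, Chain (bigXY (fun n => (c:ℂ) * Xp L F x n) (fun n => (d:ℂ) * Xp L G x n)) m b := by
  obtain ⟨_, h2, s, h3, h4⟩ := hx
  have hmono : Monotone (fun k => Nk k x) := monotone_nat_of_le_succ fun k => hN k x
  obtain ⟨b, hb, hch, _⟩ := chain_build
    (bigXY (fun n => (c:ℂ) * Xp L F x n) (fun n => (d:ℂ) * Xp L G x n))
    (fun k => (Nk k x + L).toNat) (fun k l hkl => by
      have := hmono hkl
      simp only at this ⊢
      omega) (2 * L) s (fun k hk => by
      obtain ⟨h5, h6⟩ := h4 k hk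
      have h7 : Nk 0 x ≤ Nk k x := hmono (Nat.zero_le k)
      have h8 := hN k x
      have h9 : Nk k x ≠ Nk (k + 1) x := by
        intro e
        rw [← e] at h6
        simp [bjump] at h6
        linarith
      refine ⟨by omega, by omega, ?_⟩
      unfold bigXY
      rw [area_smul2, area_jump L F G x _ _ (by omega) h8 h5, norm_mul, norm_mul, Complex.norm_real,
        Complex.norm_real, Real.norm_of_nonneg hc.le, Real.norm_of_nonneg hd.le, ← hcd]
      exact mul_lt_mul_of_pos_left h6 (mul_pos hc hd))
  exact ⟨b, hb, h3 ▸ hch⟩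

lemma Hsum_le (r s c d : ℝ) (hc : 0 ≤ c) (hd : 0 ≤ d) (D E : ℕ → ℝ)
    (hD : ∀ n, 0 ≤ D n) (hE : ∀ n, 0 ≤ E n) (Sf Sg : ℝ≥0∞) (T : ℕ)
    (hf : ∑ k ∈ Finset.range (T + 1), ENNReal.ofReal (D k ^ r) ≤ Sf)
    (hg : ∑ k ∈ Finset.range (T + 1), ENNReal.ofReal (E k ^ s) ≤ Sg) :
    ENNReal.ofReal (Hsum r s (fun n => c * D n) (fun n => d * E n) T) ≤
      ENNReal.ofReal (c ^ r) * Sf + ENNReal.ofReal (d ^ s) * Sg := by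
  unfold Hsum
  have h1 : ∀ k, 0 ≤ (c * D k) ^ r := fun k => Real.rpow_nonneg (mul_nonneg hc (hD k)) _
  have h2 : ∀ k, 0 ≤ (d * E k) ^ s := fun k => Real.rpow_nonneg (mul_nonneg hd (hE k)) _
  rw [ENNReal.ofReal_sum_of_nonneg (fun k _ => add_nonneg (h1 k) (h2 k))]
  calc _ = ∑ k ∈ Finset.range (T + 1), (ENNReal.ofReal (c ^ r) * ENNReal.ofReal (D k ^ r) +
        ENNReal.ofReal (d ^ s) * ENNReal.ofReal (E k ^ s)) := by
        refine Finset.sum_congr rfl fun k _ => ?_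
        rw [ENNReal.ofReal_add (h1 k) (h2 k), Real.mul_rpow hc (hD k), Real.mul_rpow hd (hE k),
          ENNReal.ofReal_mul (Real.rpow_nonneg hc _), ENNReal.ofReal_mul (Real.rpow_nonneg hd _)]
    _ = ENNReal.ofReal (c ^ r) * ∑ k ∈ Finset.range (T + 1), ENNReal.ofReal (D k ^ r) +
        ENNReal.ofReal (d ^ s) * ∑ k ∈ Finset.range (T + 1), ENNReal.ofReal (E k ^ s) := by
        rw [Finset.sum_add_distrib, Finset.mul_sum, Finset.mul_sum]
    _ ≤ _ := by gcongr

/-- data produced by `transfer` -/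
def HasS (r : ℝ) (F : ℤ → ℝ → ℂ) (S : ℝ → ℝ≥0∞) : Prop :=
  ∀ L : ℕ, ∃ (M : ℝ → ℕ → ℂ) (D : ℝ → ℕ → ℝ),
    Mart (dpart L) (volume.restrict (Set.Ico (-(2:ℝ) ^ L) (2 ^ L))) M D ∧
    (∀ x, Coup r (M x) (Xp L F x) (D x)) ∧
    ∀ x T, ∑ k ∈ Finset.range T, ENNReal.ofReal (D x k ^ r) ≤ S x

lemma dist_fin (r s : ℝ) (hr : 1 ≤ r) (hr2 : r ≤ 2) (hs : 1 ≤ s) (hs2 : s ≤ 2) (hne : r ≠ 1 ∨ s ≠ 1)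
    (F G : ℤ → ℝ → ℂ) (Sf Sg : ℝ → ℝ≥0∞) (hF : HasS r F Sf) (hG : HasS s G Sg)
    (Nk : ℕ → ℝ → ℤ) (hN : ∀ k x, Nk k x ≤ Nk (k + 1) x) (lam : ℝ)
    (hlam : 0 < lam) (m : ℕ) (hm : 1 ≤ m) (c d : ℝ) (hc : 0 < c) (hd : 0 < d) (hcd : c * d * lam = 2)
    (γ : ℝ) (hγ : 0 < γ) (hγ1 : γ ≤ 1 / 216) :
    volume {x | (m : ℕ∞) ≤ {k : ℕ | lam < ‖bjump F G (Nk k x) (Nk (k + 1) x) x‖}.encard} ≤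
      ∑' l : ℕ, ENNReal.ofReal (72 * γ) ^ l * volume {x | ENNReal.ofReal (γ * m) <
        36 ^ l * (ENNReal.ofReal (c ^ r) * Sf x + ENNReal.ofReal (d ^ s) * Sg x)} := by
  refine (measure_mono (evL_cover F G Nk lam m)).trans ?_
  rw [(evL_mono F G Nk lam m).measure_iUnion]
  refine iSup_le fun L => ?_
  obtain ⟨M, D, hM, hX, hS⟩ := hF L
  obtain ⟨N, E, hN', hY, hS'⟩ := hG L
  have hb : volume (Set.Ico (-(2:ℝ) ^ L) (2 ^ L)) < ⊤ := by simp
  have : IsFiniteMeasure (volume.restrict (Set.Ico (-(2:ℝ) ^ L) (2 ^ L))) :=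
    ⟨by rw [Measure.restrict_apply_univ]; exact hb⟩
  have key := dist_main (dpart_filt L) (hM.smul c hc.le) (hN'.smul d hd.le) r s hr hr2 hs hs2 hne
    (X := fun x n => (c:ℂ) * Xp L F x n) (Y := fun x n => (d:ℂ) * Xp L G x n)
    (fun x => (hX x).smul c hc.le) (fun x => (hY x).smul d hd.le) m hm γ hγ.le hγ1 (2 * L)
  calc volume (evL F G Nk lam m L) ≤ volume.restrict (Set.Ico (-(2:ℝ) ^ L) (2 ^ L))
        {x | ∃ b ≤ 2 * L, Chain (bigXY (fun n => (c:ℂ) * Xp L F x n)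
          (fun n => (d:ℂ) * Xp L G x n)) m b} := by
        rw [Measure.restrict_apply' measurableSet_Ico]
        refine measure_mono fun x hx => ⟨?_, hx.1⟩
        exact evL_chain F G Nk hN lam hlam m L c d hc hd hcd x hx
    _ ≤ _ := key
    _ ≤ _ := by
        refine ENNReal.tsum_le_tsum fun l => ?_
        refine mul_le_mul le_rfl ?_ zero_le zero_le
        refine (Measure.restrict_apply_le _ _).trans (measure_mono fun x hx => ?_)
        have h1 : γ * m < 36 ^ l * Hsum r s (fun n => c * D x n) (fun n => d * E x n) (2 * L) := hx
        have h2 := Hsum_le r s c d hc.le hd.le (D x) (E x) (hM.D0 x) (hN'.D0 x) (Sf x) (Sg x) (2 * L)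
          (hS x _) (hS' x _)
        have h0 : 0 ≤ γ * m := by positivity
        have h3 : ENNReal.ofReal (γ * m) < ENNReal.ofReal (36 ^ l *
            Hsum r s (fun n => c * D x n) (fun n => d * E x n) (2 * L)) :=
          (ENNReal.ofReal_lt_ofReal_iff_of_nonneg h0).2 h1
        refine lt_of_lt_of_le h3 ?_
        rw [ENNReal.ofReal_mul (by positivity), ENNReal.ofReal_pow (by norm_num),
          show ENNReal.ofReal 36 = 36 by simp]
        gcongr

lemma layer_pt (n : ℕ∞) (v : ℝ) (hv : 0 < v) :
    (n : ℝ≥0∞) ^ v ≤ 2 ^ v * ∑' k : ℕ, ((2:ℝ≥0∞) ^ k) ^ v *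
      (if ((2 ^ k : ℕ) : ℕ∞) ≤ n then 1 else 0) := by
  induction n using ENat.recTopCoe with
  | top =>
    simp only [le_top, if_true, mul_one]
    have h : ∑' k : ℕ, ((2:ℝ≥0∞) ^ k) ^ v = ⊤ := by
      rw [eq_top_iff, ← ENNReal.tsum_const_eq_top_of_ne_zero (α := ℕ) (one_ne_zero : (1:ℝ≥0∞) ≠ 0)]
      refine ENNReal.tsum_le_tsum fun k => ?_
      exact ENNReal.one_le_rpow (one_le_pow₀ (by norm_num)) hv
    rw [h, ENNReal.mul_top]
    · exact le_top
    · simp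
  | coe n =>
    by_cases hn : n = 0
    · subst hn
      simp [hv]
    · have h1 := Nat.pow_log_le_self 2 hn
      have h2 := Nat.lt_pow_succ_log_self (b := 2) (by norm_num) n
      calc _ ≤ (2:ℝ≥0∞) ^ v * (((2:ℝ≥0∞) ^ (Nat.log 2 n)) ^ v * 1) := by
            rw [mul_one, ← ENNReal.mul_rpow_of_nonneg _ _ hv.le]
            refine ENNReal.rpow_le_rpow ?_ hv.le
            rw [← pow_succ']
            have : (n:ℝ≥0∞) ≤ ((2 ^ (Nat.log 2 n + 1) : ℕ) : ℝ≥0∞) := by exact_mod_cast h2.le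
            simpa using this
        _ ≤ _ := by
            gcongr
            refine le_trans (le_of_eq ?_) (ENNReal.le_tsum (Nat.log 2 n))
            rw [if_pos (by exact_mod_cast h1)]

lemma layer (J : ℝ → ℕ∞) (v : ℝ) (hv : 0 < v) :
    ∫⁻ x, (J x : ℝ≥0∞) ^ v ≤ 2 ^ v * ∑' k : ℕ, ((2:ℝ≥0∞) ^ k) ^ v *
      volume {x | ((2 ^ k : ℕ) : ℕ∞) ≤ J x} := by
  classical
  set A : ℕ → Set ℝ := fun k => toMeasurable volume {x | ((2 ^ k : ℕ) : ℕ∞) ≤ J x} with hA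
  have hAm : ∀ k, MeasurableSet (A k) := fun k => measurableSet_toMeasurable _ _
  have hAv : ∀ k, volume (A k) = volume {x | ((2 ^ k : ℕ) : ℕ∞) ≤ J x} := fun k =>
    measure_toMeasurable _
  have hm : ∀ k : ℕ, Measurable (fun x => ((2:ℝ≥0∞) ^ k) ^ v * (A k).indicator 1 x) := fun k =>
    (measurable_one.indicator (hAm k)).const_mul _
  calc _ ≤ ∫⁻ x, 2 ^ v * ∑' k : ℕ, ((2:ℝ≥0∞) ^ k) ^ v * (A k).indicator 1 x := by
        refine lintegral_mono fun x => (layer_pt (J x) v hv).trans ?_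
        gcongr with k
        split_ifs with h
        · have : x ∈ A k := subset_toMeasurable _ _ h
          simp [this]
        · exact zero_le
    _ = 2 ^ v * ∑' k : ℕ, ∫⁻ x, ((2:ℝ≥0∞) ^ k) ^ v * (A k).indicator 1 x := by
        rw [lintegral_const_mul' _ _ (ENNReal.rpow_ne_top_of_nonneg hv.le (by norm_num)),
          lintegral_tsum fun k => (hm k).aemeasurable]
    _ = _ := by
        congr 1
        refine tsum_congr fun k => ?_
        rw [lintegral_const_mul _ (measurable_one.indicator (hAm k)), lintegral_indicator_one (hAm k),
          hAv]

lemma geo_ind (z0 κ : ℝ) (hz : 0 < z0) (hκ : 1 < κ) (Y : ℝ≥0∞) :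
    ∑' k : ℕ, ENNReal.ofReal (z0 * κ ^ k) * (if ENNReal.ofReal (z0 * κ ^ k) < Y then 1 else 0) ≤
      ENNReal.ofReal (κ / (κ - 1)) * Y := by
  have hκ0 : 0 < κ - 1 := by linarith
  have hκ' : 0 < κ := by linarith
  rw [ENNReal.tsum_eq_iSup_nat]
  refine iSup_le fun n => ?_
  suffices h : (∑ k ∈ Finset.range n, ENNReal.ofReal (z0 * κ ^ k) *
      (if ENNReal.ofReal (z0 * κ ^ k) < Y then 1 else 0) ≤ ENNReal.ofReal (z0 * κ ^ n / (κ - 1))) ∧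
      (∑ k ∈ Finset.range n, ENNReal.ofReal (z0 * κ ^ k) *
      (if ENNReal.ofReal (z0 * κ ^ k) < Y then 1 else 0) ≤ ENNReal.ofReal (κ / (κ - 1)) * Y) from h.2
  induction n with
  | zero => simp
  | succ n ih =>
    rw [Finset.sum_range_succ]
    have e : ENNReal.ofReal (z0 * κ ^ n / (κ - 1)) + ENNReal.ofReal (z0 * κ ^ n) =
        ENNReal.ofReal (z0 * κ ^ (n + 1) / (κ - 1)) := by
      rw [← ENNReal.ofReal_add (by positivity) (by positivity)]
      congr 1
      field_simp
      ring
    split_ifs with h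
    · rw [mul_one]
      have h1 := add_le_add_left ih.1 (ENNReal.ofReal (z0 * κ ^ n))
      rw [e] at h1
      refine ⟨h1, h1.trans ?_⟩
      calc ENNReal.ofReal (z0 * κ ^ (n + 1) / (κ - 1)) =
            ENNReal.ofReal (κ / (κ - 1)) * ENNReal.ofReal (z0 * κ ^ n) := by
            rw [← ENNReal.ofReal_mul (by positivity)]
            congr 1
            ring
        _ ≤ _ := by gcongr
    · rw [mul_zero, add_zero]
      refine ⟨ih.1.trans ?_, ih.2⟩
      rw [← e]
      exact le_self_add

lemma geo_vol (z0 κ : ℝ) (hz : 0 < z0) (hκ : 1 < κ) (Y : ℝ → ℝ≥0∞) (hY : Measurable Y) :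
    ∑' k : ℕ, ENNReal.ofReal (z0 * κ ^ k) * volume {x | ENNReal.ofReal (z0 * κ ^ k) < Y x} ≤
      ENNReal.ofReal (κ / (κ - 1)) * ∫⁻ x, Y x := by
  classical
  have hm : ∀ k : ℕ, MeasurableSet {x | ENNReal.ofReal (z0 * κ ^ k) < Y x} := fun k =>
    measurableSet_lt measurable_const hY
  have hm2 : ∀ k : ℕ, Measurable (fun x => ENNReal.ofReal (z0 * κ ^ k) *
      {x | ENNReal.ofReal (z0 * κ ^ k) < Y x}.indicator (1 : ℝ → ℝ≥0∞) x) := fun k =>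
    (measurable_one.indicator (hm k)).const_mul _
  calc _ = ∑' k : ℕ, ∫⁻ x, ENNReal.ofReal (z0 * κ ^ k) *
        {x | ENNReal.ofReal (z0 * κ ^ k) < Y x}.indicator (1 : ℝ → ℝ≥0∞) x := by
        refine tsum_congr fun k => ?_
        rw [lintegral_const_mul _ (measurable_one.indicator (hm k)), lintegral_indicator_one (hm k)]
    _ = ∫⁻ x, ∑' k : ℕ, ENNReal.ofReal (z0 * κ ^ k) *
        {x | ENNReal.ofReal (z0 * κ ^ k) < Y x}.indicator (1 : ℝ → ℝ≥0∞) x :=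
        (lintegral_tsum fun k => (hm2 k).aemeasurable).symm
    _ ≤ ∫⁻ x, ENNReal.ofReal (κ / (κ - 1)) * Y x := by
        refine lintegral_mono fun x => ?_
        refine le_trans (le_of_eq (tsum_congr fun k => ?_)) (geo_ind z0 κ hz hκ (Y x))
        simp [Set.indicator_apply]
    _ = _ := lintegral_const_mul' _ _ ENNReal.ofReal_ne_top

/-- one of the two halves of the final sum -/
lemma half (p r γ κ : ℝ) (hp : 0 < p) (hr : 0 < r) (hγ : 0 < γ) (hκ : 1 < κ)
    (hsm : 72 * γ * 36 ^ (p / r) < 1) : ∃ C : ℝ≥0∞, C ≠ ⊤ ∧ ∀ (S : ℝ → ℝ≥0∞), Measurable S →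
    ∀ τ z0 : ℝ, 0 < τ → 0 < z0 →
    ∑' l : ℕ, ENNReal.ofReal (72 * γ) ^ l * ∑' k : ℕ, ENNReal.ofReal (z0 * κ ^ k) *
      volume {x | ENNReal.ofReal (z0 * κ ^ k) <
        (ENNReal.ofReal (2 / γ * 36 ^ l * τ ^ r) * S x) ^ (p / r)} ≤
      C * (ENNReal.ofReal (τ ^ p) * ∫⁻ x, S x ^ (p / r)) := by
  have hθ : 0 < p / r := by positivity
  set η : ℝ := 72 * γ * 36 ^ (p / r) with hη
  have hη0 : 0 < η := by positivity
  refine ⟨ENNReal.ofReal (κ / (κ - 1)) * ENNReal.ofReal ((2 / γ) ^ (p / r)) *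
    ∑' l : ℕ, ENNReal.ofReal η ^ l, ?_, ?_⟩
  · refine ENNReal.mul_ne_top (ENNReal.mul_ne_top ENNReal.ofReal_ne_top ENNReal.ofReal_ne_top) ?_
    rw [ENNReal.tsum_geometric]
    simp only [ne_eq, ENNReal.inv_eq_top, tsub_eq_zero_iff_le, not_le]
    rw [← ENNReal.ofReal_one]
    exact (ENNReal.ofReal_lt_ofReal_iff one_pos).2 hsm
  · intro S hS τ z0 hτ hz0
    calc _ ≤ ∑' l : ℕ, ENNReal.ofReal (72 * γ) ^ l * (ENNReal.ofReal (κ / (κ - 1)) *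
          ∫⁻ x, (ENNReal.ofReal (2 / γ * 36 ^ l * τ ^ r) * S x) ^ (p / r)) := by
          refine ENNReal.tsum_le_tsum fun l => mul_le_mul le_rfl ?_ zero_le zero_le
          exact geo_vol z0 κ hz0 hκ _ ((hS.const_mul _).pow_const _)
      _ = ∑' l : ℕ, ENNReal.ofReal η ^ l * (ENNReal.ofReal (κ / (κ - 1)) *
          ENNReal.ofReal ((2 / γ) ^ (p / r)) * (ENNReal.ofReal (τ ^ p) * ∫⁻ x, S x ^ (p / r))) := by
          refine tsum_congr fun l => ?_
          simp only [ENNReal.mul_rpow_of_nonneg _ _ hθ.le]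
          rw [lintegral_const_mul' _ _ (ENNReal.rpow_ne_top_of_nonneg hθ.le ENNReal.ofReal_ne_top)]
          have e : ENNReal.ofReal (72 * γ) ^ l * ENNReal.ofReal (2 / γ * 36 ^ l * τ ^ r) ^ (p / r) =
              ENNReal.ofReal η ^ l * (ENNReal.ofReal ((2 / γ) ^ (p / r)) * ENNReal.ofReal (τ ^ p)) := by
            rw [ENNReal.ofReal_rpow_of_nonneg (by positivity) hθ.le, ← ENNReal.ofReal_pow (by positivity),
              ← ENNReal.ofReal_pow (by positivity), ← ENNReal.ofReal_mul (by positivity),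
              ← ENNReal.ofReal_mul (by positivity), ← ENNReal.ofReal_mul (by positivity)]
            congr 1
            have e36 : (((36:ℝ) ^ l)) ^ (p / r) = ((36:ℝ) ^ (p / r)) ^ l := by
              rw [← Real.rpow_natCast 36 l, ← Real.rpow_mul (by norm_num),
                ← Real.rpow_natCast ((36:ℝ) ^ (p / r)) l, ← Real.rpow_mul (by norm_num), mul_comm (l:ℝ)]
            rw [Real.mul_rpow (by positivity) (by positivity), Real.mul_rpow (by positivity) (by positivity),
              ← Real.rpow_mul hτ.le, mul_div_cancel₀ _ hr.ne', hη, e36, mul_pow (72 * γ) ((36:ℝ) ^ (p / r)) l]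
            ring
          set I := ∫⁻ x, S x ^ (p / r)
          calc _ = (ENNReal.ofReal (72 * γ) ^ l * ENNReal.ofReal (2 / γ * 36 ^ l * τ ^ r) ^ (p / r)) *
                (ENNReal.ofReal (κ / (κ - 1)) * I) := by ring
            _ = _ := by rw [e]; ring
      _ = _ := by rw [ENNReal.tsum_mul_right]; ring

lemma half_pt (p r γ z τ c m : ℝ) (l : ℕ) (hp : 0 < p) (hr : 0 < r) (hγ : 0 < γ) (hz : 0 < z)
    (hτ : 0 < τ) (hc : 0 < c) (hcm : c ^ r * z ^ (r / p) = m * τ ^ r) (S : ℝ≥0∞)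
    (h : (ENNReal.ofReal (2 / γ * 36 ^ l * τ ^ r) * S) ^ (p / r) ≤ ENNReal.ofReal z) :
    36 ^ l * (ENNReal.ofReal (c ^ r) * S) ≤ ENNReal.ofReal (γ * m / 2) := by
  have hτr : 0 < τ ^ r := Real.rpow_pos_of_pos hτ r
  have hcr : 0 < c ^ r := Real.rpow_pos_of_pos hc r
  have h1 : ENNReal.ofReal (2 / γ * 36 ^ l * τ ^ r) * S ≤ ENNReal.ofReal (z ^ (r / p)) := by
    have h2 := ENNReal.rpow_le_rpow h (show 0 ≤ r / p by positivity)
    rw [← ENNReal.rpow_mul, show p / r * (r / p) = 1 by field_simp, ENNReal.rpow_one,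
      ENNReal.ofReal_rpow_of_nonneg hz.le (by positivity)] at h2
    exact h2
  have e36 : (36 : ℝ≥0∞) ^ l = ENNReal.ofReal (36 ^ l) := by
    rw [ENNReal.ofReal_pow (by norm_num)]; simp
  calc 36 ^ l * (ENNReal.ofReal (c ^ r) * S)
      = ENNReal.ofReal (γ / 2 * c ^ r / τ ^ r) * (ENNReal.ofReal (2 / γ * 36 ^ l * τ ^ r) * S) := by
        rw [e36, ← mul_assoc, ← mul_assoc, ← ENNReal.ofReal_mul (by positivity),
          ← ENNReal.ofReal_mul (by positivity)]
        congr 2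
        field_simp
    _ ≤ ENNReal.ofReal (γ / 2 * c ^ r / τ ^ r) * ENNReal.ofReal (z ^ (r / p)) :=
        mul_le_mul le_rfl h1 zero_le zero_le
    _ = ENNReal.ofReal (γ * m / 2) := by
        rw [← ENNReal.ofReal_mul (by positivity)]
        congr 1
        rw [show γ / 2 * c ^ r / τ ^ r * z ^ (r / p) = γ / 2 * (c ^ r * z ^ (r / p)) / τ ^ r by ring, hcm]
        field_simp

lemma cpow (p r z τ m : ℝ) (hp : 0 < p) (hr : 0 < r) (hz : 0 < z) (hτ : 0 < τ) (hm : 0 < m) :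
    (m ^ (1 / r) * τ * z ^ (-(1 / p))) ^ r * z ^ (r / p) = m * τ ^ r := by
  rw [Real.mul_rpow (by positivity) (by positivity), Real.mul_rpow (by positivity) (by positivity),
    ← Real.rpow_mul hm.le, ← Real.rpow_mul hz.le, one_div_mul_cancel hr.ne', Real.rpow_one, mul_assoc,
    ← Real.rpow_add hz, show -(1 / p) * r + r / p = 0 by ring, Real.rpow_zero, mul_one]

lemma cdprod (p q r s lam τ m : ℝ) (hp : 0 < p) (hq : 0 < q) (hr : 0 < r) (hs : 0 < s) (hl : 0 < lam)
    (hτ : 0 < τ) (hm : 0 < m) (z : ℝ) (hz : z = (lam / 2 * m ^ (1 / r + 1 / s)) ^ (p * q / (p + q))) :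
    (m ^ (1 / r) * τ * z ^ (-(1 / p))) * (m ^ (1 / s) * τ⁻¹ * z ^ (-(1 / q))) * lam = 2 := by
  have hz0 : 0 < z := by rw [hz]; positivity
  have e : z ^ (-(1 / p)) * z ^ (-(1 / q)) = (lam / 2 * m ^ (1 / r + 1 / s))⁻¹ := by
    rw [← Real.rpow_add hz0, hz, ← Real.rpow_mul (by positivity),
      show p * q / (p + q) * (-(1 / p) + -(1 / q)) = -1 by field_simp; ring, Real.rpow_neg_one]
  calc _ = (m ^ (1 / r) * m ^ (1 / s)) * (τ * τ⁻¹) * (z ^ (-(1 / p)) * z ^ (-(1 / q))) * lam := by ring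
    _ = 2 := by
      rw [e, ← Real.rpow_add hm, mul_inv_cancel₀ hτ.ne']
      have : 0 < m ^ (1 / r + 1 / s) := by positivity
      field_simp

lemma theta_bd (p q r s : ℝ) (hp : 0 < p) (hq : 0 < q) (hr : 1 ≤ r) (hr2 : r ≤ 2) (hs : 1 ≤ s)
    (hs2 : s ≤ 2) (hne : r ≠ 1 ∨ s ≠ 1) : ∃ C : ℝ≥0∞, C ≠ ⊤ ∧ ∀ (F G : ℤ → ℝ → ℂ) (Sf Sg : ℝ → ℝ≥0∞),
    Measurable Sf → Measurable Sg → HasS r F Sf → HasS s G Sg → ∀ (Nk : ℕ → ℝ → ℤ),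
    (∀ k x, Nk k x ≤ Nk (k + 1) x) → ∀ lam τ : ℝ, 0 < lam → 0 < τ →
    ENNReal.ofReal (lam ^ (p * q / (p + q))) *
      ∫⁻ x, (({k : ℕ | lam < ‖bjump F G (Nk k x) (Nk (k + 1) x) x‖}.encard : ℕ∞) : ℝ≥0∞) ^
        ((1 / r + 1 / s) * (p * q / (p + q))) ≤
      C * (ENNReal.ofReal (τ ^ p) * (∫⁻ x, Sf x ^ (p / r)) +
        ENNReal.ofReal (τ⁻¹ ^ q) * (∫⁻ x, Sg x ^ (q / s))) := by
  have hr0 : 0 < r := by linarith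
  have hs0 : 0 < s := by linarith
  set u := p * q / (p + q) with hu
  have hu0 : 0 < u := by positivity
  set v := (1 / r + 1 / s) * u with hv
  have hv0 : 0 < v := by positivity
  set κ : ℝ := 2 ^ v with hκ
  have hκ1 : 1 < κ := Real.one_lt_rpow (by norm_num) hv0
  set γ : ℝ := 1 / (216 * 36 ^ (p + q)) with hγ
  have hP : 1 ≤ (36:ℝ) ^ (p + q) := Real.one_le_rpow (by norm_num) (by positivity)
  have hγ0 : 0 < γ := by positivity
  have hγ1 : γ ≤ 1 / 216 := by
    rw [hγ]; exact one_div_le_one_div_of_le (by norm_num) (by linarith)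
  have sm : ∀ e : ℝ, e ≤ p + q → 72 * γ * 36 ^ e < 1 := by
    intro e he
    have h1 : (36:ℝ) ^ e ≤ 36 ^ (p + q) := Real.rpow_le_rpow_of_exponent_le (by norm_num) he
    rw [hγ, show 72 * (1 / (216 * (36:ℝ) ^ (p + q))) * 36 ^ e = (36 ^ e / 36 ^ (p + q)) / 3 by
      field_simp; norm_num]
    have : (36:ℝ) ^ e / 36 ^ (p + q) ≤ 1 := div_le_one_of_le₀ h1 (by positivity)
    linarith
  have hpr : p / r ≤ p + q := by
    have : p / r ≤ p := div_le_self hp.le hr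
    linarith
  have hqs : q / s ≤ p + q := by
    have : q / s ≤ q := div_le_self hq.le hs
    linarith
  obtain ⟨C1, hC1, H1⟩ := half p r γ κ hp hr0 hγ0 hκ1 (sm _ hpr)
  obtain ⟨C2, hC2, H2⟩ := half q s γ κ hq hs0 hγ0 hκ1 (sm _ hqs)
  refine ⟨ENNReal.ofReal (2 ^ u) * 2 ^ v * (C1 + C2), ENNReal.mul_ne_top (ENNReal.mul_ne_top ENNReal.ofReal_ne_top
    (ENNReal.rpow_ne_top_of_nonneg hv0.le (by norm_num))) (ENNReal.add_ne_top.2 ⟨hC1, hC2⟩), ?_⟩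
  intro F G Sf Sg hSf hSg hF hG Nk hN lam τ hlam hτ
  set z0 : ℝ := (lam / 2) ^ u with hz0
  have hz00 : 0 < z0 := by positivity
  have hτi : 0 < τ⁻¹ := by positivity
  set V1 : ℕ → ℕ → ℝ≥0∞ := fun l k => volume {x | ENNReal.ofReal (z0 * κ ^ k) <
        (ENNReal.ofReal (2 / γ * 36 ^ l * τ ^ r) * Sf x) ^ (p / r)} with hV1
  set V2 : ℕ → ℕ → ℝ≥0∞ := fun l k => volume {x | ENNReal.ofReal (z0 * κ ^ k) <
        (ENNReal.ofReal (2 / γ * 36 ^ l * τ⁻¹ ^ s) * Sg x) ^ (q / s)} with hV2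
  have hzk : ∀ k : ℕ, z0 * κ ^ k = (lam / 2 * ((2:ℝ) ^ k) ^ (1 / r + 1 / s)) ^ u := by
    intro k
    rw [Real.mul_rpow (by positivity) (by positivity), hz0, ← Real.rpow_mul (by positivity), ← hv, hκ,
      ← Real.rpow_natCast, ← Real.rpow_natCast, ← Real.rpow_mul (by norm_num),
      ← Real.rpow_mul (by norm_num), mul_comm v]
  have lev : ∀ k : ℕ, volume {x | ((2 ^ k : ℕ) : ℕ∞) ≤
      {k : ℕ | lam < ‖bjump F G (Nk k x) (Nk (k + 1) x) x‖}.encard} ≤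
      ∑' l : ℕ, ENNReal.ofReal (72 * γ) ^ l * (V1 l k + V2 l k) := by
    intro k
    have hm : (0:ℝ) < 2 ^ k := by positivity
    have hzp : 0 < z0 * κ ^ k := by positivity
    have hc := cpow p r (z0 * κ ^ k) τ (2 ^ k) hp hr0 hzp hτ hm
    have hd := cpow q s (z0 * κ ^ k) τ⁻¹ (2 ^ k) hq hs0 hzp hτi hm
    have hcd := cdprod p q r s lam τ (2 ^ k) hp hq hr0 hs0 hlam hτ hm (z0 * κ ^ k) (hzk k)
    set c : ℝ := ((2:ℝ) ^ k) ^ (1 / r) * τ * (z0 * κ ^ k) ^ (-(1 / p)) with hcdef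
    set d : ℝ := ((2:ℝ) ^ k) ^ (1 / s) * τ⁻¹ * (z0 * κ ^ k) ^ (-(1 / q)) with hddef
    have hc0 : 0 < c := by positivity
    have hd0 : 0 < d := by positivity
    refine (dist_fin r s hr hr2 hs hs2 hne F G Sf Sg hF hG Nk hN lam hlam (2 ^ k) Nat.one_le_two_pow
      c d hc0 hd0 hcd γ hγ0 hγ1).trans ?_
    refine ENNReal.tsum_le_tsum fun l => mul_le_mul le_rfl ?_ zero_le zero_le
    refine (measure_mono ?_).trans (measure_union_le _ _)
    intro x hx
    by_contra hcon
    rw [Set.mem_union, not_or] at hcon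
    obtain ⟨n1, n2⟩ := hcon
    simp only [Set.mem_ofPred_eq, not_lt] at n1 n2 hx
    have b1 := half_pt p r γ (z0 * κ ^ k) τ c (2 ^ k) l hp hr0 hγ0 hzp hτ hc0 hc (Sf x) n1
    have b2 := half_pt q s γ (z0 * κ ^ k) τ⁻¹ d (2 ^ k) l hq hs0 hγ0 hzp hτi hd0 hd (Sg x) n2
    refine absurd hx (not_lt.2 ?_)
    rw [mul_add]
    refine (add_le_add b1 b2).trans (le_of_eq ?_)
    rw [← ENNReal.ofReal_add (by positivity) (by positivity)]
    congr 1
    push_cast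
    ring
  have hwt : ∀ k : ℕ, ENNReal.ofReal (lam ^ u) * ((2:ℝ≥0∞) ^ k) ^ v =
      ENNReal.ofReal (2 ^ u) * ENNReal.ofReal (z0 * κ ^ k) := by
    intro k
    have e2 : ((2:ℝ≥0∞) ^ k) ^ v = ENNReal.ofReal (κ ^ k) := by
      rw [show (2:ℝ≥0∞) = ENNReal.ofReal 2 by simp, ← ENNReal.ofReal_pow (by norm_num),
        ENNReal.ofReal_rpow_of_nonneg (by positivity) hv0.le, hκ]
      congr 1
      rw [← Real.rpow_natCast, ← Real.rpow_natCast, ← Real.rpow_mul (by norm_num),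
        ← Real.rpow_mul (by norm_num), mul_comm v]
    rw [e2, ← ENNReal.ofReal_mul (by positivity), ← ENNReal.ofReal_mul (by positivity)]
    congr 1
    rw [← mul_assoc, hz0, ← Real.mul_rpow (by norm_num) (by positivity)]
    congr 2
    ring
  have lay := layer (fun x => {k : ℕ | lam < ‖bjump F G (Nk k x) (Nk (k + 1) x) x‖}.encard) v hv0
  have t1 := H1 Sf hSf τ z0 hτ hz00
  have t2 := H2 Sg hSg τ⁻¹ z0 hτi hz00
  set If := ∫⁻ x, Sf x ^ (p / r)
  set Ig := ∫⁻ x, Sg x ^ (q / s)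
  calc _ ≤ ENNReal.ofReal (lam ^ u) * (2 ^ v * ∑' k : ℕ, ((2:ℝ≥0∞) ^ k) ^ v *
        ∑' l : ℕ, ENNReal.ofReal (72 * γ) ^ l * (V1 l k + V2 l k)) := by
        refine mul_le_mul le_rfl (lay.trans ?_) zero_le zero_le
        refine mul_le_mul le_rfl ?_ zero_le zero_le
        exact ENNReal.tsum_le_tsum fun k => mul_le_mul le_rfl (lev k) zero_le zero_le
    _ = 2 ^ v * ∑' k : ℕ, (ENNReal.ofReal (2 ^ u) * ENNReal.ofReal (z0 * κ ^ k)) *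
        ∑' l : ℕ, ENNReal.ofReal (72 * γ) ^ l * (V1 l k + V2 l k) := by
        rw [mul_left_comm, ← ENNReal.tsum_mul_left]
        congr 1
        refine tsum_congr fun k => ?_
        rw [← mul_assoc, hwt]
    _ = ENNReal.ofReal (2 ^ u) * 2 ^ v * ∑' k : ℕ, ∑' l : ℕ, ENNReal.ofReal (72 * γ) ^ l *
          (ENNReal.ofReal (z0 * κ ^ k) * V1 l k + ENNReal.ofReal (z0 * κ ^ k) * V2 l k) := by
        have e : ∀ k : ℕ, (ENNReal.ofReal (2 ^ u) * ENNReal.ofReal (z0 * κ ^ k)) *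
            ∑' l : ℕ, ENNReal.ofReal (72 * γ) ^ l * (V1 l k + V2 l k) =
            ENNReal.ofReal (2 ^ u) * ∑' l : ℕ, ENNReal.ofReal (72 * γ) ^ l *
              (ENNReal.ofReal (z0 * κ ^ k) * V1 l k + ENNReal.ofReal (z0 * κ ^ k) * V2 l k) := by
          intro k
          rw [mul_assoc, ← ENNReal.tsum_mul_left]
          refine congrArg _ (tsum_congr fun l => ?_)
          ring
        rw [tsum_congr e, ENNReal.tsum_mul_left]
        ring
    _ = ENNReal.ofReal (2 ^ u) * 2 ^ v *
        ((∑' l : ℕ, ENNReal.ofReal (72 * γ) ^ l * ∑' k : ℕ, ENNReal.ofReal (z0 * κ ^ k) * V1 l k) +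
        ∑' l : ℕ, ENNReal.ofReal (72 * γ) ^ l * ∑' k : ℕ, ENNReal.ofReal (z0 * κ ^ k) * V2 l k) := by
        rw [ENNReal.tsum_comm, ← ENNReal.tsum_add]
        congr 1
        refine tsum_congr fun l => ?_
        rw [← mul_add, ← ENNReal.tsum_add, ENNReal.tsum_mul_left]
    _ ≤ ENNReal.ofReal (2 ^ u) * 2 ^ v * (C1 * (ENNReal.ofReal (τ ^ p) * If) +
          C2 * (ENNReal.ofReal (τ⁻¹ ^ q) * Ig)) :=
        mul_le_mul le_rfl (add_le_add t1 t2) zero_le zero_le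
    _ ≤ ENNReal.ofReal (2 ^ u) * 2 ^ v * ((C1 + C2) * (ENNReal.ofReal (τ ^ p) * If +
          ENNReal.ofReal (τ⁻¹ ^ q) * Ig)) := by
        refine mul_le_mul le_rfl ?_ zero_le zero_le
        rw [mul_add (C1 + C2)]
        exact add_le_add (mul_le_mul le_self_add le_rfl zero_le zero_le)
          (mul_le_mul le_add_self le_rfl zero_le zero_le)
    _ = _ := by ring

lemma opt_real (p q : ℝ) (hp : 0 < p) (hq : 0 < q) (a b : ℝ) (ha : 0 < a) (hb : 0 < b) :
    ∃ τ : ℝ, 0 < τ ∧ τ ^ p * a ^ p = (a * b) ^ (p * q / (p + q)) ∧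
      τ⁻¹ ^ q * b ^ q = (a * b) ^ (p * q / (p + q)) := by
  have hab : 0 < a * b := by positivity
  refine ⟨(a * b) ^ (q / (p + q)) / a, by positivity, ?_, ?_⟩
  · rw [← Real.mul_rpow (by positivity) ha.le, div_mul_cancel₀ _ ha.ne', ← Real.rpow_mul hab.le]
    congr 1
    ring
  · rw [← Real.mul_rpow (by positivity) hb.le, inv_div, div_mul_eq_mul_div]
    have : a * b / (a * b) ^ (q / (p + q)) = (a * b) ^ (1 - q / (p + q)) := by
      rw [Real.rpow_sub hab, Real.rpow_one]
    rw [this, ← Real.rpow_mul hab.le]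
    congr 1
    field_simp
    ring

lemma opt (p q : ℝ) (hp : 0 < p) (hq : 0 < q) (A B L C : ℝ≥0∞) (hA : A ≠ ⊤) (hB : B ≠ ⊤) (hC : C ≠ ⊤)
    (h : ∀ τ : ℝ, 0 < τ → L ≤ C * (ENNReal.ofReal (τ ^ p) * A ^ p + ENNReal.ofReal (τ⁻¹ ^ q) * B ^ q)) :
    L ≤ 2 * C * (A * B) ^ (p * q / (p + q)) := by
  have hu : 0 < p * q / (p + q) := by positivity
  have key : ∀ ε : ℝ, 0 < ε → L ≤ 2 * C *
      ENNReal.ofReal (((A.toReal + ε) * (B.toReal + ε)) ^ (p * q / (p + q))) := by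
    intro ε hε
    have hA0 : 0 ≤ A.toReal := ENNReal.toReal_nonneg
    have hB0 : 0 ≤ B.toReal := ENNReal.toReal_nonneg
    have ha : 0 < A.toReal + ε := by linarith
    have hb : 0 < B.toReal + ε := by linarith
    obtain ⟨τ, hτ, e1, e2⟩ := opt_real p q hp hq _ _ ha hb
    refine (h τ hτ).trans ?_
    have hA1 : A ≤ ENNReal.ofReal (A.toReal + ε) := by
      rw [← ENNReal.ofReal_toReal hA]
      exact ENNReal.ofReal_le_ofReal (by rw [ENNReal.toReal_ofReal hA0]; linarith)
    have hB1 : B ≤ ENNReal.ofReal (B.toReal + ε) := by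
      rw [← ENNReal.ofReal_toReal hB]
      exact ENNReal.ofReal_le_ofReal (by rw [ENNReal.toReal_ofReal hB0]; linarith)
    have f1 : ENNReal.ofReal (τ ^ p) * A ^ p ≤
        ENNReal.ofReal (((A.toReal + ε) * (B.toReal + ε)) ^ (p * q / (p + q))) := by
      rw [← e1, ENNReal.ofReal_mul (by positivity), ← ENNReal.ofReal_rpow_of_nonneg ha.le hp.le]
      exact mul_le_mul le_rfl (ENNReal.rpow_le_rpow hA1 hp.le) zero_le zero_le
    have f2 : ENNReal.ofReal (τ⁻¹ ^ q) * B ^ q ≤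
        ENNReal.ofReal (((A.toReal + ε) * (B.toReal + ε)) ^ (p * q / (p + q))) := by
      rw [← e2, ENNReal.ofReal_mul (by positivity), ← ENNReal.ofReal_rpow_of_nonneg hb.le hq.le]
      exact mul_le_mul le_rfl (ENNReal.rpow_le_rpow hB1 hq.le) zero_le zero_le
    refine (mul_le_mul le_rfl (add_le_add f1 f2) zero_le zero_le).trans (le_of_eq ?_)
    ring
  have lim : Filter.Tendsto (fun ε : ℝ => 2 * C *
      ENNReal.ofReal (((A.toReal + ε) * (B.toReal + ε)) ^ (p * q / (p + q))))
      (nhdsWithin 0 (Set.Ioi 0)) (nhds (2 * C *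
      ENNReal.ofReal (((A.toReal + 0) * (B.toReal + 0)) ^ (p * q / (p + q))))) := by
    refine ENNReal.Tendsto.const_mul ?_ (Or.inr (ENNReal.mul_ne_top (by norm_num) hC))
    refine ENNReal.tendsto_ofReal ?_
    have hc : Continuous (fun ε : ℝ => ((A.toReal + ε) * (B.toReal + ε)) ^ (p * q / (p + q))) := by
      refine Continuous.rpow_const (by fun_prop) fun _ => Or.inr hu.le
    exact (hc.tendsto 0).mono_left nhdsWithin_le_nhds
  have := ge_of_tendsto lim (by
    filter_upwards [self_mem_nhdsWithin] with ε hε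
    exact key ε hε)
  refine this.trans (le_of_eq ?_)
  rw [add_zero, add_zero, ← ENNReal.toReal_mul, ← ENNReal.ofReal_rpow_of_nonneg ENNReal.toReal_nonneg hu.le,
    ENNReal.ofReal_toReal (ENNReal.mul_ne_top hA hB)]

/-- Weak-type (jump counting) bilinear variational paraproduct estimate at the endpoint
`max(r,s) = 2`, `t = rs/(r+s)`, for general (not necessarily band-limited) families. -/
theorem bilinear_weak_jump_paraproduct_nonband
    (p q r s t Nb : ℝ) (hp : 1 < p) (hq : 1 < q)
    (hr1 : 1 ≤ r) (hr2 : r ≤ 2) (hs1 : 1 ≤ s) (hs2 : s ≤ 2)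
    (hmax : max r s = 2) (ht : t = r * s / (r + s)) (hNb : 0 < Nb)
    (φ : SchwartzMap ℝ ℂ)
    (hφ : ∀ ξ : ℝ, 𝓕 (⇑φ) ξ ≠ 0 → (2 : ℝ) ^ (-Nb) < |ξ| ∧ |ξ| < (2 : ℝ) ^ Nb) :
    ∃ C : ℝ≥0, 0 < C ∧
      ∀ (f g : ℤ → ℝ → ℂ),
      (∀ i, Measurable (f i)) → (∀ j, Measurable (g j)) →
      mixedNorm p r f < ⊤ → mixedNorm q s g < ⊤ →
      ∀ (Nk : ℕ → ℝ → ℤ), IsJumpCollection Nk →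
      ∀ lam : ℝ, 0 < lam →
      (∫⁻ x : ℝ,
          (ENNReal.ofReal lam *
            (({k : ℕ | lam <
                ‖(∑ j ∈ Finset.Ioc (Nk k x) (Nk (k + 1) x),
                  ∑ i ∈ Finset.Ioo (Nk k x) j,
                    conv (dilate φ i) (f i) x * conv (dilate φ j) (g j) x)‖}.encard
              : ℝ≥0∞)) ^ (1 / t)) ^ (p * q / (p + q))) ^ ((p + q) / (p * q))
        ≤ (C : ℝ≥0∞) * mixedNorm p r f * mixedNorm q s g := by
  obtain ⟨C, hC, k1, k2, k3⟩ := schwartz_bds φ (schwartz_zero_mean φ Nb hφ)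
  have hK : KB φ C := ⟨hC, k1, k2, k3⟩
  have hp0 : 0 < p := by linarith
  have hq0 : 0 < q := by linarith
  have hr0 : 0 < r := by linarith
  have hs0 : 0 < s := by linarith
  have hne : r ≠ 1 ∨ s ≠ 1 := by
    by_contra hcon
    push Not at hcon
    rw [hcon.1, hcon.2] at hmax
    norm_num at hmax
  obtain ⟨Cf, hCf, Tf⟩ := transfer hK p r hp hr1
  obtain ⟨Cg, hCg, Tg⟩ := transfer hK q s hq hs1
  obtain ⟨C0, hC0, H⟩ := theta_bd p q r s hp0 hq0 hr1 hr2 hs1 hs2 hne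
  have hu : 0 < p * q / (p + q) := by positivity
  have hui : 0 < (p + q) / (p * q) := by positivity
  have ht1 : 1 / t = 1 / r + 1 / s := by rw [ht]; field_simp; ring
  set D : ℝ≥0∞ := 2 * (C0 * (Cf + Cg)) with hD
  have hCC : C0 * (Cf + Cg) ≠ ⊤ := ENNReal.mul_ne_top hC0 (ENNReal.add_ne_top.2 ⟨hCf, hCg⟩)
  have hDt : D ≠ ⊤ := ENNReal.mul_ne_top (by norm_num) hCC
  have hDu : D ^ ((p + q) / (p * q)) ≠ ⊤ := ENNReal.rpow_ne_top_of_nonneg hui.le hDt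
  refine ⟨(D ^ ((p + q) / (p * q))).toNNReal + 1, by positivity, ?_⟩
  intro f g hf hg hfn hgn Nk hN lam hlam
  obtain ⟨Sf, mSf, iSf, hSf⟩ := Tf f hf hfn
  obtain ⟨Sg, mSg, iSg, hSg⟩ := Tg g hg hgn
  set A := mixedNorm p r f
  set B := mixedNorm q s g
  set F : ℤ → ℝ → ℂ := fun i => conv (dilate φ i) (f i) with hF
  set G : ℤ → ℝ → ℂ := fun i => conv (dilate φ i) (g i) with hG
  have e1 : (∫⁻ x : ℝ, (ENNReal.ofReal lam *
            (({k : ℕ | lam <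
                ‖(∑ j ∈ Finset.Ioc (Nk k x) (Nk (k + 1) x),
                  ∑ i ∈ Finset.Ioo (Nk k x) j,
                    conv (dilate φ i) (f i) x * conv (dilate φ j) (g j) x)‖}.encard
              : ℝ≥0∞)) ^ (1 / t)) ^ (p * q / (p + q))) =
      ENNReal.ofReal (lam ^ (p * q / (p + q))) *
      ∫⁻ x, (({k : ℕ | lam < ‖bjump F G (Nk k x) (Nk (k + 1) x) x‖}.encard : ℕ∞) : ℝ≥0∞) ^
        ((1 / r + 1 / s) * (p * q / (p + q))) := by
    rw [← lintegral_const_mul' _ _ ENNReal.ofReal_ne_top]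
    refine lintegral_congr fun x => ?_
    rw [ENNReal.mul_rpow_of_nonneg _ _ hu.le, ENNReal.ofReal_rpow_of_nonneg hlam.le hu.le,
      ← ENNReal.rpow_mul, ht1]
    rfl
  have main := opt p q hp0 hq0 A B _ (C0 * (Cf + Cg)) hfn.ne hgn.ne hCC (fun τ hτ => by
    refine (H F G Sf Sg mSf mSg hSf hSg Nk hN.2 lam τ hlam hτ).trans ?_
    rw [mul_assoc]
    refine mul_le_mul le_rfl ?_ zero_le zero_le
    rw [mul_add]
    refine add_le_add ?_ ?_
    · calc _ ≤ ENNReal.ofReal (τ ^ p) * (Cf * A ^ p) := mul_le_mul le_rfl iSf zero_le zero_le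
        _ = Cf * (ENNReal.ofReal (τ ^ p) * A ^ p) := by ring
        _ ≤ _ := mul_le_mul le_self_add le_rfl zero_le zero_le
    · calc _ ≤ ENNReal.ofReal (τ⁻¹ ^ q) * (Cg * B ^ q) := mul_le_mul le_rfl iSg zero_le zero_le
        _ = Cg * (ENNReal.ofReal (τ⁻¹ ^ q) * B ^ q) := by ring
        _ ≤ _ := mul_le_mul le_add_self le_rfl zero_le zero_le)
  rw [e1]
  refine (ENNReal.rpow_le_rpow main hui.le).trans ?_
  rw [ENNReal.mul_rpow_of_nonneg _ _ hui.le, ← ENNReal.rpow_mul,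
    show p * q / (p + q) * ((p + q) / (p * q)) = 1 by field_simp, ENNReal.rpow_one, mul_assoc _ A B]
  refine mul_le_mul ?_ le_rfl zero_le zero_le
  rw [ENNReal.coe_add, ENNReal.coe_toNNReal hDu]
  exact le_self_add

end
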